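/- Let 𝓛 ⊂ ℂ be a lattice, ω a half-period, η = ζ(ω), and assume η + ωe_j ≠ 0 for j = 1,2,3 and u(k*) ≠ 0 where η + ω℘(k*) = 0 and u(k) = Re[ηk − ωζ(k)]. Then the spectrum of the complex Lamé operator L = −d²/dx² + 2ω²℘(ωx+z₀) in L²(ℝ) consists of exactly two non-intersecting regular analytic arcs; precisely one arc extends to infinity, and the remaining three endpoints of the arcs are the points −ω²e₁, −ω²e₂, −ω²e₃. -/

import Mathlib

open Complex Set Filter

noncomputable section

/-- The period lattice with half-periods `w1`, `w3`, i.e. the set of all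
`2 m w1 + 2 n w3` with `m n : ℤ`. -/
def latticeSet (w1 w3 : ℂ) : Set ℂ := {z | ∃ m n : ℤ, z = 2 * m * w1 + 2 * n * w3}

/-- Weierstrass data for a lattice `𝓛` with basic half-periods `w1`, `w3`:
the functions `℘` (denoted `P`), `ζ` (denoted `Z`) and `σ` (denoted `S`),
characterized up to uniqueness by their standard analytic properties:
`℘` is `𝓛`-periodic, holomorphic off `𝓛`, with `℘(z) - 1/z² → 0` as `z → 0`;
`ζ` is odd with `ζ' = -℘`; `σ` is entire, non-vanishing off `𝓛`, with
`σ'/σ = ζ` and `σ(z)/z → 1` as `z → 0`. -/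
structure WeierstrassData where
  w1 : ℂ
  w3 : ℂ
  P : ℂ → ℂ
  Z : ℂ → ℂ
  S : ℂ → ℂ
  w1_ne : w1 ≠ 0
  indep : ∀ r : ℝ, w3 ≠ (r : ℂ) * w1
  P_diff : ∀ z ∉ latticeSet w1 w3, DifferentiableAt ℂ P z
  P_periodic : ∀ w ∈ latticeSet w1 w3, ∀ z, P (z + w) = P z
  P_pole : Tendsto (fun z => P z - 1 / z ^ 2) (nhdsWithin 0 {(0 : ℂ)}ᶜ) (nhds 0)
  Z_diff : ∀ z ∉ latticeSet w1 w3, DifferentiableAt ℂ Z z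
  Z_deriv : ∀ z ∉ latticeSet w1 w3, deriv Z z = -P z
  Z_odd : ∀ z, Z (-z) = -Z z
  S_diff : Differentiable ℂ S
  S_ne : ∀ z ∉ latticeSet w1 w3, S z ≠ 0
  S_deriv : ∀ z ∉ latticeSet w1 w3, deriv S z = Z z * S z
  S_norm : Tendsto (fun z => S z / z) (nhdsWithin 0 {(0 : ℂ)}ᶜ) (nhds 1)

namespace WeierstrassData

variable (W : WeierstrassData)

/-- The period lattice of `W`. -/
def lattice : Set ℂ := latticeSet W.w1 W.w3

/-- The third basic half-period `ω₂ = ω₁ + ω₃`. -/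
def w2 : ℂ := W.w1 + W.w3

/-- `e₁ = ℘(ω₁)`. -/
def e1 : ℂ := W.P W.w1
/-- `e₂ = ℘(ω₂)`. -/
def e2 : ℂ := W.P W.w2
/-- `e₃ = ℘(ω₃)`. -/
def e3 : ℂ := W.P W.w3

/-- The Rofe-Beketov spectrum of the complex Lamé operator
`L = -d²/dx² + m(m+1) ω² ℘(ωx + z₀)` in `L²(ℝ)`: the set of `λ ∈ ℂ` for which
the equation `Lψ = λψ` has a nonzero bounded solution on the whole real line. -/
def lameSpectrum (m : ℕ) (ω z0 : ℂ) : Set ℂ :=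
  {lam | ∃ φ : ℝ → ℂ, φ ≠ 0 ∧ ContDiff ℝ 2 φ ∧
    (∀ x : ℝ, -deriv (deriv φ) x + (m * (m + 1) : ℂ) * ω ^ 2 * W.P (ω * x + z0) * φ x
      = lam * φ x) ∧ ∃ C : ℝ, ∀ x : ℝ, ‖φ x‖ ≤ C}

/-- The function `u(k) = Re[η k - ω ζ(k)]`, where `η = ζ(ω)`. -/
def uFun (ω : ℂ) : ℂ → ℝ := fun k => (W.Z ω * k - ω * W.Z k).re

/-- The function `v(k) = Im[η k - ω ζ(k)]`, where `η = ζ(ω)`. -/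
def vFun (ω : ℂ) : ℂ → ℝ := fun k => (W.Z ω * k - ω * W.Z k).im

end WeierstrassData

namespace Lame
open scoped Topology

variable (W : WeierstrassData)

/-- The Mathlib period pair attached to Weierstrass data. -/
def pp : PeriodPair where
  ω₁ := 2 * W.w1
  ω₂ := 2 * W.w3
  indep := by
    rw [LinearIndependent.pair_iff' (by simp [W.w1_ne])]
    intro a h
    apply W.indep a
    have h2 : (2:ℂ) * W.w3 = 2 * (a * W.w1) := by
      rw [← h]; simp; ring
    exact mul_left_cancel₀ two_ne_zero h2

lemma lat_iff (z : ℂ) : z ∈ W.lattice ↔ z ∈ (pp W).lattice := by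
  rw [PeriodPair.mem_lattice]
  constructor
  · rintro ⟨m, n, h⟩; exact ⟨m, n, by rw [h]; simp [pp]; ring⟩
  · rintro ⟨m, n, h⟩; exact ⟨m, n, by rw [← h]; simp [pp]; ring⟩

lemma lat_eq : W.lattice = ((pp W).lattice : Set ℂ) := by
  ext z; exact lat_iff W z

variable {W}

lemma zero_mem : (0:ℂ) ∈ W.lattice := by rw [lat_iff]; exact Submodule.zero_mem _
lemma add_mem {a b : ℂ} (ha : a ∈ W.lattice) (hb : b ∈ W.lattice) : a + b ∈ W.lattice := by
  rw [lat_iff] at *; exact Submodule.add_mem _ ha hb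
lemma neg_mem {a : ℂ} (ha : a ∈ W.lattice) : -a ∈ W.lattice := by
  rw [lat_iff] at *; exact Submodule.neg_mem _ ha
lemma neg_mem_iff {a : ℂ} : -a ∈ W.lattice ↔ a ∈ W.lattice :=
  ⟨fun h => by simpa using neg_mem h, neg_mem⟩
lemma sub_mem {a b : ℂ} (ha : a ∈ W.lattice) (hb : b ∈ W.lattice) : a - b ∈ W.lattice := by
  rw [sub_eq_add_neg]; exact add_mem ha (neg_mem hb)
lemma add_mem_iff {z l : ℂ} (hl : l ∈ W.lattice) : z + l ∈ W.lattice ↔ z ∈ W.lattice :=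
  ⟨fun h => by simpa using sub_mem h hl, fun h => add_mem h hl⟩
lemma sub_mem_iff {z l : ℂ} (hl : l ∈ W.lattice) : z - l ∈ W.lattice ↔ z ∈ W.lattice := by
  rw [sub_eq_add_neg]; exact add_mem_iff (neg_mem hl)
lemma sub_mem_iff' {z l : ℂ} (hl : l ∈ W.lattice) : l - z ∈ W.lattice ↔ z ∈ W.lattice := by
  rw [sub_eq_add_neg, add_comm, add_mem_iff hl, neg_mem_iff]

lemma lat_closed : IsClosed W.lattice := by rw [lat_eq]; exact (pp W).isClosed_lattice
lemma lat_open : IsOpen (W.lattice)ᶜ := lat_closed.isOpen_compl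

lemma lat_countable : (W.lattice).Countable := by
  rw [lat_eq]
  exact Set.countable_coe_iff.mp (inferInstanceAs (Countable (pp W).lattice))

lemma lat_conn : IsPreconnected (W.lattice)ᶜ :=
  (lat_countable.isPathConnected_compl_of_one_lt_rank (by simp)).isConnected.isPreconnected

lemma ev_notMem (z : ℂ) : ∀ᶠ y in 𝓝[≠] z, y ∉ W.lattice := by
  have := (pp W).compl_lattice_sdiff_singleton_mem_nhds z
  filter_upwards [mem_nhdsWithin_of_mem_nhds this, self_mem_nhdsWithin] with y hy hy2 h
  rw [lat_eq] at h
  exact hy ⟨h, hy2⟩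

lemma ev_notMem' {z : ℂ} (hz : z ∉ W.lattice) : ∀ᶠ y in 𝓝 z, y ∉ W.lattice :=
  lat_open.mem_nhds hz

lemma exists_sep : ∃ δ > 0, ∀ l ∈ W.lattice, ‖l‖ < δ → l = 0 := by
  have := ev_notMem (W := W) 0
  rw [eventually_nhdsWithin_iff, Metric.eventually_nhds_iff] at this
  obtain ⟨δ, hδ, h⟩ := this
  refine ⟨δ, hδ, fun l hl hn => ?_⟩
  by_contra h0
  exact h (by simpa using hn) h0 hl

lemma exists_reduce : ∃ R : ℝ, ∀ z : ℂ, ∃ l ∈ W.lattice, ‖z + l‖ ≤ R := by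
  obtain ⟨R, hR⟩ := (ZSpan.fundamentalDomain_isBounded (pp W).basis).subset_closedBall 0
  refine ⟨R, fun z => ⟨-(ZSpan.floor (pp W).basis z : ℂ), ?_, ?_⟩⟩
  · apply neg_mem
    rw [lat_iff, PeriodPair.lattice_eq_span_range_basis]
    exact (ZSpan.floor (pp W).basis z).2
  · have := hR (ZSpan.fract_mem_fundamentalDomain (pp W).basis z)
    rw [ZSpan.fract_apply] at this
    simpa [sub_eq_add_neg] using this

/-- Liouville for functions with removable singularities, periodic. -/
lemma liouville (f : ℂ → ℂ)
    (hd : ∀ z, (∀ᶠ y in 𝓝[≠] z, DifferentiableAt ℂ f y))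
    (hl : ∀ z, ∃ c, Tendsto f (𝓝[≠] z) (𝓝 c))
    (hp : ∀ l ∈ W.lattice, ∀ z, ∀ᶠ y in 𝓝[≠] z, f (y + l) = f y) :
    ∃ c, ∀ z, Tendsto f (𝓝[≠] z) (𝓝 c) := by
  choose g hg using hl
  have key : ∀ z, Function.update f z (g z) =ᶠ[𝓝 z] g := by
    intro z
    have h1 := hd z
    have h2 : ∀ᶠ y in 𝓝[≠] z, f y = g y := by
      filter_upwards [h1] with y hy
      exact tendsto_nhds_unique (hy.continuousAt.tendsto.mono_left nhdsWithin_le_nhds) (hg y)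
    rw [eventually_nhdsWithin_iff] at h2
    filter_upwards [h2] with y hy
    by_cases h : y = z
    · subst h; simp
    · rw [Function.update_of_ne h]; exact hy h
  have hgd : Differentiable ℂ g := by
    intro z
    have : AnalyticAt ℂ (Function.update f z (g z)) z := by
      apply analyticAt_of_differentiable_on_punctured_nhds_of_continuousAt
      · have h1 := hd z
        filter_upwards [h1, self_mem_nhdsWithin] with y hy hy2
        refine hy.congr_of_eventuallyEq ?_
        filter_upwards [isOpen_ne.mem_nhds hy2] with x hx
        rw [Function.update_of_ne hx]
      · rw [continuousAt_update_same]; exact hg z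
    exact (this.congr (key z)).differentiableAt
  have hgp : ∀ l ∈ W.lattice, ∀ z, g (z + l) = g z := by
    intro l hlm z
    have h1 : Tendsto (fun y => f (y + l)) (𝓝[≠] z) (𝓝 (g (z + l))) := by
      refine (hg (z + l)).comp ?_
      refine tendsto_nhdsWithin_of_tendsto_nhds_of_eventually_within _ ?_ ?_
      · exact ((continuous_id.add continuous_const).tendsto z).mono_left nhdsWithin_le_nhds
      · filter_upwards [self_mem_nhdsWithin] with y hy
        simpa using hy
    exact tendsto_nhds_unique h1 ((hg z).congr' (by
      filter_upwards [hp l hlm z] with y hy using hy.symm))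
  have hb : Bornology.IsBounded (range g) := by
    obtain ⟨R, hR⟩ := exists_reduce (W := W)
    refine ((isCompact_closedBall (0:ℂ) R).image hgd.continuous).isBounded.subset ?_
    rintro _ ⟨z, rfl⟩
    obtain ⟨l, hl, h⟩ := hR z
    exact ⟨z + l, by simpa using h, hgp l hl z⟩
  refine ⟨g 0, fun z => ?_⟩
  rw [← hgd.apply_eq_apply_of_bounded hb z 0]
  exact hg z

/-- A function with vanishing derivative off the lattice is constant. -/
lemma const_off (f : ℂ → ℂ) (h : ∀ z ∉ W.lattice, HasDerivAt f 0 z) {a b : ℂ}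
    (ha : a ∉ W.lattice) (hb : b ∉ W.lattice) : f a = f b := by
  apply lat_open.is_const_of_deriv_eq_zero (𝕜 := ℂ) lat_conn
    (fun z hz => (h z hz).differentiableAt.differentiableWithinAt)
    (fun z hz => (h z hz).deriv) ha hb

end Lame

namespace Lame
open scoped Topology

variable {W : WeierstrassData}

lemma w1_notMem : W.w1 ∉ W.lattice := by
  have := (pp W).ω₁_div_two_notMem_lattice
  rw [lat_iff]; simpa [pp] using this

lemma w3_notMem : W.w3 ∉ W.lattice := by
  have := (pp W).ω₂_div_two_notMem_lattice
  rw [lat_iff]; simpa [pp] using this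

lemma w2_notMem : W.w2 ∉ W.lattice := by
  have := ((pp W).mul_ω₁_add_mul_ω₂_mem_lattice (α := 1 / 2) (β := 1 / 2)).not.mpr (by norm_num)
  rw [lat_iff]
  convert this using 2
  simp [pp, WeierstrassData.w2]

lemma Z_hd {z : ℂ} (hz : z ∉ W.lattice) : HasDerivAt W.Z (-W.P z) z := by
  rw [← W.Z_deriv z hz]; exact (W.Z_diff z hz).hasDerivAt

lemma S_hd {z : ℂ} (hz : z ∉ W.lattice) : HasDerivAt W.S (W.Z z * W.S z) z := by
  rw [← W.S_deriv z hz]; exact (W.S_diff z).hasDerivAt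

lemma P_an {z : ℂ} (hz : z ∉ W.lattice) : AnalyticAt ℂ W.P z :=
  DifferentiableOn.analyticAt (s := (W.lattice)ᶜ)
    (fun y hy => (W.P_diff y hy).differentiableWithinAt) (lat_open.mem_nhds hz)

lemma Z_an {z : ℂ} (hz : z ∉ W.lattice) : AnalyticAt ℂ W.Z z :=
  DifferentiableOn.analyticAt (s := (W.lattice)ᶜ)
    (fun y hy => (W.Z_diff y hy).differentiableWithinAt) (lat_open.mem_nhds hz)

lemma S_an (z : ℂ) : AnalyticAt ℂ W.S z := W.S_diff.analyticAt z

lemma P_even {z : ℂ} (hz : z ∉ W.lattice) : W.P (-z) = W.P z := by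
  have h1 : HasDerivAt (fun z => W.Z (-z)) (-(-W.P (-z))) z := by
    have := (Z_hd (W := W) (z := -z) (by rwa [neg_mem_iff])).comp z (hasDerivAt_neg z)
    simpa [Function.comp_def] using this
  have h2 : HasDerivAt (fun z => W.Z (-z)) (-(-W.P z)) z := by
    have : (fun z => W.Z (-z)) = fun z => - W.Z z := by ext z; exact W.Z_odd z
    rw [this]; exact (Z_hd hz).neg
  simpa using h1.unique h2

lemma P_per {l : ℂ} (hl : l ∈ W.lattice) (z : ℂ) : W.P (z + l) = W.P z := W.P_periodic l hl z

/-- The quasi-period of `ζ`. -/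
def hq (W : WeierstrassData) (l : ℂ) : ℂ := W.Z (W.w1 + l) - W.Z W.w1

lemma Z_qper {l : ℂ} (hl : l ∈ W.lattice) {z : ℂ} (hz : z ∉ W.lattice) :
    W.Z (z + l) = W.Z z + hq W l := by
  have := const_off (W := W) (fun z => W.Z (z + l) - W.Z z) (fun z hz => by
    have h1 : HasDerivAt (fun z => W.Z (z + l)) (-W.P (z + l)) z := by
      have := (Z_hd (W := W) (z := z + l) (by rwa [add_mem_iff hl])).comp z
        ((hasDerivAt_id z).add_const l)
      simpa [Function.comp_def] using this
    have := h1.sub (Z_hd hz)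
    rw [P_per hl, sub_self] at this
    exact this) hz w1_notMem
  rw [hq, ← this]; ring

lemma hq_add {l l' : ℂ} (hl : l ∈ W.lattice) (hl' : l' ∈ W.lattice) :
    hq W (l + l') = hq W l + hq W l' := by
  have h1 := Z_qper (add_mem hl hl') (w1_notMem (W := W))
  have h2 := Z_qper hl (w1_notMem (W := W))
  have h3 := Z_qper hl' (z := W.w1 + l) (by rw [add_mem_iff hl]; exact w1_notMem)
  rw [← add_assoc, h3, h2] at h1
  linear_combination -h1

lemma hq_half {w : ℂ} (h2 : 2 * w ∈ W.lattice) (h : w ∉ W.lattice) : hq W (2 * w) = 2 * W.Z w := by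
  have h1 := Z_qper h2 (z := -w) (by rwa [neg_mem_iff])
  rw [W.Z_odd, show -w + 2 * w = w by ring] at h1
  linear_combination -h1

lemma S_qper {l : ℂ} (hl : l ∈ W.lattice) : ∃ A : ℂ, A ≠ 0 ∧
    ∀ z, W.S (z + l) = A * exp (hq W l * z) * W.S z := by
  have key : ∀ z ∉ W.lattice, ∀ y ∉ W.lattice,
      W.S (z + l) / (exp (hq W l * z) * W.S z) = W.S (y + l) / (exp (hq W l * y) * W.S y) := by
    intro z hz y hy
    refine const_off (W := W) (fun z => W.S (z + l) / (exp (hq W l * z) * W.S z))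
      (fun z hz => ?_) hz hy
    have h1 : HasDerivAt (fun z => W.S (z + l)) (W.Z (z + l) * W.S (z + l)) z := by
      have := (S_hd (W := W) (z := z + l) (by rwa [add_mem_iff hl])).comp z
        ((hasDerivAt_id z).add_const l)
      simpa [Function.comp_def] using this
    have h2 : HasDerivAt (fun z => exp (hq W l * z)) (exp (hq W l * z) * hq W l) z := by
      have := ((hasDerivAt_id z).const_mul (hq W l)).cexp
      simpa using this
    have h3 := h1.div (h2.mul (S_hd hz)) (mul_ne_zero (exp_ne_zero _) (W.S_ne z hz))
    refine h3.congr_deriv ?_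
    rw [Z_qper hl hz]
    rw [div_eq_zero_iff]; left
    simp only [Pi.mul_apply]; ring
  refine ⟨W.S (W.w1 + l) / (exp (hq W l * W.w1) * W.S W.w1), ?_, ?_⟩
  · exact div_ne_zero (W.S_ne _ (by change _ ∉ W.lattice; rw [add_mem_iff hl]; exact w1_notMem))
      (mul_ne_zero (exp_ne_zero _) (W.S_ne _ w1_notMem))
  · have h1 : ∀ z ∈ (W.lattice)ᶜ, W.S (z + l) =
      W.S (W.w1 + l) / (exp (hq W l * W.w1) * W.S W.w1) * exp (hq W l * z) * W.S z := by
      intro z hz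
      rw [← key z hz _ w1_notMem]
      have := W.S_ne z hz
      have := exp_ne_zero (hq W l * z)
      field_simp
    have hdense : Dense (W.lattice)ᶜ := lat_countable.dense_compl ℝ
    intro z
    refine congrFun (Continuous.ext_on hdense ?_ ?_ h1) z
    · exact W.S_diff.continuous.comp (by fun_prop)
    · have := W.S_diff.continuous
      fun_prop

lemma legendre {l l' : ℂ} (hl : l ∈ W.lattice) (hl' : l' ∈ W.lattice) :
    exp (hq W l * l') = exp (hq W l' * l) := by
  obtain ⟨A, hA, h⟩ := S_qper hl
  obtain ⟨B, hB, h'⟩ := S_qper hl'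
  have e1 : W.S (W.w1 + l + l') = B * exp (hq W l' * (W.w1 + l)) * (A * exp (hq W l * W.w1) * W.S W.w1) := by
    rw [h', h]
  have e2 : W.S (W.w1 + l + l') = A * exp (hq W l * (W.w1 + l')) * (B * exp (hq W l' * W.w1) * W.S W.w1) := by
    rw [add_right_comm, h, h']
  rw [e1] at e2
  simp only [mul_add, Complex.exp_add] at e2
  have := W.S_ne _ w1_notMem
  have := exp_ne_zero (hq W l * W.w1)
  have := exp_ne_zero (hq W l' * W.w1)
  have hne : A * B * exp (hq W l * W.w1) * exp (hq W l' * W.w1) * W.S W.w1 ≠ 0 := by positivity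
  apply mul_left_cancel₀ hne
  linear_combination -e2

lemma S_zero : W.S 0 = 0 := by
  have h1 : Tendsto W.S (𝓝[≠] 0) (𝓝 (W.S 0)) :=
    (W.S_diff.continuous.tendsto 0).mono_left nhdsWithin_le_nhds
  have h2 : Tendsto (fun z => W.S z / z * z) (𝓝[≠] 0) (𝓝 (1 * 0)) :=
    W.S_norm.mul ((continuous_id.tendsto 0).mono_left nhdsWithin_le_nhds)
  have h3 : Tendsto W.S (𝓝[≠] 0) (𝓝 (1 * 0)) := by
    refine h2.congr' ?_
    filter_upwards [self_mem_nhdsWithin] with z hz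
    exact div_mul_cancel₀ _ hz
  simpa using tendsto_nhds_unique h1 h3

lemma S_lat {l : ℂ} (hl : l ∈ W.lattice) : W.S l = 0 := by
  obtain ⟨A, hA, h⟩ := S_qper hl
  have := h 0
  rw [S_zero] at this; simpa using this

lemma S_hd0 : HasDerivAt W.S 1 0 := by
  rw [hasDerivAt_iff_tendsto_slope]
  refine W.S_norm.congr' ?_
  filter_upwards [self_mem_nhdsWithin] with z hz
  simp [slope_def_field, S_zero]

lemma S_hd_neg {z : ℂ} (hz : z ∉ W.lattice) :
    HasDerivAt (fun z => W.S (-z)) (W.Z z * W.S (-z)) z := by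
  have := (S_hd (W := W) (z := -z) (by rwa [neg_mem_iff])).comp z (hasDerivAt_neg z)
  refine this.congr_deriv ?_
  rw [W.Z_odd]; ring

lemma S_odd (z : ℂ) : W.S (-z) = -W.S z := by
  by_cases hz : z ∈ W.lattice
  · rw [S_lat hz, S_lat (neg_mem hz)]; simp
  have h1 : ∀ y ∉ W.lattice, W.S (-y) / W.S y = W.S (-z) / W.S z := by
    intro y hy
    refine const_off (W := W) (fun z => W.S (-z) / W.S z) (fun z hz => ?_) hy hz
    refine ((S_hd_neg hz).div (S_hd hz) (W.S_ne z hz)).congr_deriv ?_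
    rw [div_eq_zero_iff]; left; ring
  have h2 : Tendsto (fun y => W.S (-y) / W.S y) (𝓝[≠] 0) (𝓝 (W.S (-z) / W.S z)) := by
    refine tendsto_const_nhds.congr' ?_
    filter_upwards [ev_notMem (W := W) 0] with y hy using (h1 y hy).symm
  have h3 : Tendsto (fun y => -(W.S (-y) / (-y)) / (W.S y / y)) (𝓝[≠] 0) (𝓝 (-1 / 1)) := by
    refine Tendsto.div ?_ W.S_norm one_ne_zero
    refine Tendsto.neg (W.S_norm.comp ?_)
    refine tendsto_nhdsWithin_of_tendsto_nhds_of_eventually_within _ ?_ ?_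
    · have := (continuous_neg (G := ℂ)).tendsto 0
      rw [neg_zero] at this
      exact this.mono_left nhdsWithin_le_nhds
    · filter_upwards [self_mem_nhdsWithin] with y hy
      simpa using hy
  have h4 : Tendsto (fun y => W.S (-y) / W.S y) (𝓝[≠] 0) (𝓝 (-1 / 1)) := by
    refine h3.congr' ?_
    filter_upwards [ev_notMem (W := W) 0, self_mem_nhdsWithin] with y hy hy0
    have := W.S_ne y hy
    have : y ≠ 0 := hy0
    field_simp
  have := tendsto_nhds_unique h2 h4
  have h5 := W.S_ne z hz
  field_simp at this
  linear_combination this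

lemma S_div_an : ∃ s : ℂ → ℂ, Differentiable ℂ s ∧ s 0 = 1 ∧ ∀ z, W.S z = z * s z := by
  refine ⟨dslope W.S 0, ?_, ?_, fun z => ?_⟩
  · rw [← differentiableOn_univ, Complex.differentiableOn_dslope univ_mem, differentiableOn_univ]
    exact W.S_diff
  · rw [dslope_same, S_hd0.deriv]
  · have := sub_smul_dslope W.S 0 z
    rw [S_zero] at this
    simpa using this.symm

/-- Expansion of `ζ` at the origin. -/
lemma Z_exp : ∃ a : ℂ → ℂ, AnalyticAt ℂ a 0 ∧ a 0 = 0 ∧ HasDerivAt a 0 0 ∧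
    ∀ᶠ z in 𝓝[≠] 0, W.Z z = 1 / z + a z := by
  obtain ⟨s, hs, hs0, hS⟩ := S_div_an (W := W)
  have hsan : AnalyticAt ℂ s 0 := hs.analyticAt 0
  have han : AnalyticAt ℂ (fun z => deriv s z / s z) 0 :=
    hsan.deriv.div hsan (by rw [hs0]; exact one_ne_zero)
  have hev : ∀ᶠ z in 𝓝[≠] 0, W.Z z = 1 / z + deriv s z / s z := by
    filter_upwards [ev_notMem (W := W) 0, self_mem_nhdsWithin] with z hz hz0
    have h1 : HasDerivAt W.S (1 * s z + z * deriv s z) z := by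
      have : W.S = fun z => z * s z := by ext z; exact hS z
      rw [this]
      exact (hasDerivAt_id z).mul (hs z).hasDerivAt
    have h2 := h1.unique (S_hd hz)
    have h3 := W.S_ne z hz
    rw [hS] at h3 h2
    have hz0' : z ≠ 0 := hz0
    have : s z ≠ 0 := fun h => h3 (by simp [h])
    field_simp
    linear_combination -h2
  refine ⟨fun z => deriv s z / s z, han, ?_, ?_, hev⟩
  · have hneg : Tendsto (fun z : ℂ => -z) (𝓝[≠] 0) (𝓝[≠] 0) := by
      refine tendsto_nhdsWithin_of_tendsto_nhds_of_eventually_within _ ?_ ?_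
      · have := (continuous_neg (G := ℂ)).tendsto 0
        rw [neg_zero] at this
        exact this.mono_left nhdsWithin_le_nhds
      · filter_upwards [self_mem_nhdsWithin] with y hy
        simpa using hy
    have t1 : Tendsto (fun z => deriv s z / s z) (𝓝[≠] 0) (𝓝 (deriv s 0 / s 0)) :=
      han.continuousAt.tendsto.mono_left nhdsWithin_le_nhds
    have t2 := t1.comp hneg
    have t3 := t1.neg
    have h := tendsto_nhds_unique (t2.congr' ?_) t3
    · have h' : 2 * (deriv s 0 / s 0) = 0 := by linear_combination h
      simpa using h'
    · filter_upwards [hev, hneg.eventually hev] with z h1 h2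
      have := W.Z_odd z
      rw [h1, h2] at this
      simp only [Function.comp_apply]
      have h5 : 1 / -z = -(1/z) := by rw [div_neg]
      linear_combination this - h5
  · have t1 : Tendsto (deriv (fun z => deriv s z / s z)) (𝓝[≠] 0)
        (𝓝 (deriv (fun z => deriv s z / s z) 0)) :=
      han.deriv.continuousAt.tendsto.mono_left nhdsWithin_le_nhds
    have t2 : Tendsto (fun z => -(W.P z - 1 / z ^ 2)) (𝓝[≠] 0) (𝓝 (-0)) := W.P_pole.neg
    have := tendsto_nhds_unique (t2.congr' ?_) t1
    · have h := han.differentiableAt.hasDerivAt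
      rw [← this] at h
      simpa using h
    · have hev2 := eventually_eventually_nhdsWithin.mpr hev
      filter_upwards [hev2, ev_notMem (W := W) 0, self_mem_nhdsWithin] with z h1 hz hz0
      have hz0' : z ≠ 0 := hz0
      rw [isOpen_compl_singleton.nhdsWithin_eq hz0] at h1
      have h2 : HasDerivAt (fun z => W.Z z - z⁻¹) (-W.P z - -(z^2)⁻¹) z :=
        (Z_hd hz).sub (hasDerivAt_inv hz0')
      have h3 : (fun z => deriv s z / s z) =ᶠ[𝓝 z] fun z => W.Z z - z⁻¹ := by
        filter_upwards [h1] with y hy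
        rw [hy]; ring
      rw [(h2.congr_of_eventuallyEq h3).deriv]
      ring

end Lame

namespace Lame
open scoped Topology

variable {W : WeierstrassData}

lemma tendsto_transl {f : ℂ → ℂ} {l z c : ℂ}
    (hp : ∀ᶠ y in 𝓝[≠] z, f (y + l) = f y) (h : Tendsto f (𝓝[≠] z) (𝓝 c)) :
    Tendsto f (𝓝[≠] (z + l)) (𝓝 c) := by
  have h1 : Tendsto (fun y => y - l) (𝓝[≠] (z + l)) (𝓝[≠] z) := by
    refine tendsto_nhdsWithin_of_tendsto_nhds_of_eventually_within _ ?_ ?_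
    · have hcont : Continuous fun y : ℂ => y - l := by fun_prop
      have := hcont.tendsto (z + l)
      rw [add_sub_cancel_right] at this
      exact this.mono_left nhdsWithin_le_nhds
    · filter_upwards [self_mem_nhdsWithin] with y hy h
      apply hy
      have : y - l = z := h
      simp [← this]
  refine (h.comp h1).congr' ?_
  filter_upwards [h1.eventually hp] with y hy
  rw [sub_add_cancel] at hy
  exact hy.symm

lemma liouville_L (f : ℂ → ℂ) (hd : ∀ z ∉ W.lattice, DifferentiableAt ℂ f z)
    (hp : ∀ l ∈ W.lattice, ∀ z ∉ W.lattice, f (z + l) = f z)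
    {c0 : ℂ} (h0 : Tendsto f (𝓝[≠] 0) (𝓝 c0)) : ∃ c, ∀ z ∉ W.lattice, f z = c := by
  obtain ⟨c, hc⟩ := liouville (W := W) f
    (fun z => (ev_notMem z).mono fun y hy => hd y hy)
    (fun z => by
      by_cases hz : z ∈ W.lattice
      · refine ⟨c0, ?_⟩
        have := tendsto_transl (z := 0) (l := z) ((ev_notMem 0).mono fun y hy => hp z hz y hy) h0
        simpa using this
      · exact ⟨f z, (hd z hz).continuousAt.tendsto.mono_left nhdsWithin_le_nhds⟩)
    (fun l hl z => (ev_notMem z).mono fun y hy => hp l hl y hy)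
  exact ⟨c, fun z hz => tendsto_nhds_unique
    ((hd z hz).continuousAt.tendsto.mono_left nhdsWithin_le_nhds) (hc z)⟩

lemma even_div_sq {g : ℂ → ℂ} (hg : AnalyticAt ℂ g 0) (h0 : g 0 = 0)
    (he : ∀ᶠ z in 𝓝 0, g (-z) = g z) : ∃ c, Tendsto (fun z => g z / z ^ 2) (𝓝[≠] 0) (𝓝 c) := by
  have hd : deriv g 0 = 0 := by
    have h1 : HasDerivAt (fun z => g (-z)) (-deriv g 0) 0 := by
      have h2 : HasDerivAt g (deriv g 0) (-0) := by
        rw [neg_zero]; exact hg.differentiableAt.hasDerivAt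
      have := h2.comp 0 (hasDerivAt_neg (0:ℂ))
      simpa [Function.comp_def] using this
    have h2 := hg.differentiableAt.hasDerivAt.congr_of_eventuallyEq he
    have := h1.unique h2
    have h' : 2 * deriv g 0 = 0 := by linear_combination -this
    simpa using h'
  obtain ⟨p, hp⟩ := hg
  have h1 : AnalyticAt ℂ (dslope g 0) 0 := ⟨_, hp.has_fpower_series_dslope_fslope⟩
  obtain ⟨p', hp'⟩ := h1
  have h2 : AnalyticAt ℂ (dslope (dslope g 0) 0) 0 := ⟨_, hp'.has_fpower_series_dslope_fslope⟩
  refine ⟨_, (h2.continuousAt.tendsto.mono_left nhdsWithin_le_nhds).congr' ?_⟩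
  filter_upwards [self_mem_nhdsWithin] with z hz
  have hz' : z ≠ 0 := hz
  have e1 := sub_smul_dslope g 0 z
  have e2 := sub_smul_dslope (dslope g 0) 0 z
  rw [dslope_same, hd] at e2
  rw [h0] at e1
  simp only [sub_zero, smul_eq_mul] at e1 e2
  rw [← e1, ← e2]; field_simp

/-- The sigma identity for the difference of two values of `℘`. -/
lemma sigma_id {k : ℂ} (hk : k ∉ W.lattice) {z : ℂ} (hz : z ∉ W.lattice) :
    W.S (z + k) * W.S (z - k) = - W.S k ^ 2 * W.S z ^ 2 * (W.P z - W.P k) := by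
  obtain ⟨s, hs, hs0, hS⟩ := S_div_an (W := W)
  have hseven : ∀ z, z ≠ 0 → s (-z) = s z := by
    intro z hz0
    have h1 := S_odd (W := W) z
    rw [hS, hS] at h1
    apply mul_left_cancel₀ hz0
    linear_combination -h1
  set g : ℂ → ℂ := fun z => W.S (z + k) * W.S (z - k) / s z ^ 2 + W.S k ^ 2 with hg
  have hgan : AnalyticAt ℂ g 0 := by
    refine AnalyticAt.add (AnalyticAt.div (AnalyticAt.mul ?_ ?_) ((hs.analyticAt 0).pow 2) ?_)
      analyticAt_const
    · exact (W.S_diff.comp (differentiable_id.add_const k)).analyticAt 0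
    · exact (W.S_diff.comp (differentiable_id.sub_const k)).analyticAt 0
    · simp [hs0]
  obtain ⟨c0, hc0⟩ := even_div_sq hgan (by simp [hg, hs0, S_odd]; ring) (by
    filter_upwards with z
    by_cases h : z = 0
    · simp [h]
    · simp only [hg, hseven z h]
      rw [show -z + k = -(z - k) by ring, show -z - k = -(z + k) by ring, S_odd, S_odd]; ring)
  obtain ⟨c, hc⟩ := liouville_L (W := W)
    (fun z => W.S (z + k) * W.S (z - k) / W.S z ^ 2 + W.S k ^ 2 * (W.P z - W.P k))
    (fun z hz => by
      refine DifferentiableAt.add (DifferentiableAt.div (DifferentiableAt.mul ?_ ?_)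
        ((W.S_diff z).pow 2) (pow_ne_zero 2 (W.S_ne z hz))) (((W.P_diff z hz).sub_const _).const_mul _)
      · exact (W.S_diff.comp (differentiable_id.add_const k)) z
      · exact (W.S_diff.comp (differentiable_id.sub_const k)) z)
    (fun l hl z hz => by
      obtain ⟨A, hA, h⟩ := S_qper hl
      simp only [P_per hl]
      congr 1
      rw [show z + l + k = (z + k) + l by ring, show z + l - k = (z - k) + l by ring, h, h, h]
      have h1 := W.S_ne z hz
      have h2 := exp_ne_zero (hq W l * z)
      have h3 : exp (hq W l * (z + k)) * exp (hq W l * (z - k)) = exp (hq W l * z) ^ 2 := by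
        rw [← Complex.exp_add, ← Complex.exp_nat_mul]; congr 1; push_cast; ring
      field_simp
      linear_combination W.S (z + k) * W.S (z - k) * h3)
    (c0 := c0 + W.S k ^ 2 * (0 - W.P k)) (by
      refine (hc0.add ((W.P_pole.sub_const (W.P k)).const_mul (W.S k ^ 2))).congr' ?_
      filter_upwards [ev_notMem (W := W) 0, self_mem_nhdsWithin] with z hz hz0
      have hz0' : z ≠ 0 := hz0
      have h1 := W.S_ne z hz
      simp only [hg]
      rw [hS z] at h1 ⊢
      have h2 : s z ≠ 0 := fun h => h1 (by simp [h])
      field_simp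
      ring)
  have h1 := hc k hk
  rw [sub_self, sub_self, S_zero] at h1
  have h2 := hc z hz
  rw [← h1] at h2
  have h3 := W.S_ne z hz
  field_simp at h2
  linear_combination h2

lemma P_eq_iff {z k : ℂ} (hz : z ∉ W.lattice) (hk : k ∉ W.lattice) :
    W.P z = W.P k ↔ z - k ∈ W.lattice ∨ z + k ∈ W.lattice := by
  constructor
  · intro h
    have := sigma_id hk hz
    rw [h, sub_self, mul_zero, mul_eq_zero] at this
    by_contra! hn
    rcases this with h | h
    · exact W.S_ne _ hn.2 h
    · exact W.S_ne _ hn.1 h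
  · rintro (h | h)
    · rw [← P_per h k]; congr 1; ring
    · rw [← P_even hk, ← P_per h (-k)]; congr 1; ring

lemma P_tendsto_zero : Tendsto (fun z => ‖W.P z‖) (𝓝[≠] 0) atTop := by
  have h1 : Tendsto (fun z : ℂ => ‖z ^ 2‖⁻¹) (𝓝[≠] 0) atTop := by
    refine tendsto_inv_nhdsGT_zero.comp ?_
    refine tendsto_nhdsWithin_of_tendsto_nhds_of_eventually_within _ ?_ ?_
    · have : Continuous fun z : ℂ => ‖z ^ 2‖ := by fun_prop
      have := this.tendsto 0
      simp only [ne_eq, OfNat.ofNat_ne_zero, not_false_eq_true, zero_pow, norm_zero] at this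
      exact this.mono_left nhdsWithin_le_nhds
    · filter_upwards [self_mem_nhdsWithin] with z hz
      have : z ≠ 0 := hz
      simp [this]
  have h2 : Tendsto (fun z => ‖W.P z - 1 / z ^ 2‖) (𝓝[≠] 0) (𝓝 0) := by
    simpa using W.P_pole.norm
  have h3 := h1.atTop_add h2.neg
  refine tendsto_atTop_mono (fun z => ?_) h3
  have := norm_sub_norm_le (1 / z ^ 2) (1 / z ^ 2 - W.P z)
  rw [sub_sub_cancel, norm_sub_rev (1 / z ^ 2), norm_div, norm_one, one_div] at this
  linarith

lemma P_surj (c : ℂ) : ∃ k ∉ W.lattice, W.P k = c := by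
  by_contra! hn
  have h0 : Tendsto (fun z => (W.P z - c)⁻¹) (𝓝[≠] 0) (𝓝 0) := by
    rw [tendsto_zero_iff_norm_tendsto_zero]
    simp only [norm_inv]
    refine tendsto_inv_atTop_zero.comp ?_
    refine tendsto_atTop_mono (fun z => norm_sub_norm_le (W.P z) c) ?_
    exact tendsto_atTop_add_const_right _ _ P_tendsto_zero
  obtain ⟨d, hd⟩ := liouville_L (W := W) (fun z => (W.P z - c)⁻¹)
    (fun z hz => ((W.P_diff z hz).sub_const c).inv (sub_ne_zero.mpr (hn z hz)))
    (fun l hl z hz => by simp only [P_per hl]) h0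
  have h1 : Tendsto (fun z => (W.P z - c)⁻¹) (𝓝[≠] 0) (𝓝 d) :=
    tendsto_const_nhds.congr' ((ev_notMem (W := W) 0).mono fun y hy => (hd y hy).symm)
  have h2 := tendsto_nhds_unique h1 h0
  have := hd _ (w1_notMem (W := W))
  rw [h2] at this
  exact inv_ne_zero (sub_ne_zero.mpr (hn _ w1_notMem)) this

lemma P_deriv_ne {k : ℂ} (hk : k ∉ W.lattice) (h2k : 2 * k ∉ W.lattice) : deriv W.P k ≠ 0 := by
  intro h0
  have h1 : HasDerivAt (fun z => - W.S k ^ 2 * W.S z ^ 2 * (W.P z - W.P k)) 0 k := by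
    have a1 : HasDerivAt (fun z => W.P z - W.P k) (deriv W.P k) k :=
      (W.P_diff k hk).hasDerivAt.sub_const _
    have a2 : HasDerivAt (fun z => - W.S k ^ 2 * W.S z ^ 2)
        (deriv (fun z => - W.S k ^ 2 * W.S z ^ 2) k) k :=
      DifferentiableAt.hasDerivAt (((W.S_diff k).pow 2).const_mul _)
    refine (a2.mul a1).congr_deriv ?_
    rw [h0]; simp
  have h2 : HasDerivAt (fun z => W.S (z + k) * W.S (z - k)) (W.S (k + k)) k := by
    have a1 : HasDerivAt (fun z => W.S (z - k)) 1 k := by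
      have : HasDerivAt W.S 1 (k - k) := by rw [sub_self]; exact S_hd0
      exact HasDerivAt.comp_sub_const k k this
    have a2 : HasDerivAt (fun z => W.S (z + k)) (deriv (fun z => W.S (z + k)) k) k :=
      DifferentiableAt.hasDerivAt ((W.S_diff.comp (differentiable_id.add_const k)) k)
    refine (a2.mul a1).congr_deriv ?_
    rw [sub_self, S_zero]; simp
  have h3 := h2.unique (h1.congr_of_eventuallyEq (by
    filter_upwards [ev_notMem' hk] with z hz using sigma_id hk hz))
  rw [← two_mul] at h3
  exact W.S_ne _ h2k h3

/-- At a half period, `℘ - e` has a double zero. -/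
lemma P_half_sq {k : ℂ} (hk : k ∉ W.lattice) (h2k : 2 * k ∈ W.lattice) :
    ∃ c ≠ 0, Tendsto (fun z => (W.P z - W.P k) / (z - k) ^ 2) (𝓝[≠] k) (𝓝 c) := by
  obtain ⟨s, hs, hs0, hS⟩ := S_div_an (W := W)
  obtain ⟨A, hA, hq'⟩ := S_qper h2k
  have hSk := W.S_ne k hk
  have hc : Continuous W.S := W.S_diff.continuous
  have hcs : Continuous s := hs.continuous
  have hlim : Tendsto (fun z => -(A * exp (hq W (2 * k) * (z - k)) * s (z - k) ^ 2)
      / (W.S k ^ 2 * W.S z ^ 2)) (𝓝 k) (𝓝 (-(A * exp (hq W (2 * k) * (k - k)) * s (k - k) ^ 2)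
      / (W.S k ^ 2 * W.S k ^ 2))) := by
    refine Tendsto.div ?_ ?_ (by positivity)
    · have : Continuous fun z => -(A * exp (hq W (2 * k) * (z - k)) * s (z - k) ^ 2) := by fun_prop
      exact this.tendsto k
    · have : Continuous fun z => (W.S k ^ 2 * W.S z ^ 2) := by fun_prop
      exact this.tendsto k
  refine ⟨_, ?_, (hlim.mono_left nhdsWithin_le_nhds).congr' ?_⟩
  · simp [hs0, hA, hSk]
  · filter_upwards [self_mem_nhdsWithin, mem_nhdsWithin_of_mem_nhds (ev_notMem' hk)] with z hz0 hz
    have h1 := sigma_id hk hz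
    rw [show z + k = (z - k) + 2 * k by ring, hq', hS (z - k)] at h1
    have h2 : z - k ≠ 0 := sub_ne_zero.mpr hz0
    have h3 := W.S_ne z hz
    field_simp
    linear_combination -h1

end Lame

namespace Lame
open scoped Topology

variable {W : WeierstrassData}

lemma tendsto_add_punct (z k : ℂ) : Tendsto (fun y => y + k) (𝓝[≠] z) (𝓝[≠] (z + k)) := by
  refine tendsto_nhdsWithin_of_tendsto_nhds_of_eventually_within _ ?_ ?_
  · have hcont : Continuous fun y : ℂ => y + k := by fun_prop
    exact (hcont.tendsto z).mono_left nhdsWithin_le_nhds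
  · filter_upwards [self_mem_nhdsWithin] with y hy
    simpa using hy

lemma ev_notMem_add (z k : ℂ) : ∀ᶠ y in 𝓝[≠] z, y + k ∉ W.lattice :=
  (tendsto_add_punct z k).eventually (ev_notMem (z + k))

/-- The defect in the Hermite identity. -/
def Qh (W : WeierstrassData) (k z : ℂ) : ℂ :=
  (W.Z (z + k) - W.Z z - W.Z k) ^ 2 - W.P (z + k) - W.P z - W.P k

lemma Qh_diff {k z : ℂ} (hz : z ∉ W.lattice) (hzk : z + k ∉ W.lattice) :
    DifferentiableAt ℂ (Qh W k) z := by
  have h1 : DifferentiableAt ℂ (fun z => W.Z (z + k)) z :=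
    DifferentiableAt.comp z (g := W.Z) (W.Z_diff _ hzk) (by fun_prop)
  have h2 : DifferentiableAt ℂ (fun z => W.P (z + k)) z :=
    DifferentiableAt.comp z (g := W.P) (W.P_diff _ hzk) (by fun_prop)
  exact ((((h1.sub (W.Z_diff z hz)).sub_const _).pow 2).sub h2 |>.sub (W.P_diff z hz)).sub_const _

lemma Qh_zero {k : ℂ} (hk : k ∉ W.lattice) : Tendsto (Qh W k) (𝓝[≠] 0) (𝓝 0) := by
  obtain ⟨a, ha, ha0, had, hev⟩ := Z_exp (W := W)
  have h1 : HasDerivAt (fun z => W.Z (z + k) - W.Z k - a z) (-W.P k) 0 := by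
    have e1 : HasDerivAt W.Z (-W.P k) (0 + k) := by rw [zero_add]; exact Z_hd hk
    have e2 : HasDerivAt (fun z => W.Z (z + k)) (-W.P k) 0 := e1.comp_add_const 0 k
    have := (e2.sub_const (W.Z k)).sub had
    rw [sub_zero] at this
    exact this
  have h2 := hasDerivAt_iff_tendsto_slope.mp h1
  have h3 : Tendsto (fun z => W.Z (z + k) - W.Z k - a z) (𝓝[≠] 0) (𝓝 0) := by
    have := h1.continuousAt.tendsto
    simp only [zero_add, sub_self, ha0] at this
    exact this.mono_left nhdsWithin_le_nhds
  have h4 : Tendsto (fun z => W.P (z + k)) (𝓝[≠] 0) (𝓝 (W.P k)) := by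
    have e1 : ContinuousAt W.P (0 + k) := by rw [zero_add]; exact (W.P_diff k hk).continuousAt
    have e2 : ContinuousAt (fun z => W.P (z + k)) 0 :=
      ContinuousAt.comp (g := W.P) e1 (by fun_prop)
    have := e2.tendsto
    rw [zero_add] at this
    exact this.mono_left nhdsWithin_le_nhds
  have h5 := ((((h3.pow 2).sub (h2.const_mul 2)).sub W.P_pole).sub h4).sub_const (W.P k)
  have e0 : (0:ℂ) ^ 2 - 2 * (-W.P k) - 0 - W.P k - W.P k = 0 := by ring
  rw [e0] at h5
  refine h5.congr' ?_
  filter_upwards [hev, self_mem_nhdsWithin] with z hz hz0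
  have hz0' : z ≠ 0 := hz0
  simp only [Qh, slope_def_field, ha0, zero_add, sub_self, sub_zero]
  rw [hz]
  field_simp
  ring

lemma Qh_shift {k : ℂ} (hk : k ∉ W.lattice) (z : ℂ) : Qh W k (z + -k) = Qh W (-k) z := by
  simp only [Qh]
  rw [W.Z_odd, P_even hk, neg_add_cancel_right]
  ring

lemma Qh_per {k l z : ℂ} (hl : l ∈ W.lattice) (hz : z ∉ W.lattice) (hzk : z + k ∉ W.lattice) :
    Qh W k (z + l) = Qh W k z := by
  simp only [Qh]
  rw [show z + l + k = (z + k) + l by ring, Z_qper hl hz, Z_qper hl hzk, P_per hl, P_per hl]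
  ring

lemma hermite {k z : ℂ} (hk : k ∉ W.lattice) (hz : z ∉ W.lattice) (hzk : z + k ∉ W.lattice) :
    (W.Z (z + k) - W.Z z - W.Z k) ^ 2 = W.P (z + k) + W.P z + W.P k := by
  have hper : ∀ l ∈ W.lattice, ∀ z, ∀ᶠ y in 𝓝[≠] z, Qh W k (y + l) = Qh W k y := by
    intro l hl z
    filter_upwards [ev_notMem (W := W) z, ev_notMem_add (W := W) z k] with y h1 h2
    exact Qh_per hl h1 h2
  obtain ⟨c, hc⟩ := liouville (W := W) (Qh W k)
    (fun z => by
      filter_upwards [ev_notMem (W := W) z, ev_notMem_add (W := W) z k] with y h1 h2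
      exact Qh_diff h1 h2)
    (fun z => by
      by_cases h1 : z ∈ W.lattice
      · refine ⟨0, ?_⟩
        have := tendsto_transl (hper z h1 0) (Qh_zero hk)
        simpa using this
      by_cases h2 : z + k ∈ W.lattice
      · refine ⟨0, ?_⟩
        have e1 : Tendsto (Qh W k) (𝓝[≠] (-k)) (𝓝 0) := by
          have t1 := tendsto_add_punct (-k) k
          rw [neg_add_cancel] at t1
          have t2 := (Qh_zero (W := W) (k := -k) (by rwa [neg_mem_iff])).comp t1
          refine t2.congr fun y => ?_
          simp only [Function.comp_apply]
          rw [← Qh_shift hk]; simp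
        have := tendsto_transl (hper _ h2 (-k)) e1
        rwa [show -k + (z + k) = z by ring] at this
      · exact ⟨_, (Qh_diff h1 h2).continuousAt.tendsto.mono_left nhdsWithin_le_nhds⟩)
    hper
  have h0 : c = 0 := tendsto_nhds_unique (hc 0) (Qh_zero hk)
  have := tendsto_nhds_unique
    ((Qh_diff hz hzk).continuousAt.tendsto.mono_left nhdsWithin_le_nhds) (hc z)
  rw [h0, Qh] at this
  linear_combination this

/-- Hermite's solution. -/
def psi (W : WeierstrassData) (k z : ℂ) : ℂ := W.S (z + k) / W.S z * exp (-W.Z k * z)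

lemma psi_an {k z : ℂ} (hz : z ∉ W.lattice) : AnalyticAt ℂ (psi W k) z := by
  refine AnalyticAt.mul (AnalyticAt.div ?_ (S_an z) (W.S_ne z hz)) ?_
  · exact (W.S_diff.comp (differentiable_id.add_const k)).analyticAt z
  · exact Differentiable.analyticAt (by fun_prop) z

lemma psi_hd {k z : ℂ} (hz : z ∉ W.lattice) (hzk : z + k ∉ W.lattice) :
    HasDerivAt (psi W k) (psi W k z * (W.Z (z + k) - W.Z z - W.Z k)) z := by
  have h1 : HasDerivAt (fun z => W.S (z + k)) (W.Z (z + k) * W.S (z + k)) z :=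
    (S_hd hzk).comp_add_const z k
  have h2 : HasDerivAt (fun z => exp (-W.Z k * z)) (exp (-W.Z k * z) * -W.Z k) z := by
    have := ((hasDerivAt_id z).const_mul (-W.Z k)).cexp
    simpa using this
  have := (h1.div (S_hd hz) (W.S_ne z hz)).mul h2
  refine this.congr_deriv ?_
  have h3 := W.S_ne z hz
  simp only [psi, Pi.div_apply]
  field_simp
  ring

lemma psi_ode {k z : ℂ} (hk : k ∉ W.lattice) (hz : z ∉ W.lattice) :
    HasDerivAt (deriv (psi W k)) ((2 * W.P z + W.P k) * psi W k z) z := by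
  have key : ∀ z, z ∉ W.lattice → z + k ∉ W.lattice →
      deriv (deriv (psi W k)) z = (2 * W.P z + W.P k) * psi W k z := by
    intro z hz hzk
    have e1 : deriv (psi W k) =ᶠ[𝓝 z] fun z => psi W k z * (W.Z (z + k) - W.Z z - W.Z k) := by
      have hc : ContinuousAt (fun y : ℂ => y + k) z := by fun_prop
      filter_upwards [ev_notMem' hz, hc.eventually (ev_notMem' hzk)] with y h1 h2
      exact (psi_hd h1 h2).deriv
    rw [e1.deriv_eq]
    have h1 := psi_hd hz hzk
    have h2 := (((Z_hd hzk).comp_add_const z k).sub (Z_hd hz)).sub_const (W.Z k)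
    have h3 := (h1.mul h2).deriv
    refine Eq.trans ?_ (h3.trans ?_)
    · rfl
    · have := hermite hk hz hzk
      simp only [Pi.sub_apply]
      linear_combination psi W k z * this
  have ha := (psi_an (k := k) hz).deriv
  have h2 : deriv (deriv (psi W k)) z = (2 * W.P z + W.P k) * psi W k z := by
    have t1 : Tendsto (deriv (deriv (psi W k))) (𝓝[≠] z) (𝓝 (deriv (deriv (psi W k)) z)) :=
      ha.deriv.continuousAt.tendsto.mono_left nhdsWithin_le_nhds
    have t2 : Tendsto (fun z => (2 * W.P z + W.P k) * psi W k z) (𝓝[≠] z)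
        (𝓝 ((2 * W.P z + W.P k) * psi W k z)) := by
      refine Tendsto.mono_left ?_ nhdsWithin_le_nhds
      have := (W.P_diff z hz).continuousAt
      have := (psi_an (k := k) hz).continuousAt
      refine ContinuousAt.tendsto ?_
      fun_prop
    refine tendsto_nhds_unique (t1.congr' ?_) t2
    filter_upwards [ev_notMem (W := W) z, ev_notMem_add (W := W) z k] with y h1 h2
    exact key y h1 h2
  rw [← h2]
  exact ha.differentiableAt.hasDerivAt

lemma psi_mult {k w z : ℂ} (h2 : 2 * w ∈ W.lattice) (h : w ∉ W.lattice) (hz : z ∉ W.lattice) :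
    psi W k (z + 2 * w) = exp (2 * (W.Z w * k - w * W.Z k)) * psi W k z := by
  obtain ⟨A, hA, hS⟩ := S_qper h2
  simp only [psi]
  rw [show z + 2 * w + k = (z + k) + 2 * w by ring, hS, hS, hq_half h2 h]
  have e1 : exp (2 * W.Z w * (z + k)) = exp (2 * W.Z w * z) * exp (2 * W.Z w * k) := by
    rw [← Complex.exp_add]; ring_nf
  have e2 : exp (-W.Z k * (z + 2 * w)) = exp (-W.Z k * z) * exp (-2 * w * W.Z k) := by
    rw [← Complex.exp_add]; ring_nf
  have e3 : exp (2 * (W.Z w * k - w * W.Z k)) = exp (2 * W.Z w * k) * exp (-2 * w * W.Z k) := by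
    rw [← Complex.exp_add]; ring_nf
  rw [e1, e2, e3]
  have := exp_ne_zero (2 * W.Z w * z)
  have := W.S_ne z hz
  field_simp

lemma psi_wronsk {k : ℂ} (hk : k ∉ W.lattice) (h2k : 2 * k ∉ W.lattice) {z : ℂ}
    (hz : z ∉ W.lattice) :
    psi W k z * deriv (psi W (-k)) z - deriv (psi W k) z * psi W (-k) z ≠ 0 := by
  have hk' : -k ∉ W.lattice := by rwa [neg_mem_iff]
  have h1 := const_off (W := W)
    (fun z => psi W k z * deriv (psi W (-k)) z - deriv (psi W k) z * psi W (-k) z)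
    (fun z hz => by
      have a1 := (psi_an (W := W) (k := k) hz).differentiableAt.hasDerivAt
      have a2 := (psi_an (W := W) (k := -k) hz).differentiableAt.hasDerivAt
      have b1 := psi_ode hk hz
      have b2 := psi_ode hk' hz
      refine ((a1.mul b2).sub (b1.mul a2)).congr_deriv ?_
      rw [P_even hk]; ring) hz hk'
  rw [h1]
  have e1 : psi W k (-k) = 0 := by simp [psi, S_zero]
  have e2 : deriv (psi W k) (-k) = 1 / W.S (-k) * exp (-W.Z k * -k) := by
    have h3 : HasDerivAt (fun z => W.S (z + k)) 1 (-k) := by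
      have : HasDerivAt W.S 1 (-k + k) := by rw [neg_add_cancel]; exact S_hd0
      exact this.comp_add_const (-k) k
    have h4 : HasDerivAt (fun z => exp (-W.Z k * z)) (exp (-W.Z k * -k) * -W.Z k) (-k) := by
      have := ((hasDerivAt_id (-k)).const_mul (-W.Z k)).cexp
      simpa using this
    have := (h3.div (W.S_diff (-k)).hasDerivAt (W.S_ne _ hk')).mul h4
    refine this.deriv.trans ?_
    have h5 := W.S_ne _ hk'
    simp only [neg_add_cancel, S_zero, Pi.div_apply]
    field_simp
    simp
  have e3 : psi W (-k) (-k) ≠ 0 := by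
    simp only [psi]
    refine mul_ne_zero (div_ne_zero ?_ (W.S_ne _ hk')) (exp_ne_zero _)
    apply W.S_ne
    change _ ∉ W.lattice
    rwa [show -k + -k = -(2 * k) by ring, neg_mem_iff]
  rw [e1, e2, zero_mul, zero_sub]
  refine neg_ne_zero.mpr (mul_ne_zero (mul_ne_zero ?_ (exp_ne_zero _)) e3)
  exact one_div_ne_zero (W.S_ne _ hk')

end Lame

namespace Lame
open scoped Topology

variable {W : WeierstrassData}

/-- The function `F(k) = η k - ω ζ(k)`. -/
def FF (W : WeierstrassData) (ω k : ℂ) : ℂ := W.Z ω * k - ω * W.Z k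

lemma uFun_eq (ω k : ℂ) : W.uFun ω k = (FF W ω k).re := rfl

lemma FF_neg (ω k : ℂ) : FF W ω (-k) = -FF W ω k := by
  simp only [FF, W.Z_odd]; ring

lemma FF_hd {ω k : ℂ} (hk : k ∉ W.lattice) :
    HasDerivAt (FF W ω) (W.Z ω + ω * W.P k) k := by
  have h1 : HasDerivAt (fun k => W.Z ω * k) (W.Z ω * 1) k := (hasDerivAt_id k).const_mul _
  have h2 := (Z_hd hk).const_mul ω
  refine (h1.sub h2).congr_deriv ?_
  ring

lemma FF_an {ω k : ℂ} (hk : k ∉ W.lattice) : AnalyticAt ℂ (FF W ω) k := by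
  have h2 := Z_an hk
  unfold FF
  fun_prop

/-- The shift of `F` under a lattice vector. -/
def cc (W : WeierstrassData) (ω l : ℂ) : ℂ := W.Z ω * l - ω * hq W l

lemma FF_add {ω k l : ℂ} (hl : l ∈ W.lattice) (hk : k ∉ W.lattice) :
    FF W ω (k + l) = FF W ω k + cc W ω l := by
  simp only [FF, cc, Z_qper hl hk]; ring

lemma cc_int {ω l : ℂ} (hω : 2 * ω ∈ W.lattice) (hω' : ω ∉ W.lattice) (hl : l ∈ W.lattice) :
    ∃ n : ℤ, cc W ω l = n * (Real.pi * I) := by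
  have h := legendre hω hl
  rw [hq_half hω hω', Complex.exp_eq_exp_iff_exists_int] at h
  obtain ⟨n, hn⟩ := h
  refine ⟨n, ?_⟩
  have : 2 * cc W ω l = 2 * (n * (Real.pi * I)) := by
    simp only [cc]
    linear_combination hn
  exact mul_left_cancel₀ two_ne_zero this

lemma cc_re {ω l : ℂ} (hω : 2 * ω ∈ W.lattice) (hω' : ω ∉ W.lattice) (hl : l ∈ W.lattice) :
    (cc W ω l).re = 0 := by
  obtain ⟨n, hn⟩ := cc_int hω hω' hl
  rw [hn]; simp

lemma FF_half_re {ω k : ℂ} (hω : 2 * ω ∈ W.lattice) (hω' : ω ∉ W.lattice)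
    (hk : k ∉ W.lattice) (h2k : 2 * k ∈ W.lattice) : (FF W ω k).re = 0 := by
  have h1 := FF_add (ω := ω) h2k (by rwa [neg_mem_iff] : -k ∉ W.lattice)
  rw [FF_neg, show -k + 2 * k = k by ring] at h1
  have h2 := congrArg Complex.re h1
  simp only [Complex.add_re, Complex.neg_re, cc_re hω hω' h2k] at h2
  linarith

lemma real_comp {f : ℂ → ℂ} {f' ω z0 : ℂ} {x : ℝ} (h : HasDerivAt f f' (ω * x + z0)) :
    HasDerivAt (fun x : ℝ => f (ω * x + z0)) (f' * ω) x := by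
  have h1 : HasDerivAt (fun x : ℝ => ω * (x : ℂ) + z0) ω x := by
    have := ((hasDerivAt_id x).ofReal_comp.const_mul ω).add_const z0
    simpa using this
  exact h.comp x h1

/-- Hermite's solution restricted to the line. -/
def psr (W : WeierstrassData) (ω z0 k : ℂ) (x : ℝ) : ℂ := psi W k (ω * x + z0)

section
variable {ω z0 : ℂ}

lemma psr_hd (hz0 : ∀ x : ℝ, ω * x + z0 ∉ W.lattice) (k : ℂ) (x : ℝ) :
    HasDerivAt (psr W ω z0 k) (deriv (psi W k) (ω * x + z0) * ω) x :=
  real_comp (psi_an (hz0 x)).differentiableAt.hasDerivAt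

lemma psr_deriv (hz0 : ∀ x : ℝ, ω * x + z0 ∉ W.lattice) (k : ℂ) :
    deriv (psr W ω z0 k) = fun x : ℝ => deriv (psi W k) (ω * x + z0) * ω :=
  funext fun x => (psr_hd hz0 k x).deriv

lemma psr_hd2 (hz0 : ∀ x : ℝ, ω * x + z0 ∉ W.lattice) {k : ℂ} (hk : k ∉ W.lattice) (x : ℝ) :
    HasDerivAt (deriv (psr W ω z0 k))
      ((2 * W.P (ω * x + z0) + W.P k) * psr W ω z0 k x * ω ^ 2) x := by
  rw [psr_deriv hz0]
  refine ((real_comp (psi_ode hk (hz0 x))).mul_const ω).congr_deriv ?_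
  simp only [psr]; ring

lemma psr_contDiff (hz0 : ∀ x : ℝ, ω * x + z0 ∉ W.lattice) (k : ℂ) : ContDiff ℝ 2 (psr W ω z0 k) := by
  rw [contDiff_iff_contDiffAt]
  intro x
  have h1 : ContDiffAt ℝ 2 (psi W k) (ω * x + z0) :=
    ((psi_an (hz0 x)).contDiffAt (n := 2)).restrict_scalars ℝ
  have h2 : ContDiffAt ℝ 2 (fun x : ℝ => ω * (x : ℂ) + z0) x := by
    have : ContDiff ℝ 2 (fun x : ℝ => (x : ℂ)) := Complex.ofRealCLM.contDiff
    exact ((contDiff_const.mul this).add contDiff_const).contDiffAt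
  exact ContDiffAt.comp x (g := psi W k) h1 h2

lemma psr_mult (hz0 : ∀ x : ℝ, ω * x + z0 ∉ W.lattice) (hω : 2 * ω ∈ W.lattice) (hω' : ω ∉ W.lattice) (k : ℂ) (x : ℝ) :
    psr W ω z0 k (x + 2) = exp (2 * FF W ω k) * psr W ω z0 k x := by
  have := psi_mult (k := k) hω hω' (hz0 x)
  simp only [psr, FF]
  rw [← this]
  congr 1
  push_cast; ring

lemma spec_of_u (hz0 : ∀ x : ℝ, ω * x + z0 ∉ W.lattice) (hω : 2 * ω ∈ W.lattice) (hω' : ω ∉ W.lattice) {k : ℂ} (hk : k ∉ W.lattice)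
    (hu : W.uFun ω k = 0) : -ω ^ 2 * W.P k ∈ W.lameSpectrum 1 ω z0 := by
  refine ⟨psr W ω z0 k, ?_, psr_contDiff hz0 k, ?_, ?_⟩
  · intro h0
    obtain ⟨δ, hδ, hsep⟩ := exists_sep (W := W)
    have hω0 : ω ≠ 0 := by rintro rfl; exact hω' zero_mem
    have h1 : ∀ x : ℝ, ω * x + z0 + k ∈ W.lattice := by
      intro x
      by_contra hx
      have := congrFun h0 x
      simp only [psr, psi, Pi.zero_apply, mul_eq_zero, div_eq_zero_iff] at this
      rcases this with (h | h) | h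
      · exact W.S_ne _ hx h
      · exact W.S_ne _ (hz0 x) h
      · exact exp_ne_zero _ h
    set t : ℝ := δ / (2 * ‖ω‖) with ht
    have hωn : 0 < ‖ω‖ := norm_pos_iff.2 hω0
    have ht0 : 0 < t := by positivity
    have h2 := sub_mem (h1 t) (h1 0)
    rw [show ω * (t : ℂ) + z0 + k - (ω * ((0 : ℝ) : ℂ) + z0 + k) = ω * t by push_cast; ring] at h2
    have h3 := hsep _ h2 (by
      rw [norm_mul, Complex.norm_real, Real.norm_of_nonneg ht0.le, ht]
      field_simp; linarith)
    rcases mul_eq_zero.1 h3 with h | h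
    · exact hω0 h
    · exact ht0.ne' (by exact_mod_cast h)
  · intro x
    rw [(psr_hd2 hz0 hk x).deriv]
    push_cast; ring
  · have hc : Continuous (fun x => ‖psr W ω z0 k x‖) := (psr_contDiff hz0 k).continuous.norm
    have hp : Function.Periodic (fun x => ‖psr W ω z0 k x‖) 2 := by
      intro x
      simp only [psr_mult hz0 hω hω', norm_mul, Complex.norm_exp]
      rw [uFun_eq] at hu
      simp [hu]
    have hb := hp.isBounded_of_continuous two_ne_zero hc
    obtain ⟨C, hC⟩ := hb.exists_norm_le
    refine ⟨C, fun x => ?_⟩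
    have := hC _ ⟨x, rfl⟩
    simpa using this

lemma growth {A B M : ℂ} {C : ℝ} (hM : 1 < ‖M‖)
    (h : ∀ n : ℕ, ∃ N : ℂ, ‖N‖ ≤ 1 ∧ ‖M ^ n * A - N * B‖ ≤ C) : A = 0 := by
  by_contra hA
  have h1 : Tendsto (fun n : ℕ => ‖M‖ ^ n * ‖A‖) atTop atTop :=
    (tendsto_pow_atTop_atTop_of_one_lt hM).atTop_mul_const (norm_pos_iff.2 hA)
  obtain ⟨n, hn⟩ := (h1.eventually_gt_atTop (C + ‖B‖)).exists
  obtain ⟨N, hN, hle⟩ := h n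
  have h2 : ‖M ^ n * A‖ ≤ ‖M ^ n * A - N * B‖ + ‖N * B‖ := by
    have := norm_add_le (M ^ n * A - N * B) (N * B)
    simpa using this
  rw [norm_mul, norm_pow, norm_mul N] at h2
  have := mul_le_mul_of_nonneg_right hN (norm_nonneg B)
  linarith

lemma u_of_spec_aux (hz0 : ∀ x : ℝ, ω * x + z0 ∉ W.lattice) (hω : 2 * ω ∈ W.lattice) (hω' : ω ∉ W.lattice) {k : ℂ} (hk : k ∉ W.lattice)
    (h : -ω ^ 2 * W.P k ∈ W.lameSpectrum 1 ω z0) (hu : 0 < W.uFun ω k) : False := by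
  obtain ⟨φ, hne, hcd, hode, C, hC⟩ := h
  have hω0 : ω ≠ 0 := by rintro rfl; exact hω' zero_mem
  have h2k : 2 * k ∉ W.lattice := fun h => hu.ne' (FF_half_re hω hω' hk h)
  have hk' : -k ∉ W.lattice := by rwa [neg_mem_iff]
  set p := psr W ω z0 k with hp
  set q := psr W ω z0 (-k) with hq
  have hφ1 : ∀ x, HasDerivAt φ (deriv φ x) x := fun x =>
    ((hcd.differentiable (by norm_num)) x).hasDerivAt
  have hφ2 : ∀ x : ℝ, HasDerivAt (deriv φ) (ω ^ 2 * (2 * W.P (ω * x + z0) + W.P k) * φ x) x := by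
    intro x
    have h1 : ContDiff ℝ 1 (deriv φ) := by
      have : ContDiff ℝ (1 + 1) φ := by simpa [one_add_one_eq_two] using hcd
      exact (contDiff_succ_iff_deriv.1 this).2.2
    refine ((h1.differentiable (by norm_num)) x).hasDerivAt.congr_deriv ?_
    have := hode x
    push_cast at this
    linear_combination -this
  have wr : ∀ κ, κ ∉ W.lattice → W.P κ = W.P k → ∀ f g : ℝ → ℂ,
      (∀ x, HasDerivAt f (deriv f x) x) →
      (∀ x : ℝ, HasDerivAt (deriv f) (ω ^ 2 * (2 * W.P (ω * x + z0) + W.P k) * f x) x) →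
      g = psr W ω z0 κ → ∀ x y, f x * deriv g x - deriv f x * g x
        = f y * deriv g y - deriv f y * g y := by
    rintro κ hκ hP f g hf1 hf2 rfl x y
    have key : ∀ x, HasDerivAt (fun x => f x * deriv (psr W ω z0 κ) x
        - deriv f x * psr W ω z0 κ x) 0 x := by
      intro x
      have a1 := psr_hd hz0 κ x
      have a2 := psr_hd2 hz0 hκ x
      have a3 : HasDerivAt (psr W ω z0 κ) (deriv (psr W ω z0 κ) x) x :=
        a1.differentiableAt.hasDerivAt
      refine (((hf1 x).mul a2).sub ((hf2 x).mul a3)).congr_deriv ?_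
      rw [hP]; ring
    exact is_const_of_deriv_eq_zero (fun x => (key x).differentiableAt)
      (fun x => (key x).deriv) x y
  have hp1 : ∀ x, HasDerivAt p (deriv p x) x := fun x =>
    (psr_hd hz0 k x).differentiableAt.hasDerivAt
  have hp2 : ∀ x : ℝ, HasDerivAt (deriv p) (ω ^ 2 * (2 * W.P (ω * x + z0) + W.P k) * p x) x :=
    fun x => (psr_hd2 hz0 hk x).congr_deriv (by ring)
  have c1 := wr (-k) hk' (P_even hk) φ q hφ1 hφ2 rfl
  have c2 := wr k hk rfl φ p hφ1 hφ2 rfl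
  have c3 := wr (-k) hk' (P_even hk) p q hp1 hp2 rfl
  set a := φ 0 * deriv q 0 - deriv φ 0 * q 0
  set b := φ 0 * deriv p 0 - deriv φ 0 * p 0
  set w := p 0 * deriv q 0 - deriv p 0 * q 0 with hw
  have hw0 : w ≠ 0 := by
    have := psi_wronsk hk h2k (hz0 0)
    rw [hw, hp, hq, psr_deriv hz0, psr_deriv hz0]
    simp only [psr]
    intro h
    apply this
    have h' : ω * (psi W k (ω * ((0:ℝ):ℂ) + z0) * deriv (psi W (-k)) (ω * ((0:ℝ):ℂ) + z0)
      - deriv (psi W k) (ω * ((0:ℝ):ℂ) + z0) * psi W (-k) (ω * ((0:ℝ):ℂ) + z0)) = 0 := by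
      linear_combination h
    exact (mul_eq_zero.1 h').resolve_left hω0
  have rep : ∀ x, φ x * w = p x * a - q x * b := by
    intro x
    have e1 := c1 x 0
    have e2 := c2 x 0
    have e3 := c3 x 0
    change _ = a at e1
    change _ = b at e2
    change _ = w at e3
    rw [← e1, ← e2, ← e3]; ring
  set M := exp (2 * FF W ω k) with hM
  have hMn : 1 < ‖M‖ := by
    rw [hM, Complex.norm_exp]
    rw [uFun_eq] at hu
    simpa using hu
  have hM0 : M ≠ 0 := exp_ne_zero _
  have pM : ∀ x, p (x + 2) = M * p x := psr_mult hz0 hω hω' k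
  have qM : ∀ x, q x = M * q (x + 2) := by
    intro x
    have := psr_mult hz0 hω hω' (-k) x
    rw [FF_neg] at this
    rw [hq, this, ← mul_assoc, hM, ← Complex.exp_add]
    simp
  have pn : ∀ n : ℕ, ∀ x, p (x + 2 * n) = M ^ n * p x := by
    intro n
    induction n with
    | zero => intro x; simp
    | succ n ih =>
      intro x
      rw [show x + 2 * ((n + 1 : ℕ) : ℝ) = (x + 2 * n) + 2 by push_cast; ring, pM, ih]; ring
  have qn : ∀ n : ℕ, ∀ x, q x = M ^ n * q (x + 2 * n) := by
    intro n
    induction n with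
    | zero => intro x; simp
    | succ n ih =>
      intro x
      rw [show x + 2 * ((n + 1 : ℕ) : ℝ) = (x + 2 * n) + 2 by push_cast; ring, ih x, qM]; ring
  have hinv : ∀ n : ℕ, ‖(M ^ n)⁻¹‖ ≤ 1 := by
    intro n
    rw [norm_inv, norm_pow]
    exact inv_le_one_of_one_le₀ (one_le_pow₀ hMn.le)
  apply hne
  funext x
  have A0 : p x * a = 0 := by
    refine growth (B := q x * b) (C := C * ‖w‖) hMn fun n => ⟨(M ^ n)⁻¹, hinv n, ?_⟩
    have e1 := rep (x + 2 * n)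
    have e2 : q (x + 2 * n) = (M ^ n)⁻¹ * q x := by
      rw [qn n x, inv_mul_cancel_left₀ (pow_ne_zero _ hM0)]
    rw [pn, e2] at e1
    rw [← mul_assoc, ← mul_assoc, ← e1, norm_mul]
    exact mul_le_mul_of_nonneg_right (hC _) (norm_nonneg _)
  have B0 : q x * b = 0 := by
    refine growth (B := p x * a) (C := C * ‖w‖) hMn fun n => ⟨(M ^ n)⁻¹, hinv n, ?_⟩
    have e1 := rep (x - 2 * n)
    have e2 : p (x - 2 * n) = (M ^ n)⁻¹ * p x := by
      have := pn n (x - 2 * n)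
      rw [sub_add_cancel] at this
      rw [this, inv_mul_cancel_left₀ (pow_ne_zero _ hM0)]
    have e3 := qn n (x - 2 * n)
    rw [sub_add_cancel] at e3
    rw [e2, e3] at e1
    rw [← mul_assoc, ← mul_assoc, ← norm_neg, neg_sub, ← e1, norm_mul]
    exact mul_le_mul_of_nonneg_right (hC _) (norm_nonneg _)
  have := rep x
  rw [A0, B0, sub_zero] at this
  exact (mul_eq_zero.1 this).resolve_right hw0

lemma spec_iff (hz0 : ∀ x : ℝ, ω * x + z0 ∉ W.lattice) (hω : 2 * ω ∈ W.lattice) (hω' : ω ∉ W.lattice) :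
    W.lameSpectrum 1 ω z0 = {lam | ∃ k, k ∉ W.lattice ∧ (FF W ω k).re = 0 ∧ lam = -ω ^ 2 * W.P k} := by
  have hω0 : ω ≠ 0 := by rintro rfl; exact hω' zero_mem
  ext lam
  constructor
  · intro h
    obtain ⟨k, hk, hPk⟩ := P_surj (W := W) (-lam / ω ^ 2)
    have hl : lam = -ω ^ 2 * W.P k := by rw [hPk]; field_simp
    refine ⟨k, hk, ?_, hl⟩
    rw [hl] at h
    by_contra hu
    rcases lt_or_gt_of_ne hu with hu | hu
    · have hk' : -k ∉ W.lattice := by rwa [neg_mem_iff]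
      refine u_of_spec_aux hz0 hω hω' hk' (by rwa [P_even hk]) ?_
      rw [uFun_eq, FF_neg]; simpa using hu
    · exact u_of_spec_aux hz0 hω hω' hk h hu
  · rintro ⟨k, hk, hu, rfl⟩
    exact spec_of_u hz0 hω hω' hk hu

end

end Lame

namespace Lame
open scoped Topology

/-- The data of the theorem, bundled. -/
structure Ctx where
  W : WeierstrassData
  ω : ℂ
  hω : 2 * ω ∈ W.lattice
  hω' : ω ∉ W.lattice
  hns : ∀ k ∉ W.lattice, W.Z ω + ω * W.P k = 0 → (FF W ω k).re ≠ 0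

namespace Ctx

variable (D : Ctx)

/-- The lattice. -/
abbrev L : Set ℂ := D.W.lattice
/-- The function `F`. -/
def F (k : ℂ) : ℂ := FF D.W D.ω k
/-- Its derivative. -/
def DF (k : ℂ) : ℂ := D.W.Z D.ω + D.ω * D.W.P k
/-- The imaginary shift of `F` under lattice translations. -/
def t (l : ℂ) : ℝ := (cc D.W D.ω l).im

/-- The regular points. -/
def E : Set ℂ := {k | k ∉ D.L ∧ D.DF k ≠ 0}

variable {D}

lemma ω_ne : D.ω ≠ 0 := by
  intro h; exact D.hω' (h ▸ zero_mem)

lemma F_hd {k : ℂ} (hk : k ∉ D.L) : HasDerivAt D.F (D.DF k) k := FF_hd hk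

lemma F_an {k : ℂ} (hk : k ∉ D.L) : AnalyticAt ℂ D.F k := FF_an hk

lemma F_cont {k : ℂ} (hk : k ∉ D.L) : ContinuousAt D.F k := (F_an hk).continuousAt

lemma DF_an {k : ℂ} (hk : k ∉ D.L) : AnalyticAt ℂ D.DF k := by
  have h2 := P_an hk
  unfold DF
  fun_prop

lemma DF_per {k l : ℂ} (hl : l ∈ D.L) : D.DF (k + l) = D.DF k := by
  simp only [DF, P_per hl]

lemma F_neg (k : ℂ) : D.F (-k) = -D.F k := FF_neg _ _

lemma t_cc {l : ℂ} (hl : l ∈ D.L) : cc D.W D.ω l = D.t l * I := by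
  apply Complex.ext
  · rw [cc_re D.hω D.hω' hl]; simp
  · simp [t]

lemma F_add {k l : ℂ} (hl : l ∈ D.L) (hk : k ∉ D.L) : D.F (k + l) = D.F k + D.t l * I := by
  rw [← t_cc hl]; exact FF_add hl hk

lemma t_int {l : ℂ} (hl : l ∈ D.L) : ∃ n : ℤ, D.t l = n * Real.pi := by
  obtain ⟨n, hn⟩ := cc_int D.hω D.hω' hl
  refine ⟨n, ?_⟩
  rw [t, hn]; simp

lemma t_zero : D.t 0 = 0 := by
  have h := F_add (D := D) zero_mem D.hω'
  rw [add_zero] at h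
  have : (D.t 0 : ℂ) * I = 0 := by linear_combination -h
  simpa using this

lemma t_add {l l' : ℂ} (hl : l ∈ D.L) (hl' : l' ∈ D.L) : D.t (l + l') = D.t l + D.t l' := by
  have h1 := F_add hl' D.hω'
  have h1' : D.ω + l' ∉ D.L := by rw [add_mem_iff hl']; exact D.hω'
  have h2 := F_add hl h1'
  have h3 := F_add (add_mem hl hl') D.hω'
  rw [show D.ω + (l + l') = D.ω + l' + l by ring] at h3
  have : ((D.t (l + l') : ℂ) - (D.t l + D.t l')) * I = 0 := by
    linear_combination h2 + h1 - h3
  have h4 := (mul_eq_zero.1 this).resolve_right I_ne_zero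
  have h5 : ((D.t (l + l') - (D.t l + D.t l') : ℝ) : ℂ) = 0 := by push_cast; exact h4
  have := Complex.ofReal_eq_zero.1 h5
  linarith

lemma t_neg {l : ℂ} (hl : l ∈ D.L) : D.t (-l) = -D.t l := by
  have := t_add hl (neg_mem hl)
  rw [add_neg_cancel, t_zero] at this
  linarith

lemma E_add {k l : ℂ} (hl : l ∈ D.L) (hk : k ∈ D.E) : k + l ∈ D.E :=
  ⟨by rw [add_mem_iff hl]; exact hk.1, by rw [DF_per hl]; exact hk.2⟩

lemma E_open : IsOpen D.E := by
  rw [isOpen_iff_mem_nhds]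
  intro k hk
  exact (ev_notMem' hk.1).and ((DF_an hk.1).continuousAt.eventually_ne hk.2)

lemma E_of_u {k : ℂ} (hk : k ∉ D.L) (hu : (D.F k).re = 0) : k ∈ D.E :=
  ⟨hk, fun h => D.hns k hk h hu⟩

end Ctx

section inv
variable {𝕜 : Type*} [NontriviallyNormedField 𝕜] [CompleteSpace 𝕜]

lemma loc_inv {f : 𝕜 → 𝕜} {f' a : 𝕜} (hf : HasStrictDerivAt f f' a) (hf' : f' ≠ 0) {V : Set 𝕜}
    (hV : V ∈ 𝓝 a) : ∃ e : OpenPartialHomeomorph 𝕜 𝕜, (e : 𝕜 → 𝕜) = f ∧ a ∈ e.source ∧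
      e.source ⊆ V ∧ ∃ r > 0, Metric.ball (f a) r ⊆ e.target := by
  let i : 𝕜 ≃L[𝕜] 𝕜 := .unitsEquivAut 𝕜 (.mk0 _ hf')
  have hfd : HasStrictFDerivAt f i.toContinuousLinearMap a := hf
  let e0 : OpenPartialHomeomorph 𝕜 𝕜 := hfd.toOpenPartialHomeomorph _
  let e := e0.restr (interior V)
  have ha : a ∈ e.source := by
    rw [OpenPartialHomeomorph.restr_source]
    exact ⟨HasStrictFDerivAt.mem_toOpenPartialHomeomorph_source _, by
      rw [interior_interior]; exact mem_interior_iff_mem_nhds.2 hV⟩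
  have hef : (e : 𝕜 → 𝕜) = f := rfl
  refine ⟨e, hef, ha, ?_, ?_⟩
  · rw [OpenPartialHomeomorph.restr_source, interior_interior]
    exact inter_subset_right.trans interior_subset
  · have := e.open_target.mem_nhds (e.map_source ha)
    rw [hef] at this
    obtain ⟨r, hr, h⟩ := Metric.mem_nhds_iff.1 this
    exact ⟨r, hr, h⟩

lemma loc_inv_an {f : 𝕜 → 𝕜} {a : 𝕜} (hf : AnalyticAt 𝕜 f a) (hf' : deriv f a ≠ 0)
    {e : OpenPartialHomeomorph 𝕜 𝕜} (he : (e : 𝕜 → 𝕜) = f) (ha : a ∈ e.source) :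
    AnalyticAt 𝕜 e.symm (f a) := by
  let i : 𝕜 ≃L[𝕜] 𝕜 := .unitsEquivAut 𝕜 (.mk0 _ hf')
  rw [← he]
  refine e.analyticAt_symm' (i := i) ha (he ▸ hf) ?_
  rw [he]
  ext
  simp [i]

end inv

namespace Ctx
variable {D : Ctx}

lemma F_strict {k : ℂ} (hk : k ∉ D.L) : HasStrictDerivAt D.F (D.DF k) k := by
  have := (F_an hk).hasStrictDerivAt
  rwa [(F_hd hk).deriv] at this

lemma F_locHomeo : IsLocalHomeomorphOn D.F D.E := by
  refine IsLocalHomeomorphOn.mk _ _ fun k hk => ?_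
  obtain ⟨e, he, hek, -, -⟩ := loc_inv (F_strict hk.1) hk.2 univ_mem
  exact ⟨e, hek, fun x _ => by rw [he]⟩

lemma p_locHomeo : IsLocalHomeomorph (fun k : D.E => D.F k) := by
  rw [isLocalHomeomorph_iff_isLocalHomeomorphOn_univ]
  have h1 : IsLocalHomeomorph (Subtype.val : D.E → ℂ) :=
    (E_open.isOpenEmbedding_subtypeVal).isLocalHomeomorph
  rw [isLocalHomeomorph_iff_isLocalHomeomorphOn_univ] at h1
  exact F_locHomeo.comp h1 (fun k _ => k.2)

lemma lift_unique {A : Type*} [TopologicalSpace A] {s : Set A} (hs : IsPreconnected s)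
    {f g : A → ℂ} (hf : ContinuousOn f s) (hg : ContinuousOn g s)
    (hfE : ∀ x ∈ s, f x ∈ D.E) (hgE : ∀ x ∈ s, g x ∈ D.E)
    (h : ∀ x ∈ s, D.F (f x) = D.F (g x)) {a : A} (ha : a ∈ s) (hfg : f a = g a) :
    ∀ x ∈ s, f x = g x := by
  rw [isPreconnected_iff_preconnectedSpace] at hs
  rw [continuousOn_iff_continuous_domRestrict] at hf hg
  let f1 : s → D.E := fun x => ⟨f x, hfE x x.2⟩
  let g1 : s → D.E := fun x => ⟨g x, hgE x x.2⟩
  have hf1 : Continuous f1 := hf.subtype_mk _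
  have hg1 : Continuous g1 := hg.subtype_mk _
  have key : f1 = g1 := IsSeparatedMap.eq_of_comp_eq (p := fun k : D.E => D.F k)
    (T2Space.isSeparatedMap _) p_locHomeo.isLocallyInjective hf1 hg1
    (funext fun x => h x x.2) ⟨a, ha⟩ (Subtype.ext hfg)
  intro x hx
  exact congrArg Subtype.val (congrFun key ⟨x, hx⟩)

lemma uniform_of_local (Q : ℝ → ℂ → Prop) (mono : ∀ a b k, a ≤ b → Q b k → Q a k)
    (trans : ∀ a k, ∀ l ∈ D.L, Q a k → Q a (k + l))
    (loc : ∀ z, ∃ a > 0, ∀ᶠ k in 𝓝 z, Q a k) : ∃ a > 0, ∀ k, Q a k := by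
  obtain ⟨R, hR⟩ := exists_reduce (W := D.W)
  have : ∃ a > 0, ∀ k ∈ Metric.closedBall (0 : ℂ) R, Q a k := by
    refine (isCompact_closedBall (0:ℂ) R).induction_on (p := fun s => ∃ a > 0, ∀ k ∈ s, Q a k)
      ⟨1, one_pos, by simp⟩ ?_ ?_ ?_
    · rintro s t hst ⟨a, ha, h⟩
      exact ⟨a, ha, fun k hk => h k (hst hk)⟩
    · rintro s t ⟨a, ha, h⟩ ⟨b, hb, h'⟩
      refine ⟨min a b, lt_min ha hb, ?_⟩
      rintro k (hk | hk)
      · exact mono _ _ _ (min_le_left _ _) (h k hk)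
      · exact mono _ _ _ (min_le_right _ _) (h' k hk)
    · intro z _
      obtain ⟨a, ha, h⟩ := loc z
      exact ⟨_, mem_nhdsWithin_of_mem_nhds h, a, ha, fun k hk => hk⟩
  obtain ⟨a, ha, h⟩ := this
  refine ⟨a, ha, fun k => ?_⟩
  obtain ⟨l, hl, hkl⟩ := hR k
  have := trans a (k + l) (-l) (neg_mem hl) (h _ (by simpa using hkl))
  simpa using this

/-- Inverse of `F` near infinity. -/
lemma F_near_zero : ∃ e : OpenPartialHomeomorph ℂ ℂ, ∃ r > 0, (0:ℂ) ∈ e.source ∧ e 0 = 0 ∧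
    e.symm 0 = 0 ∧ Metric.ball 0 r ⊆ e.target ∧
    (∀ k ∈ e.source, k ≠ 0 → k ∈ D.E ∧ D.F k * e k = 1) := by
  obtain ⟨a, ha, ha0, had, hev⟩ := Z_exp (W := D.W)
  set f : ℂ → ℂ := fun z => z / (D.W.Z D.ω * z ^ 2 - D.ω - D.ω * z * a z) with hf
  have hden : AnalyticAt ℂ (fun z => D.W.Z D.ω * z ^ 2 - D.ω - D.ω * z * a z) 0 := by fun_prop
  have hω0 := D.ω_ne
  have hfan : AnalyticAt ℂ f 0 := analyticAt_id.div hden (by simpa using hω0)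
  have hfd : HasDerivAt f (-1 / D.ω) 0 := by
    have := (hasDerivAt_id (0:ℂ)).div hden.differentiableAt.hasDerivAt (by simpa using hω0)
    refine this.congr_deriv ?_
    simp; field_simp
  have hfs : HasStrictDerivAt f (-1 / D.ω) 0 := by
    have := hfan.hasStrictDerivAt
    rwa [hfd.deriv] at this
  have hP : ∀ᶠ k in 𝓝[≠] (0:ℂ), D.DF k ≠ 0 := by
    filter_upwards [(P_tendsto_zero (W := D.W)).eventually_gt_atTop (‖D.W.Z D.ω‖ / ‖D.ω‖)]
      with k hk h
    rw [DF] at h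
    have h1 : D.ω * D.W.P k = -D.W.Z D.ω := by linear_combination h
    have h2 := congrArg norm h1
    rw [norm_mul, norm_neg] at h2
    have hωn : 0 < ‖D.ω‖ := norm_pos_iff.2 hω0
    rw [div_lt_iff₀ hωn] at hk
    linarith
  have hne : ∀ᶠ k in 𝓝 (0:ℂ), D.W.Z D.ω * k ^ 2 - D.ω - D.ω * k * a k ≠ 0 :=
    hden.continuousAt.eventually_ne (by simpa using hω0)
  have hall := (hP.and (hev.and (ev_notMem (W := D.W) 0)))
  rw [eventually_nhdsWithin_iff] at hall
  obtain ⟨e, he, h0, hs, r, hr, hb⟩ := loc_inv hfs (by simp [hω0]) (hall.and hne)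
  have hf0 : f 0 = 0 := by simp [hf]
  rw [hf0] at hb
  have he0 : e 0 = 0 := by rw [he, hf0]
  refine ⟨e, r, hr, h0, he0, ?_, hb, ?_⟩
  · have := e.left_inv h0
    rwa [he0] at this
  · intro k hk hk0
    obtain ⟨h1, h2⟩ := hs hk
    obtain ⟨h3, h4, h5⟩ := h1 hk0
    refine ⟨⟨h5, h3⟩, ?_⟩
    rw [he]
    simp only [F, FF, hf, h4]
    rw [← mul_div_assoc, div_eq_one_iff_eq h2]
    field_simp
    ring

end Ctx
end Lame

namespace Lame
open scoped Topology
namespace Ctx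
variable {D : Ctx}

lemma G0_exists (D : Ctx) : ∃ (G : ℂ → ℂ) (R δ : ℝ), 0 < R ∧ 0 < δ ∧
    ContinuousOn G {w | R < ‖w‖} ∧ (∀ w, R < ‖w‖ → G w ∈ D.E ∧ D.F (G w) = w) ∧
    Tendsto G (Bornology.cobounded ℂ) (𝓝 0) ∧
    (∀ k, k ≠ 0 → ‖k‖ < δ → k ∈ D.E ∧ R + 1 < ‖D.F k‖ ∧ G (D.F k) = k) := by
  obtain ⟨e, r, hr, h0, he0, hs0, hb, hE⟩ := F_near_zero (D := D)
  have hmem : ∀ w : ℂ, 1 / r < ‖w‖ → w⁻¹ ∈ Metric.ball (0:ℂ) r := by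
    intro w hw
    have : 0 < ‖w‖ := lt_trans (by positivity) hw
    rw [mem_ball_zero_iff, norm_inv]
    rw [div_lt_iff₀ hr] at hw
    rw [inv_lt_iff_one_lt_mul₀ this]; linarith
  have hne : ∀ w : ℂ, 1 / r < ‖w‖ → w ≠ 0 := by
    rintro w hw rfl
    rw [norm_zero] at hw
    exact absurd hw (not_lt.2 (by positivity))
  have hev : ∀ᶠ k in 𝓝 (0:ℂ), k ∈ e.source ∧ ‖e k‖ < 1 / (1 / r + 1) := by
    refine Filter.Eventually.and (e.open_source.mem_nhds h0) ?_
    have := (e.continuousAt h0).norm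
    rw [ContinuousAt, he0, norm_zero] at this
    exact this.eventually_lt_const (by positivity)
  obtain ⟨δ, hδ, hev⟩ := Metric.eventually_nhds_iff.1 hev
  refine ⟨fun w => e.symm w⁻¹, 1 / r, δ, by positivity, hδ, ?_, ?_, ?_, ?_⟩
  · refine e.continuousOn_symm.comp ?_ (fun w hw => hb (hmem w hw))
    exact continuousOn_id.inv₀ (fun w hw => hne w hw)
  · intro w hw
    have h1 := e.map_target (hb (hmem w hw))
    have h2 := e.right_inv (hb (hmem w hw))
    have h3 : e.symm w⁻¹ ≠ 0 := by
      intro h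
      rw [h, he0] at h2
      exact inv_ne_zero (hne w hw) h2.symm
    obtain ⟨h4, h5⟩ := hE _ h1 h3
    refine ⟨h4, ?_⟩
    rw [h2] at h5
    have := hne w hw
    exact (mul_inv_eq_one₀ this).1 h5
  · have h1 : Tendsto (fun w : ℂ => w⁻¹) (Bornology.cobounded ℂ) (𝓝 0) :=
      tendsto_inv₀_cobounded
    have h2 : ContinuousAt e.symm 0 := e.symm.continuousAt (hb (Metric.mem_ball_self hr))
    rw [ContinuousAt, hs0] at h2
    exact h2.comp h1
  · intro k hk hkδ
    obtain ⟨h1, h2⟩ := hev (by simpa using hkδ : dist k 0 < δ)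
    obtain ⟨h3, h4⟩ := hE k h1 hk
    have h5 : e k ≠ 0 := right_ne_zero_of_mul_eq_one h4
    have h6 : D.F k = (e k)⁻¹ := eq_inv_of_mul_eq_one_left h4
    refine ⟨h3, ?_, ?_⟩
    · rw [h6, norm_inv]
      rw [lt_inv_comm₀ (by positivity) (norm_pos_iff.2 h5)]
      simpa using h2
    · simp only [h6, inv_inv]
      exact e.left_inv h1

/-- `F` has a continuous section on the ball of radius `ρ` around `F k`, through `k`. -/
def Good (D : Ctx) (ρ : ℝ) (k : ℂ) : Prop := ∃ g : ℂ → ℂ, ContinuousOn g (Metric.ball (D.F k) ρ) ∧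
  (∀ w ∈ Metric.ball (D.F k) ρ, g w ∈ D.E ∧ D.F (g w) = w) ∧ g (D.F k) = k

lemma Good.mono {ρ ρ' : ℝ} {k : ℂ} (h : ρ' ≤ ρ) (hg : D.Good ρ k) : D.Good ρ' k := by
  obtain ⟨g, h1, h2, h3⟩ := hg
  have := Metric.ball_subset_ball h (x := D.F k)
  exact ⟨g, h1.mono this, fun w hw => h2 w (this hw), h3⟩

lemma Good.add {ρ : ℝ} {k l : ℂ} (hl : l ∈ D.L) (hk : k ∉ D.L) (hg : D.Good ρ k) :
    D.Good ρ (k + l) := by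
  obtain ⟨g, h1, h2, h3⟩ := hg
  have hm : ∀ w ∈ Metric.ball (D.F (k + l)) ρ, w - D.t l * I ∈ Metric.ball (D.F k) ρ := by
    intro w hw
    rw [F_add hl hk, mem_ball_iff_norm] at hw
    rw [mem_ball_iff_norm]
    rwa [show w - D.t l * I - D.F k = w - (D.F k + D.t l * I) by ring]
  refine ⟨fun w => g (w - D.t l * I) + l, ?_, ?_, ?_⟩
  · refine ContinuousOn.add (h1.comp (by fun_prop) hm) continuousOn_const
  · intro w hw
    obtain ⟨h4, h5⟩ := h2 _ (hm w hw)
    refine ⟨E_add hl h4, ?_⟩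
    rw [F_add hl h4.1, h5]; ring
  · simp only [F_add hl hk, add_sub_cancel_right, h3]

lemma good_zero : ∀ᶠ k in 𝓝 (0:ℂ), k ∉ D.L → D.Good 1 k := by
  obtain ⟨G, R, δ, hR, hδ, hc, hG, -, hk⟩ := G0_exists D
  filter_upwards [Metric.ball_mem_nhds (0:ℂ) hδ] with k hkδ hkL
  have hk0 : k ≠ 0 := by rintro rfl; exact hkL zero_mem
  obtain ⟨h1, h2, h3⟩ := hk k hk0 (by simpa using hkδ)
  have : Metric.ball (D.F k) 1 ⊆ {w | R < ‖w‖} := by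
    intro w hw
    rw [mem_ball_iff_norm] at hw
    have := norm_sub_norm_le (D.F k) w
    rw [norm_sub_rev] at this
    simp only [mem_ofPred_eq]; linarith
  exact ⟨G, hc.mono this, fun w hw => hG w (this hw), h3⟩

lemma good_uniform (D : Ctx) {ε : ℝ} (hε : 0 < ε) :
    ∃ ρ > 0, ∀ k, k ∉ D.L → ε ≤ ‖D.DF k‖ → D.Good ρ k := by
  refine uniform_of_local (D := D) (fun ρ k => k ∉ D.L → ε ≤ ‖D.DF k‖ → D.Good ρ k) ?_ ?_ ?_
  · intro a b k hab h h1 h2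
    exact (h h1 h2).mono hab
  · intro a k l hl h h1 h2
    rw [add_mem_iff hl] at h1
    rw [DF_per hl] at h2
    exact (h h1 h2).add hl h1
  · intro z
    by_cases hz : z ∈ D.L
    · refine ⟨1, one_pos, ?_⟩
      have h1 : Tendsto (fun k => k - z) (𝓝 z) (𝓝 0) := by
        have : Continuous fun k : ℂ => k - z := by fun_prop
        simpa using this.tendsto z
      filter_upwards [h1.eventually (good_zero (D := D))] with k hk hkL _
      have h2 : k - z ∉ D.L := by rwa [sub_mem_iff hz]
      have := (hk h2).add hz h2
      simpa using this
    · by_cases hd : D.DF z = 0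
      · refine ⟨1, one_pos, ?_⟩
        have := (DF_an hz).continuousAt.norm
        rw [ContinuousAt, hd, norm_zero] at this
        filter_upwards [this.eventually_lt_const hε] with k hk _ h
        linarith
      · obtain ⟨e, he, hze, hes, r, hr, hb⟩ := loc_inv (F_strict hz) hd (E_open.mem_nhds ⟨hz, hd⟩)
        refine ⟨r / 2, by positivity, ?_⟩
        filter_upwards [e.open_source.mem_nhds hze,
          (F_cont hz).eventually (Metric.ball_mem_nhds _ (half_pos hr))] with k hk1 hk2 _ _
        have hsub : Metric.ball (D.F k) (r / 2) ⊆ e.target := by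
          refine Subset.trans ?_ hb
          apply Metric.ball_subset_ball'
          have := Metric.mem_ball.1 hk2
          linarith
        refine ⟨e.symm, e.continuousOn_symm.mono hsub, ?_, ?_⟩
        · intro w hw
          have h1 := e.right_inv (hsub hw)
          rw [he] at h1
          exact ⟨hes (e.map_target (hsub hw)), h1⟩
        · have := e.left_inv hk1
          rwa [he] at this

/-- `H` lifts the ray `a + s θ`, `0 ≤ s < b`. -/
def Lift (D : Ctx) (a θ : ℂ) (b : ℝ) (H : ℝ → ℂ) : Prop :=
  ContinuousOn H (Ico 0 b) ∧ ∀ s ∈ Ico (0:ℝ) b, H s ∈ D.E ∧ D.F (H s) = a + s * θ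

lemma Lift.mono {a θ : ℂ} {b b' : ℝ} {H : ℝ → ℂ} (hb : b' ≤ b) (h : D.Lift a θ b H) :
    D.Lift a θ b' H :=
  ⟨h.1.mono (Ico_subset_Ico_right hb), fun s hs => h.2 s (Ico_subset_Ico_right hb hs)⟩

lemma Lift.unique {a θ : ℂ} {b : ℝ} {H H' : ℝ → ℂ} (h : D.Lift a θ b H) (h' : D.Lift a θ b H')
    {s : ℝ} (hs : s ∈ Ico 0 b) (heq : H s = H' s) : ∀ x ∈ Ico 0 b, H x = H' x :=
  lift_unique isPreconnected_Ico h.1 h'.1 (fun x hx => (h.2 x hx).1) (fun x hx => (h'.2 x hx).1)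
    (fun x hx => by rw [(h.2 x hx).2, (h'.2 x hx).2]) hs heq

/-- Extend a lift using a good section. -/
lemma Lift.extend {a θ : ℂ} {b s ρ : ℝ} {H : ℝ → ℂ} (hθ : ‖θ‖ = 1) (h : D.Lift a θ b H)
    (hs : s ∈ Ico 0 b) (hg : D.Good ρ (H s)) :
    ∃ H', D.Lift a θ (s + ρ) H' ∧ H' 0 = H 0 := by
  obtain ⟨g, h1, h2, h3⟩ := hg
  have hFs := (h.2 s hs).2
  have hm : ∀ x ∈ Ico s (s + ρ), a + x * θ ∈ Metric.ball (D.F (H s)) ρ := by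
    intro x hx
    rw [hFs, mem_ball_iff_norm, show a + x * θ - (a + s * θ) = ((x - s : ℝ) : ℂ) * θ by push_cast; ring,
      norm_mul, hθ, mul_one, Complex.norm_real, Real.norm_of_nonneg (by linarith [hx.1])]
    linarith [hx.2]
  have hcg : ContinuousOn (fun x : ℝ => g (a + x * θ)) (Ico s (s + ρ)) :=
    h1.comp (by fun_prop) hm
  refine ⟨fun x => if x ≤ s then H x else g (a + x * θ), ⟨?_, ?_⟩, by simp [hs.1]⟩
  · intro x hx
    rcases lt_trichotomy x s with hlt | heq | hgt
    · have : ContinuousWithinAt H (Ico 0 s) x :=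
        (h.1 x ⟨hx.1, hlt.trans hs.2⟩).mono (Ico_subset_Ico_right hs.2.le)
      have h4 : ContinuousWithinAt H (Ico 0 (s + ρ)) x := by
        refine this.mono_of_mem_nhdsWithin ?_
        rw [mem_nhdsWithin]
        exact ⟨Iio s, isOpen_Iio, hlt, fun y hy => ⟨hy.2.1, hy.1⟩⟩
      refine h4.congr_of_eventuallyEq ?_ (by simp [hlt.le])
      filter_upwards [mem_nhdsWithin_of_mem_nhds (Iio_mem_nhds hlt)] with y hy
      simp [le_of_lt (mem_Iio.1 hy)]
    · subst heq
      have hl : ContinuousWithinAt (fun y => if y ≤ x then H y else g (a + y * θ)) (Icc 0 x) x := by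
        have : ContinuousWithinAt H (Icc 0 x) x :=
          (h.1 x hs).mono (fun y hy => ⟨hy.1, hy.2.trans_lt hs.2⟩)
        refine this.congr (fun y hy => by simp [hy.2]) (by simp)
      have hr : ContinuousWithinAt (fun y => if y ≤ x then H y else g (a + y * θ))
          (Ico x (x + ρ)) x := by
        have : ContinuousWithinAt (fun y : ℝ => g (a + y * θ)) (Ico x (x + ρ)) x :=
          hcg x ⟨le_rfl, hx.2⟩
        have hgx : H x = g (a + x * θ) := by rw [← hFs, h3]
        refine this.congr (fun y hy => ?_) (by simp [hgx])
        split_ifs with hle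
        · have : y = x := le_antisymm hle hy.1
          rw [this, hgx]
        · rfl
      refine (hl.union hr).mono ?_
      intro y hy
      rcases le_total y x with h' | h'
      · exact Or.inl ⟨hy.1, h'⟩
      · exact Or.inr ⟨h', hy.2⟩
    · have : ContinuousWithinAt (fun x : ℝ => g (a + x * θ)) (Ico s (s + ρ)) x :=
        hcg x ⟨hgt.le, hx.2⟩
      have h4 : ContinuousWithinAt (fun x : ℝ => g (a + x * θ)) (Ico 0 (s + ρ)) x := by
        refine this.mono_of_mem_nhdsWithin ?_
        rw [mem_nhdsWithin]
        exact ⟨Ioi s, isOpen_Ioi, hgt, fun y hy => ⟨le_of_lt hy.1, hy.2.2⟩⟩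
      refine h4.congr_of_eventuallyEq ?_ (by simp [hgt])
      filter_upwards [mem_nhdsWithin_of_mem_nhds (Ioi_mem_nhds hgt)] with y hy
      simp [not_le.2 (mem_Ioi.1 hy)]
  · intro x hx
    by_cases hxs : x ≤ s
    · simp only [hxs, if_true]
      exact h.2 x ⟨hx.1, hxs.trans_lt hs.2⟩
    · simp only [hxs, if_false]
      exact h2 _ (hm x ⟨(not_le.1 hxs).le, hx.2⟩)

lemma ray_lift {k : ℂ} (hk : k ∈ D.E) {θ : ℂ} (hθ : ‖θ‖ = 1) :
    (∃ H, H 0 = k ∧ ∀ b, D.Lift (D.F k) θ b H) ∨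
    (∃ b > 0, ∃ H, H 0 = k ∧ D.Lift (D.F k) θ b H ∧
      Tendsto (fun s => D.DF (H s)) (𝓝[<] b) (𝓝 0)) := by
  set B : Set ℝ := {b | 0 < b ∧ ∃ H, H 0 = k ∧ D.Lift (D.F k) θ b H} with hB
  have hne : B.Nonempty := by
    obtain ⟨ρ, hρ, h⟩ := good_uniform D (norm_pos_iff.2 hk.2)
    obtain ⟨g, h1, h2, h3⟩ := h k hk.1 le_rfl
    have hm : ∀ s ∈ Ico 0 ρ, D.F k + s * θ ∈ Metric.ball (D.F k) ρ := by
      intro s hs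
      rw [mem_ball_iff_norm, add_sub_cancel_left, norm_mul, hθ, mul_one, Complex.norm_real,
        Real.norm_of_nonneg hs.1]
      exact hs.2
    refine ⟨ρ, hρ, fun s => g (D.F k + s * θ), by simp [h3], ?_, fun s hs => h2 _ (hm s hs)⟩
    exact h1.comp (by fun_prop) hm
  -- glue all lifts
  have glue : ∃ H : ℝ → ℂ, H 0 = k ∧ ∀ b ∈ B, D.Lift (D.F k) θ b H := by
    have hch : ∀ s : ℝ, ∃ z : ℂ, ∀ b ∈ B, 0 ≤ s → s < b → ∀ H, H 0 = k → D.Lift (D.F k) θ b H →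
        H s = z := by
      intro s
      by_cases hs : ∃ b ∈ B, 0 ≤ s ∧ s < b
      · obtain ⟨b, hb, hs0, hsb⟩ := hs
        obtain ⟨hb0, H, hH0, hH⟩ := hb
        refine ⟨H s, fun b' hb' _ hsb' H' hH0' hH' => ?_⟩
        have hm := lt_min hsb hsb'
        exact Lift.unique (hH'.mono (min_le_right b b')) (hH.mono (min_le_left b b'))
          (s := 0) ⟨le_rfl, hs0.trans_lt hm⟩ (hH0'.trans hH0.symm) s ⟨hs0, hm⟩
      · exact ⟨0, fun b hb h1 h2 => absurd ⟨b, hb, h1, h2⟩ hs⟩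
    choose H hH using hch
    refine ⟨H, ?_, ?_⟩
    · obtain ⟨b, hb⟩ := hne
      obtain ⟨hb0, H', hH0', hH'⟩ := id hb
      rw [← hH0']
      exact (hH 0 b hb le_rfl hb0 H' hH0' hH').symm
    · intro b hb
      obtain ⟨hb0, H', hH0', hH'⟩ := id hb
      have heq : ∀ s ∈ Ico 0 b, H s = H' s := fun s hs =>
        (hH s b hb hs.1 hs.2 H' hH0' hH').symm
      refine ⟨hH'.1.congr heq, fun s hs => ?_⟩
      rw [heq s hs]; exact hH'.2 s hs
  obtain ⟨H, hH0, hH⟩ := glue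
  by_cases hbd : BddAbove B
  · right
    set b := sSup B with hb
    have hb0 : 0 < b := by
      obtain ⟨b', hb'⟩ := hne
      exact hb'.1.trans_le (le_csSup hbd hb')
    have hlift : D.Lift (D.F k) θ b H := by
      have key : ∀ s ∈ Ico 0 b, ∃ b' ∈ B, s < b' := fun s hs => exists_lt_of_lt_csSup hne hs.2
      refine ⟨?_, ?_⟩
      · intro s hs
        obtain ⟨b', hb', hsb'⟩ := key s hs
        refine ((hH b' hb').1 s ⟨hs.1, hsb'⟩).mono_of_mem_nhdsWithin ?_
        rw [mem_nhdsWithin]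
        exact ⟨Iio b', isOpen_Iio, hsb', fun y hy => ⟨hy.2.1, hy.1⟩⟩
      · intro s hs
        obtain ⟨b', hb', hsb'⟩ := key s hs
        exact (hH b' hb').2 s ⟨hs.1, hsb'⟩
    refine ⟨b, hb0, H, hH0, hlift, ?_⟩
    rw [Metric.tendsto_nhds]
    intro ε hε
    by_contra hcon
    rw [Filter.not_eventually] at hcon
    obtain ⟨ρ, hρ, hgood⟩ := good_uniform D hε
    have h1 : ∀ᶠ s in 𝓝[<] b, s ∈ Ioo (max 0 (b - ρ)) b :=
      Ioo_mem_nhdsLT (max_lt hb0 (by linarith))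
    obtain ⟨s, hs1, hs2⟩ := (hcon.and_eventually h1).exists
    rw [dist_zero_right, not_lt] at hs1
    have hs0 : s ∈ Ico 0 b := ⟨(le_max_left _ _).trans hs2.1.le, hs2.2⟩
    obtain ⟨H', hH', hH0'⟩ := hlift.extend hθ hs0 (hgood _ (hlift.2 s hs0).1.1 hs1)
    have : s + ρ ∈ B := ⟨by linarith [hs0.1], H', hH0'.trans hH0, hH'⟩
    have h2 := le_csSup hbd this
    have h3 := (le_max_right 0 (b - ρ)).trans_lt hs2.1
    linarith
  · left
    refine ⟨H, hH0, fun b => ?_⟩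
    rw [not_bddAbove_iff] at hbd
    obtain ⟨b', hb', hbb'⟩ := hbd b
    exact (hH b' hb').mono hbb'.le

end Ctx
end Lame

namespace Lame
open scoped Topology
namespace Ctx
variable {D : Ctx}

lemma DF_tendsto_zero : Tendsto (fun k => ‖D.DF k‖) (𝓝[≠] 0) atTop := by
  have h1 : Tendsto (fun k => ‖D.ω‖ * ‖D.W.P k‖ + -‖D.W.Z D.ω‖) (𝓝[≠] 0) atTop :=
    tendsto_atTop_add_const_right _ _
      ((P_tendsto_zero (W := D.W)).const_mul_atTop (norm_pos_iff.2 D.ω_ne))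
  refine tendsto_atTop_mono (fun k => ?_) h1
  rw [← norm_mul, DF]
  have := norm_sub_norm_le (D.ω * D.W.P k) (-D.W.Z D.ω)
  rw [norm_neg, sub_neg_eq_add, add_comm (D.ω * _)] at this
  linarith

lemma tendsto_sub_zero (z : ℂ) : Tendsto (fun k => k - z) (𝓝 z) (𝓝 0) := by
  have : Continuous fun k : ℂ => k - z := by fun_prop
  simpa using this.tendsto z

lemma DF_lower (D : Ctx) : ∃ c > 0, ∀ k, k ∉ D.L → (D.F k).re = 0 → c ≤ ‖D.DF k‖ := by
  refine uniform_of_local (D := D) (fun c k => k ∉ D.L → (D.F k).re = 0 → c ≤ ‖D.DF k‖) ?_ ?_ ?_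
  · intro a b k hab h h1 h2
    exact hab.trans (h h1 h2)
  · intro a k l hl h h1 h2
    rw [add_mem_iff hl] at h1
    rw [DF_per hl]
    rw [F_add hl h1] at h2
    exact h h1 (by simpa using h2)
  · intro z
    by_cases hz : z ∈ D.L
    · refine ⟨1, one_pos, ?_⟩
      have h1 := (DF_tendsto_zero (D := D)).eventually_ge_atTop 1
      rw [eventually_nhdsWithin_iff] at h1
      filter_upwards [(tendsto_sub_zero z).eventually h1] with k hk hkL _
      have h2 : k - z ∉ D.L := by rwa [sub_mem_iff hz]
      have h3 : k - z ∈ ({0} : Set ℂ)ᶜ := by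
        intro h; rw [mem_singleton_iff] at h; rw [h] at h2; exact h2 zero_mem
      have := hk h3
      rwa [← DF_per hz, sub_add_cancel] at this
    · by_cases hu : (D.F z).re = 0
      · have hd : D.DF z ≠ 0 := (E_of_u hz hu).2
        have hd' := norm_pos_iff.2 hd
        refine ⟨‖D.DF z‖ / 2, by positivity, ?_⟩
        have := (DF_an hz).continuousAt.norm
        filter_upwards [this.eventually_const_lt (half_lt_self hd')] with k hk _ _
        exact hk.le
      · refine ⟨1, one_pos, ?_⟩
        have : ContinuousAt (fun k => (D.F k).re) z :=
          Complex.continuous_re.continuousAt.comp (F_cont hz)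
        filter_upwards [this.eventually_ne hu] with k hk _ h
        exact absurd h hk

/-- An orbit: a continuous solution of `F (K v) = i v`. -/
def Orb (D : Ctx) (K : ℝ → ℂ) : Prop := Continuous K ∧ ∀ v, K v ∉ D.L ∧ D.F (K v) = v * I

lemma Orb.u {K : ℝ → ℂ} (h : D.Orb K) (v : ℝ) : (D.F (K v)).re = 0 := by
  rw [(h.2 v).2]; simp

lemma Orb.E {K : ℝ → ℂ} (h : D.Orb K) (v : ℝ) : K v ∈ D.E := E_of_u (h.2 v).1 (h.u v)

lemma Orb.unique {K K' : ℝ → ℂ} (h : D.Orb K) (h' : D.Orb K') {v : ℝ} (hv : K v = K' v) (x : ℝ) :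
    K x = K' x :=
  lift_unique isPreconnected_univ h.1.continuousOn h'.1.continuousOn (fun x _ => h.E x)
    (fun x _ => h'.E x) (fun x _ => by rw [(h.2 x).2, (h'.2 x).2]) (mem_univ v) hv x (mem_univ x)

lemma orb_exists_aux {k θ : ℂ} (hk : k ∉ D.L) (hu : (D.F k).re = 0) (hθ : θ = I ∨ θ = -I) :
    ∃ H : ℝ → ℂ, H 0 = k ∧ ContinuousOn H (Ici 0) ∧
      ∀ s, 0 ≤ s → H s ∉ D.L ∧ D.F (H s) = D.F k + s * θ := by
  have hθn : ‖θ‖ = 1 := by rcases hθ with rfl | rfl <;> simp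
  have hθr : θ.re = 0 := by rcases hθ with rfl | rfl <;> simp
  rcases ray_lift (E_of_u hk hu) hθn with ⟨H, hH0, hH⟩ | ⟨b, hb, H, hH0, hH, hlim⟩
  · refine ⟨H, hH0, ?_, ?_⟩
    · intro s hs
      refine ((hH (s + 1)).1 s ⟨hs, by linarith⟩).mono_of_mem_nhdsWithin ?_
      rw [mem_nhdsWithin]
      exact ⟨Iio (s + 1), isOpen_Iio, by simp, fun y hy => ⟨hy.2, hy.1⟩⟩
    · intro s hs
      obtain ⟨h1, h2⟩ := (hH (s + 1)).2 s ⟨hs, by linarith⟩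
      exact ⟨h1.1, h2⟩
  · exfalso
    obtain ⟨c, hc, hlow⟩ := DF_lower D
    have h1 := hlim.norm
    rw [norm_zero] at h1
    have h2 : ∀ᶠ s in 𝓝[<] b, s ∈ Ioo 0 b := Ioo_mem_nhdsLT hb
    obtain ⟨s, hs1, hs2⟩ := ((h1.eventually_lt_const hc).and h2).exists
    obtain ⟨h3, h4⟩ := hH.2 s ⟨hs2.1.le, hs2.2⟩
    have := hlow (H s) h3.1 (by rw [h4]; simp [hu, hθr])
    linarith

lemma orb_exists {k : ℂ} (hk : k ∉ D.L) (hu : (D.F k).re = 0) :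
    ∃ K, D.Orb K ∧ K (D.F k).im = k := by
  obtain ⟨H, hH0, hHc, hH⟩ := orb_exists_aux hk hu (Or.inl rfl)
  obtain ⟨H', hH0', hHc', hH'⟩ := orb_exists_aux hk hu (Or.inr rfl)
  set v0 := (D.F k).im with hv0
  have hFk : D.F k = v0 * I := by
    apply Complex.ext
    · simp [hu]
    · simp [hv0]
  have c1 : Continuous fun v => H (max 0 (v - v0)) := by
    rw [← continuousOn_univ]
    exact hHc.comp (by fun_prop) (fun x _ => mem_Ici.2 (le_max_left _ _))
  have c2 : Continuous fun v => H' (max 0 (v0 - v)) := by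
    rw [← continuousOn_univ]
    exact hHc'.comp (by fun_prop) (fun x _ => mem_Ici.2 (le_max_left _ _))
  refine ⟨fun v => if v0 ≤ v then H (max 0 (v - v0)) else H' (max 0 (v0 - v)), ⟨?_, ?_⟩, ?_⟩
  · refine Continuous.if_le c1 c2 continuous_const continuous_id ?_
    intro x hx
    have : v0 = x := hx
    simp [this, hH0, hH0']
  · intro v
    by_cases hv : v0 ≤ v
    · simp only [hv, if_true]
      rw [max_eq_right (by linarith)]
      obtain ⟨h1, h2⟩ := hH (v - v0) (by linarith)
      refine ⟨h1, ?_⟩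
      rw [h2, hFk]; push_cast; ring
    · simp only [hv, if_false]
      rw [max_eq_right (by linarith)]
      obtain ⟨h1, h2⟩ := hH' (v0 - v) (by linarith)
      refine ⟨h1, ?_⟩
      rw [h2, hFk]; push_cast; ring
  · simp [hH0]

lemma Orb.translate {K : ℝ → ℂ} (h : D.Orb K) {l : ℂ} (hl : l ∈ D.L) :
    D.Orb (fun v => K (v - D.t l) + l) := by
  refine ⟨(h.1.comp (by fun_prop)).add continuous_const, fun v => ?_⟩
  obtain ⟨h1, h2⟩ := h.2 (v - D.t l)
  refine ⟨by rwa [add_mem_iff hl], ?_⟩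
  rw [F_add hl h1, h2]; push_cast; ring

lemma Orb.neg {K : ℝ → ℂ} (h : D.Orb K) : D.Orb (fun v => -K (-v)) := by
  refine ⟨(h.1.comp (by fun_prop)).neg, fun v => ?_⟩
  obtain ⟨h1, h2⟩ := h.2 (-v)
  refine ⟨by rwa [neg_mem_iff], ?_⟩
  rw [F_neg, h2]; push_cast; ring

lemma Orb.v_eq {K : ℝ → ℂ} (h : D.Orb K) {a b : ℝ} (hab : D.F (K a) = b * I) : a = b := by
  rw [(h.2 a).2] at hab
  have := mul_right_cancel₀ I_ne_zero hab
  exact_mod_cast this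

lemma Orb.sub {K K' : ℝ → ℂ} (h : D.Orb K) (h' : D.Orb K') {l : ℂ} (hl : l ∈ D.L) {a b : ℝ}
    (hab : K a = K' b + l) : a = b + D.t l ∧ ∀ v, K v = K' (v - D.t l) + l := by
  have h1 : a = b + D.t l := by
    apply h.v_eq
    rw [hab, F_add hl (h'.2 b).1, (h'.2 b).2]; push_cast; ring
  refine ⟨h1, h.unique (h'.translate hl) (v := a) ?_⟩
  rw [hab]; congr 2; linarith

lemma Orb.refl {K K' : ℝ → ℂ} (h : D.Orb K) (h' : D.Orb K') {l : ℂ} (hl : l ∈ D.L) {a b : ℝ}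
    (hab : K a + K' b = l) : a + b = D.t l ∧ ∀ v, K v = l - K' (D.t l - v) := by
  obtain ⟨h1, h2⟩ := h.sub h'.neg hl (a := a) (b := -b) (by
    rw [neg_neg]; linear_combination hab)
  refine ⟨by linarith, fun v => ?_⟩
  rw [h2 v, neg_sub]; ring

lemma Orb.hasDerivAt_analytic {K : ℝ → ℂ} (h : D.Orb K) (v : ℝ) :
    AnalyticAt ℝ K v ∧ deriv K v ≠ 0 := by
  have hE := h.E v
  obtain ⟨e, he, hs, -, -⟩ := loc_inv (F_strict hE.1) hE.2 univ_mem
  have hdF : deriv D.F (K v) ≠ 0 := by rw [(F_hd hE.1).deriv]; exact hE.2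
  have h1 := loc_inv_an (F_an hE.1) hdF he hs
  rw [(h.2 v).2] at h1
  have hlin : AnalyticAt ℝ (fun v : ℝ => (v : ℂ) * I) v :=
    (Complex.ofRealCLM.analyticAt v).mul analyticAt_const
  have h2 : AnalyticAt ℝ (fun v : ℝ => e.symm ((v : ℂ) * I)) v :=
    AnalyticAt.comp (g := e.symm) (h1.restrictScalars) hlin
  have h3 : ∀ᶠ x : ℝ in 𝓝 v, e.symm ((x : ℂ) * I) = K x := by
    filter_upwards [h.1.continuousAt.eventually (e.open_source.mem_nhds hs)] with x hx
    have := e.left_inv hx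
    rwa [he, (h.2 x).2] at this
  have hK : AnalyticAt ℝ K v := h2.congr h3
  refine ⟨hK, fun h0 => ?_⟩
  have h4 : HasDerivAt K 0 v := h0 ▸ hK.differentiableAt.hasDerivAt
  have h5 : HasDerivAt (fun x : ℝ => D.F (K x)) (D.DF (K v) * 0) v :=
    HasDerivAt.comp (h₂ := D.F) (h := K) v (F_hd hE.1) h4
  have h6 : HasDerivAt (fun x : ℝ => D.F (K x)) I v := by
    have : (fun x : ℝ => D.F (K x)) = fun x : ℝ => (x : ℂ) * I := funext fun x => (h.2 x).2
    rw [this]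
    simpa using (hasDerivAt_id v).ofReal_comp.mul_const I
  have := h5.unique h6
  rw [mul_zero] at this
  exact I_ne_zero this.symm

lemma Orb.locally_eq {K : ℝ → ℂ} (h : D.Orb K) (v : ℝ) :
    ∀ᶠ k in 𝓝 (K v), (D.F k).re = 0 → K (D.F k).im = k := by
  have hE := h.E v
  obtain ⟨e, he, hs, -, -⟩ := loc_inv (F_strict hE.1) hE.2 univ_mem
  have h1 : ContinuousAt (fun k => K (D.F k).im) (K v) := by
    refine ContinuousAt.comp (g := K) h.1.continuousAt ?_
    exact Complex.continuous_im.continuousAt.comp (F_cont hE.1)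
  have h2 : K (D.F (K v)).im = K v := by rw [(h.2 v).2]; simp
  rw [ContinuousAt, h2] at h1
  filter_upwards [e.open_source.mem_nhds hs, h1.eventually (e.open_source.mem_nhds hs)]
    with k hk1 hk2 hu
  apply e.injOn hk2 hk1
  rw [he, (h.2 _).2]
  apply Complex.ext
  · simp [hu]
  · simp

/-- `K` is periodic modulo the lattice. -/
def Per (D : Ctx) (K : ℝ → ℂ) (T : ℝ) (l : ℂ) : Prop :=
  0 < T ∧ l ∈ D.L ∧ D.t l = T ∧ ∀ v, K (v + T) = K v + l

lemma Orb.per_of {K : ℝ → ℂ} (h : D.Orb K) {l : ℂ} (hl : l ∈ D.L) {a b : ℝ}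
    (hab : K a = K b + l) (hlt : b < a) : D.Per K (a - b) l := by
  obtain ⟨h1, h2⟩ := h.sub h hl hab
  refine ⟨by linarith, hl, by linarith, fun v => ?_⟩
  rw [h2 (v + (a - b))]; congr 2; linarith

lemma Orb.dichotomy {K : ℝ → ℂ} (h : D.Orb K) (M : ℝ) {δ : ℝ} (hδ : 0 < δ) :
    (∃ T l, D.Per K T l) ∨ ∃ v ≤ M, ∃ l ∈ D.L, ‖K v - l‖ < δ := by
  by_contra hcon
  push Not at hcon
  obtain ⟨hnp, hfar⟩ := hcon
  obtain ⟨R, hR⟩ := exists_reduce (W := D.W)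
  choose l hl hlR using hR
  set y : ℕ → ℂ := fun n => K (M - n) + l (K (M - n)) with hy
  have hyc : ∀ n, y n ∈ Metric.closedBall (0:ℂ) R := fun n => by simpa using hlR (K (M - n))
  obtain ⟨z, -, φ, hφ, hlim⟩ := (isCompact_closedBall (0:ℂ) R).tendsto_subseq hyc
  have hyL : ∀ n, y n ∉ D.L := fun n => by rw [hy]; rw [add_mem_iff (hl _)]; exact (h.2 _).1
  have hyF : ∀ n : ℕ, D.F (y n) = ((M - n + D.t (l (K (M - n))) : ℝ) : ℂ) * I := fun n => by
    rw [hy]; simp only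
    rw [F_add (hl _) (h.2 _).1, (h.2 _).2]; push_cast; ring
  have hz : z ∉ D.L := by
    intro hzL
    have h1 : ∀ᶠ n in atTop, dist ((y ∘ φ) n) z < δ := Metric.tendsto_nhds.1 hlim δ hδ
    obtain ⟨n, hn⟩ := h1.exists
    have := hfar (M - φ n) (by simp) (z - l (K (M - φ n))) (sub_mem hzL (hl _))
    rw [dist_eq_norm] at hn
    simp only [hy, Function.comp] at hn
    rw [show K (M - φ n) - (z - l (K (M - φ n))) = K (M - φ n) + l (K (M - φ n)) - z by ring]
      at this
    linarith
  have hFlim : Tendsto (fun n => D.F (y (φ n))) atTop (𝓝 (D.F z)) := (F_cont hz).tendsto.comp hlim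
  have hu : (D.F z).re = 0 := by
    have h1 := (Complex.continuous_re.tendsto _).comp hFlim
    have h2 : (Complex.re ∘ fun n => D.F (y (φ n))) = fun _ => (0:ℝ) := by
      funext n
      simp only [Function.comp, hyF]
      simp
    rw [h2] at h1
    exact (tendsto_nhds_unique tendsto_const_nhds h1).symm
  obtain ⟨K', hK', hz'⟩ := orb_exists hz hu
  have hloc := hK'.locally_eq (D.F z).im
  rw [hz'] at hloc
  have h1 : ∀ᶠ n in atTop, K' (D.F (y (φ n))).im = y (φ n) := by
    filter_upwards [hlim.eventually hloc] with n hn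
    apply hn
    simp only [Function.comp, hyF]
    simp
  have h2 : ∀ᶠ n in atTop, dist (D.F (y (φ n))).im (D.F z).im < 1 / 2 :=
    Metric.tendsto_nhds.1 ((Complex.continuous_im.tendsto _).comp hFlim) _ (by norm_num)
  obtain ⟨N, hN⟩ := Filter.eventually_atTop.1 (h1.and h2)
  obtain ⟨a1, a2⟩ := hN N le_rfl
  obtain ⟨b1, b2⟩ := hN (N + 1) (Nat.le_succ N)
  have hφ' : (φ N : ℝ) + 1 ≤ φ (N + 1) := by exact_mod_cast hφ (Nat.lt_succ_self N)
  obtain ⟨s1, s2⟩ := hK'.sub h (hl _) a1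
  obtain ⟨s3, s4⟩ := hK'.sub h (hl _) b1
  set l1 := l (K (M - φ N))
  set l2 := l (K (M - φ (N + 1)))
  rw [s1] at a2
  rw [s3] at b2
  have h3 := dist_triangle_right (M - (φ N : ℝ) + D.t l1) (M - (φ (N + 1) : ℝ) + D.t l2) (D.F z).im
  rw [Real.dist_eq] at h3
  have h4 := abs_le.1 h3
  have hl1 : l1 ∈ D.L := hl _
  have hl2 : l2 ∈ D.L := hl _
  have h5 : K (0 - D.t l1) = K (0 - D.t l2) + (l2 - l1) := by
    have e1 := s2 0
    have e2 := s4 0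
    linear_combination e2 - e1
  exact hnp _ _ (h.per_of (sub_mem hl2 hl1) h5 (by linarith))

end Ctx
end Lame

namespace Lame
open scoped Topology
namespace Ctx
variable {D : Ctx}

lemma eq_im {z : ℂ} (h : z.re = 0) : z = (z.im : ℂ) * I := by
  apply Complex.ext
  · simp [h]
  · simp

lemma Kplus_exists (D : Ctx) : ∃ (K : ℝ → ℂ) (v0 δ : ℝ), D.Orb K ∧ 0 < v0 ∧ 0 < δ ∧
    Tendsto K atTop (𝓝 0) ∧ ∀ k, k ∉ D.L → (D.F k).re = 0 → ‖k‖ < δ →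
      (v0 < (D.F k).im ∧ K (D.F k).im = k) ∨ ((D.F k).im < -v0 ∧ K (-(D.F k).im) = -k) := by
  obtain ⟨G, R, δ, hR, hδ, hGc, hG, hG0, hnear⟩ := G0_exists D
  have hn : ∀ v : ℝ, ‖(v : ℂ) * I‖ = |v| := fun v => by simp
  have hv : ∀ v : ℝ, R + 1 ≤ v → R < ‖(v : ℂ) * I‖ := fun v h => by
    rw [hn, abs_of_pos (by linarith)]; linarith
  obtain ⟨hE0, hF0⟩ := hG _ (hv (R + 1) le_rfl)
  obtain ⟨K, hK, hK0⟩ := orb_exists hE0.1 (by rw [hF0]; simp)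
  rw [hF0] at hK0
  have hK0' : K (R + 1) = G (((R + 1 : ℝ) : ℂ) * I) := by
    rw [← hK0]; congr 1; simp
  have hKG : ∀ v ∈ Ici (R + 1), K v = G ((v : ℂ) * I) := by
    refine lift_unique (D := D) (f := K) (g := fun v : ℝ => G ((v : ℂ) * I)) isPreconnected_Ici
      hK.1.continuousOn ?_ (fun x _ => hK.E x) (fun x hx => (hG _ (hv x (mem_Ici.1 hx))).1) ?_
      (mem_Ici.2 le_rfl) hK0'
    · exact hGc.comp (by fun_prop) (fun x hx => hv x (mem_Ici.1 hx))
    · intro x hx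
      rw [(hK.2 x).2, (hG _ (hv x (mem_Ici.1 hx))).2]
  have hpos : ∀ k, k ∉ D.L → (D.F k).re = 0 → ‖k‖ < δ → 0 ≤ (D.F k).im →
      (R + 1 < (D.F k).im ∧ K (D.F k).im = k) := by
    intro k hk hu hkδ hi
    obtain ⟨h1, h2, h3⟩ := hnear k (fun h => hk (h ▸ zero_mem)) hkδ
    rw [eq_im hu, hn, abs_of_nonneg hi] at h2
    refine ⟨h2, ?_⟩
    rw [hKG _ (mem_Ici.2 h2.le), ← eq_im hu, h3]
  refine ⟨K, R + 1, δ, hK, by linarith, hδ, ?_, ?_⟩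
  · have h1 : Tendsto (fun v : ℝ => (v : ℂ) * I) atTop (Bornology.cobounded ℂ) := by
      rw [← tendsto_norm_atTop_iff_cobounded]
      simp only [hn]
      exact tendsto_abs_atTop_atTop
    refine (hG0.comp h1).congr' ?_
    filter_upwards [eventually_ge_atTop (R + 1)] with v hv
    exact (hKG v (mem_Ici.2 hv)).symm
  · intro k hk hu hkδ
    rcases le_total 0 (D.F k).im with h | h
    · exact Or.inl (hpos k hk hu hkδ h)
    · right
      obtain ⟨h1, h2⟩ := hpos (-k) (by rwa [neg_mem_iff]) (by rw [F_neg]; simp [hu])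
        (by rwa [norm_neg]) (by rw [F_neg]; simpa using h)
      rw [F_neg, Complex.neg_im] at h1 h2
      exact ⟨by linarith, h2⟩

lemma main_orbit (D : Ctx) : ∃ (K : ℝ → ℂ) (l : ℂ), D.Orb K ∧ l ∈ D.L ∧ Tendsto K atTop (𝓝 0) ∧
    (∀ x, K x = l - K (D.t l - x)) ∧ (∀ T l', ¬ D.Per K T l') ∧
    ∀ K', D.Orb K' → (∃ T l', D.Per K' T l') ∨
      ∃ l' ∈ D.L, ∀ v, K' v = K (v - D.t l') + l' := by
  obtain ⟨K, v0, δ, hK, hv0, hδ, hlim, hnear⟩ := Kplus_exists D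
  have hnp : ∀ T l', ¬ D.Per K T l' := by
    rintro T l' ⟨hT, hl', ht, hp⟩
    have h1 : Tendsto (fun v => K (v + T)) atTop (𝓝 0) :=
      hlim.comp (tendsto_atTop_add_const_right _ _ tendsto_id)
    have h2 : Tendsto (fun v => K (v + T)) atTop (𝓝 (0 + l')) := by
      simp only [hp]
      exact hlim.add_const l'
    have := tendsto_nhds_unique h1 h2
    rw [zero_add] at this
    rw [← this, t_zero] at ht
    linarith
  have hnear' : ∀ K', D.Orb K' → ∀ v, ∀ l ∈ D.L, ‖K' v - l‖ < δ →
      (v0 < v - D.t l ∧ K (v - D.t l) = K' v - l) ∨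
      (v - D.t l < -v0 ∧ K (-(v - D.t l)) = -(K' v - l)) := by
    intro K' hK' v l hl hd
    have h1 : D.F (K' v - l) = ((v - D.t l : ℝ) : ℂ) * I := by
      rw [sub_eq_add_neg, F_add (neg_mem hl) (hK'.2 v).1, (hK'.2 v).2, t_neg hl]; push_cast; ring
    have h2 := hnear (K' v - l) (by rw [sub_mem_iff hl]; exact (hK'.2 v).1) (by rw [h1]; simp) hd
    have h3 : (D.F (K' v - l)).im = v - D.t l := by rw [h1]; simp
    rwa [h3] at h2
  obtain ⟨l, hl, hsym⟩ : ∃ l ∈ D.L, ∀ x, K x = l - K (D.t l - x) := by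
    rcases hK.dichotomy (-v0 - 1) hδ with ⟨T, l, h⟩ | ⟨v, hv, l, hl, hd⟩
    · exact absurd h (hnp T l)
    · rcases hnear' K hK v l hl hd with ⟨h1, h2⟩ | ⟨h1, h2⟩
      · exact absurd (hK.per_of (neg_mem hl) (a := v - D.t l) (b := v)
          (by rw [h2, sub_eq_add_neg]) (by linarith)) (hnp _ _)
      · exact ⟨l, hl, (hK.refl hK hl (a := v) (b := -(v - D.t l)) (by rw [h2]; ring)).2⟩
  refine ⟨K, l, hK, hl, hlim, hsym, hnp, fun K' hK' => ?_⟩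
  rcases hK'.dichotomy 0 hδ with h | ⟨v, hv, l', hl', hd⟩
  · exact Or.inl h
  · right
    rcases hnear' K' hK' v l' hl' hd with ⟨h1, h2⟩ | ⟨h1, h2⟩
    · exact ⟨l', hl', (hK'.sub hK hl' (a := v) (b := v - D.t l') (by rw [h2]; ring)).2⟩
    · refine ⟨l' - l, sub_mem hl' hl, (hK'.sub hK (sub_mem hl' hl) (a := v)
        (b := D.t l - -(v - D.t l')) ?_).2⟩
      have := hsym (-(v - D.t l'))
      linear_combination -this + h2

end Ctx
end Lame

namespace Lame
open scoped Topology

lemma half_class {W : WeierstrassData} {h : ℂ} (hh : h ∉ W.lattice) (h2 : 2 * h ∈ W.lattice) :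
    h - W.w1 ∈ W.lattice ∨ h - W.w2 ∈ W.lattice ∨ h - W.w3 ∈ W.lattice := by
  obtain ⟨m, n, hmn⟩ := h2
  have hmn' : h = m * W.w1 + n * W.w3 := by linear_combination hmn / 2
  rcases Int.even_or_odd' m with ⟨m', rfl | rfl⟩ <;> rcases Int.even_or_odd' n with ⟨n', rfl | rfl⟩
  · exfalso; apply hh
    exact ⟨m', n', by rw [hmn']; push_cast; ring⟩
  · right; right
    exact ⟨m', n', by rw [hmn']; push_cast; ring⟩
  · left
    exact ⟨m', n', by rw [hmn']; push_cast; ring⟩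
  · right; left
    exact ⟨m', n', by rw [hmn', WeierstrassData.w2]; push_cast; ring⟩

lemma two_w1 {W : WeierstrassData} : 2 * W.w1 ∈ W.lattice := ⟨1, 0, by push_cast; ring⟩
lemma two_w3 {W : WeierstrassData} : 2 * W.w3 ∈ W.lattice := ⟨0, 1, by push_cast; ring⟩
lemma two_w2 {W : WeierstrassData} : 2 * W.w2 ∈ W.lattice :=
  ⟨1, 1, by rw [WeierstrassData.w2]; push_cast; ring⟩
lemma w12 {W : WeierstrassData} : W.w1 - W.w2 ∉ W.lattice := by
  rw [WeierstrassData.w2, show W.w1 - (W.w1 + W.w3) = -W.w3 by ring, neg_mem_iff]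
  exact w3_notMem
lemma w23 {W : WeierstrassData} : W.w2 - W.w3 ∉ W.lattice := by
  rw [WeierstrassData.w2, show W.w1 + W.w3 - W.w3 = W.w1 by ring]
  exact w1_notMem
lemma w13 {W : WeierstrassData} : W.w1 - W.w3 ∉ W.lattice := by
  intro h
  have := add_mem h (two_w3 (W := W))
  rw [show W.w1 - W.w3 + 2 * W.w3 = W.w2 by rw [WeierstrassData.w2]; ring] at this
  exact w2_notMem this

/-- any other half-period class exists -/
lemma exists_other {W : WeierstrassData} (h : ℂ) :
    ∃ b, b ∉ W.lattice ∧ 2 * b ∈ W.lattice ∧ b - h ∉ W.lattice := by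
  by_cases h1 : W.w1 - h ∈ W.lattice
  · refine ⟨W.w2, w2_notMem, two_w2, fun h2 => w12 (W := W) ?_⟩
    have := sub_mem h1 h2
    rwa [show W.w1 - h - (W.w2 - h) = W.w1 - W.w2 by ring] at this
  · exact ⟨W.w1, w1_notMem, two_w1, h1⟩

lemma sub_mem_symm {W : WeierstrassData} {a b : ℂ} (h : a - b ∈ W.lattice) : b - a ∈ W.lattice := by
  rw [← neg_mem_iff, neg_sub]; exact h

lemma sub_mem_trans {W : WeierstrassData} {a b c : ℂ} (h : a - b ∈ W.lattice)
    (h' : b - c ∈ W.lattice) : a - c ∈ W.lattice := by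
  have := add_mem h h'
  rwa [sub_add_sub_cancel] at this

lemma half_triple {W : WeierstrassData} {a b c : ℂ} (ha : a ∉ W.lattice) (ha2 : 2 * a ∈ W.lattice)
    (hb : b ∉ W.lattice) (hb2 : 2 * b ∈ W.lattice) (hc : c ∉ W.lattice) (hc2 : 2 * c ∈ W.lattice)
    (hab : a - b ∉ W.lattice) (hac : a - c ∉ W.lattice) (hbc : b - c ∉ W.lattice) :
    (({W.P b, W.P c, W.P a} : Set ℂ) = {W.e1, W.e2, W.e3}) ∧
    ∀ h, h ∉ W.lattice → 2 * h ∈ W.lattice →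
      h - a ∈ W.lattice ∨ h - b ∈ W.lattice ∨ h - c ∈ W.lattice := by
  have key : ∀ {x y w : ℂ}, x - w ∈ W.lattice → y - w ∈ W.lattice → x - y ∈ W.lattice :=
    fun h1 h2 => sub_mem_trans h1 (sub_mem_symm h2)
  have pe : ∀ {x w : ℂ}, x - w ∈ W.lattice → W.P x = W.P w := by
    intro x w h
    have := P_per h w
    rwa [add_sub_cancel] at this
  constructor
  · ext z
    unfold WeierstrassData.e1 WeierstrassData.e2 WeierstrassData.e3
    simp only [mem_insert_iff, mem_singleton_iff]
    rcases half_class ha ha2 with h | h | h <;> rcases half_class hb hb2 with h' | h' | h' <;>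
      rcases half_class hc hc2 with h'' | h'' | h'' <;>
      first
        | exact absurd (key h h') hab
        | exact absurd (key h h'') hac
        | exact absurd (key h' h'') hbc
        | (rw [pe h, pe h', pe h''] <;> tauto)
  · intro x hx hx2
    rcases half_class ha ha2 with h | h | h <;> rcases half_class hb hb2 with h' | h' | h' <;>
      rcases half_class hc hc2 with h'' | h'' | h'' <;>
      first
        | exact absurd (key h h') hab
        | exact absurd (key h h'') hac
        | exact absurd (key h' h'') hbc
        | (rcases half_class hx hx2 with g | g | g <;>
            first
              | exact Or.inl (key g h)
              | exact Or.inr (Or.inl (key g h'))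
              | exact Or.inr (Or.inr (key g h'')))

namespace Ctx
variable {D : Ctx}

lemma half_orb {h : ℂ} (hh : h ∉ D.L) (h2 : 2 * h ∈ D.L) : ∃ K b, D.Orb K ∧ K b = h ∧
    D.t (2 * h) = 2 * b ∧ ∀ v, K v = 2 * h - K (2 * b - v) := by
  obtain ⟨K, hK, hKb⟩ := orb_exists hh (FF_half_re D.hω D.hω' hh h2)
  obtain ⟨h3, h4⟩ := hK.refl hK h2 (a := (D.F h).im) (b := (D.F h).im) (by rw [hKb]; ring)
  have h5 : D.t (2 * h) = 2 * (D.F h).im := by linarith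
  refine ⟨K, _, hK, hKb, h5, fun v => ?_⟩
  rw [h4 v, h5]

lemma Per.int {K : ℝ → ℂ} {T : ℝ} {l : ℂ} (h : D.Per K T l) (n : ℤ) (v : ℝ) :
    K (v + n * T) = K v + n * l := by
  induction n using Int.induction_on generalizing v with
  | zero => simp
  | succ n ih =>
    have := h.2.2.2 (v + n * T)
    have e := ih v
    push_cast at e ⊢
    rw [show v + ((n:ℝ) + 1) * T = v + n * T + T by ring, this, e]; ring
  | pred n ih =>
    have := h.2.2.2 (v + (-n - 1) * T)
    have e := ih v
    push_cast at e ⊢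
    rw [show v + (-(n:ℝ) - 1) * T + T = v + -n * T by ring, e] at this
    linear_combination -this

lemma int_mul_mem {l : ℂ} (hl : l ∈ D.L) (n : ℤ) : (n : ℂ) * l ∈ D.L := by
  obtain ⟨a, b, h⟩ := hl
  exact ⟨n * a, n * b, by rw [h]; push_cast; ring⟩

/-- minimal periods -/
lemma Orb.min_per {K : ℝ → ℂ} (hK : D.Orb K) (h : ∃ T l, D.Per K T l) :
    ∃ T l, D.Per K T l ∧ ∀ a b, K a - K b ∈ D.L → ∃ n : ℤ, a = b + n * T := by
  classical
  have h1 : ∃ n : ℕ, ∃ l, D.Per K (n * Real.pi) l := by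
    obtain ⟨T, l, hT⟩ := h
    obtain ⟨n, hn⟩ := t_int hT.2.1
    have hn' : T = n * Real.pi := by rw [← hn, hT.2.2.1]
    have hpos : 0 < (n : ℝ) := by
      have := hT.1
      rw [hn'] at this
      exact pos_of_mul_pos_left this Real.pi_pos.le
    have : 0 ≤ n := by exact_mod_cast hpos.le
    obtain ⟨m, rfl⟩ := Int.eq_ofNat_of_zero_le this
    refine ⟨m, l, ?_⟩
    rw [hn'] at hT
    exact_mod_cast hT
  obtain ⟨l, hl⟩ := Nat.find_spec h1
  set n0 := Nat.find h1 with hn0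
  refine ⟨n0 * Real.pi, l, hl, fun a b hab => ?_⟩
  set T := (n0 : ℝ) * Real.pi with hT
  have hTpos : 0 < T := hl.1
  set n := ⌊(a - b) / T⌋ with hn
  refine ⟨n, ?_⟩
  by_contra hne
  have f1 : (n : ℝ) * T ≤ a - b := (le_div_iff₀ hTpos).1 (Int.floor_le _)
  have f2 : a - b < (n + 1) * T := (div_lt_iff₀ hTpos).1 (Int.lt_floor_add_one _)
  have e1 := hl.int (-n) a
  set a' := a + ((-n : ℤ) : ℝ) * T with ha'
  have ha'' : a' = a - n * T := by rw [ha']; push_cast; ring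
  have hlt : b < a' := lt_of_le_of_ne (by linarith) (fun h => hne (by linarith))
  have hmem : K a - K b + ((-n : ℤ) : ℂ) * l ∈ D.L := add_mem hab (int_mul_mem hl.2.1 _)
  have hp := hK.per_of hmem (a := a') (b := b) (by rw [e1]; ring) hlt
  obtain ⟨m, hm⟩ := t_int hmem
  rw [hp.2.2.1] at hm
  have hmpos : 0 < (m : ℝ) := by
    have := hp.1
    rw [hm] at this
    exact pos_of_mul_pos_left this Real.pi_pos.le
  have : 0 ≤ m := by exact_mod_cast hmpos.le
  obtain ⟨m', rfl⟩ := Int.eq_ofNat_of_zero_le this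
  rw [hm] at hp
  have hmin := Nat.find_min' h1 (m := m') ⟨_, by exact_mod_cast hp⟩
  have : (n0 : ℝ) ≤ m' := by exact_mod_cast hmin
  have h6 : T ≤ m' * Real.pi := mul_le_mul_of_nonneg_right this Real.pi_pos.le
  have h7 : a' - b = m' * Real.pi := by rw [hm]; push_cast; ring
  linarith

/-- The two distinguished orbits. -/
lemma two_orbits (D : Ctx) : ∃ (K K1 : ℝ → ℂ) (l l1 : ℂ) (b T : ℝ),
    D.Orb K ∧ l ∈ D.L ∧ Tendsto K atTop (𝓝 0) ∧ (∀ x, K x = l - K (D.t l - x)) ∧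
    (∀ T l', ¬ D.Per K T l') ∧
    (∀ K', D.Orb K' → (∃ T l', D.Per K' T l') ∨ ∃ l' ∈ D.L, ∀ v, K' v = K (v - D.t l') + l') ∧
    D.Orb K1 ∧ D.Per K1 T l1 ∧ 2 * K1 b ∈ D.L ∧ (∀ x, K1 x = 2 * K1 b - K1 (2 * b - x)) ∧
    (∀ x y, K1 x - K1 y ∈ D.L → ∃ n : ℤ, x = y + n * T) ∧
    2 * K1 (b + T / 2) ∈ D.L ∧
    (({D.W.P (K1 b), D.W.P (K1 (b + T / 2)), D.W.P (K (D.t l / 2))} : Set ℂ) =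
      {D.W.e1, D.W.e2, D.W.e3}) ∧
    (∀ h, h ∉ D.L → 2 * h ∈ D.L → h - K (D.t l / 2) ∈ D.L ∨ h - K1 b ∈ D.L ∨
      h - K1 (b + T / 2) ∈ D.L) ∧ (∀ x y, K1 x - K y ∉ D.L) := by
  obtain ⟨K, l, hK, hl, hlim, hsym, hnp, hor⟩ := main_orbit D
  have hKa : 2 * K (D.t l / 2) = l := by
    have := hsym (D.t l / 2)
    rw [show D.t l - D.t l / 2 = D.t l / 2 by ring] at this
    linear_combination this
  have hinj : ∀ x y, K x - K y ∈ D.L → x = y := by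
    intro x y hxy
    by_contra hne
    rcases lt_or_gt_of_ne hne with h | h
    · exact hnp _ _ (hK.per_of (sub_mem_symm hxy) (a := y) (b := x) (by ring) h)
    · exact hnp _ _ (hK.per_of hxy (a := x) (b := y) (by ring) h)
  obtain ⟨h, hh, h2, hne⟩ := exists_other (W := D.W) (K (D.t l / 2))
  obtain ⟨K1, b, hK1, hb, htb, hsym1⟩ := half_orb hh h2
  have hper : ∃ T l', D.Per K1 T l' := by
    rcases hor K1 hK1 with h' | ⟨l', hl', hv⟩
    · exact h'
    · exfalso
      have e1 := hv b
      set w := b - D.t l' with hw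
      have e2 := hsym w
      have e3 : w = D.t l - w := by
        apply hinj
        have : K w - K (D.t l - w) = 2 * h - 2 * l' - l := by
          rw [← hb, e1]; linear_combination -e2
        rw [this]
        refine sub_mem (sub_mem h2 ?_) hl
        rw [two_mul]; exact add_mem hl' hl'
      apply hne
      rw [← hb, e1, show D.t l / 2 = w by linarith, add_sub_cancel_left]
      exact hl'
  obtain ⟨T, l1, hT, hmin⟩ := hK1.min_per hper
  have hdis : ∀ x y, K1 x - K y ∉ D.L := by
    intro x y hxy
    obtain ⟨e1, e2⟩ := hK.sub hK1 (sub_mem_symm hxy) (a := y) (b := x) (by ring)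
    apply hnp T l1
    refine ⟨hT.1, hT.2.1, hT.2.2.1, fun v => ?_⟩
    rw [e2, e2 v, show v + T - D.t (K y - K1 x) = v - D.t (K y - K1 x) + T by ring, hT.2.2.2]
    ring
  have hc : 2 * K1 (b + T / 2) ∈ D.L := by
    have e1 := hsym1 (b + T / 2)
    have e2 := hT.2.2.2 (b - T / 2)
    rw [show b - T / 2 + T = b + T / 2 by ring] at e2
    rw [show 2 * b - (b + T / 2) = b - T / 2 by ring] at e1
    have : 2 * K1 (b + T / 2) = 2 * h + l1 := by linear_combination e1 + e2
    rw [this]; exact add_mem h2 hT.2.1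
  have htrip := half_triple (W := D.W) (a := K (D.t l / 2)) (b := K1 b) (c := K1 (b + T / 2))
    (hK.2 _).1 (by rw [hKa]; exact hl) (hK1.2 _).1 (by rw [hb]; exact h2) (hK1.2 _).1 hc
    (fun h => hdis _ _ (sub_mem_symm h)) (fun h => hdis _ _ (sub_mem_symm h)) (by
      intro h'
      obtain ⟨n, hn⟩ := hmin _ _ h'
      have hTp := hT.1
      have : (2 * n + 1 : ℝ) = 0 := by
        have : (2 * n + 1 : ℝ) * T = 0 := by linarith
        rcases mul_eq_zero.1 this with h | h
        · exact h
        · linarith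
      have : 2 * n + 1 = 0 := by exact_mod_cast this
      omega)
  refine ⟨K, K1, l, l1, b, T, hK, hl, hlim, hsym, hnp, hor, hK1, hT, by rw [hb]; exact h2,
    by rw [hb]; exact hsym1, hmin, hc, htrip.1, htrip.2, hdis⟩

end Ctx
end Lame

namespace Lame
open scoped Topology
namespace Ctx
variable {D : Ctx}

lemma far_bound (D : Ctx) {δ : ℝ} (hδ : 0 < δ) : ∃ M : ℝ, ∀ k, k ∉ D.L →
    (∀ l ∈ D.L, δ ≤ ‖k - l‖) → |(D.F k).re| ≤ M := by
  obtain ⟨a, ha, h⟩ := uniform_of_local (D := D) (fun a k => k ∉ D.L →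
    (∀ l ∈ D.L, δ ≤ ‖k - l‖) → a * |(D.F k).re| ≤ 1) (by
      intro a b k hab h h1 h2
      exact (mul_le_mul_of_nonneg_right hab (abs_nonneg _)).trans (h h1 h2)) (by
      intro a k l hl h h1 h2
      rw [add_mem_iff hl] at h1
      rw [F_add hl h1]
      have := h h1 (fun l' hl' => by
        have := h2 (l' + l) (add_mem hl' hl)
        rwa [add_sub_add_right_eq_sub] at this)
      simpa using this) (by
      intro z
      by_cases hz : z ∈ D.L
      · refine ⟨1, one_pos, ?_⟩
        filter_upwards [Metric.ball_mem_nhds z hδ] with k hk _ h2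
        rw [mem_ball_iff_norm] at hk
        linarith [h2 z hz]
      · have hp : 0 < |(D.F z).re| + 1 := by positivity
        refine ⟨1 / (|(D.F z).re| + 1), by positivity, ?_⟩
        have hc : ContinuousAt (fun k => |(D.F k).re|) z :=
          (Complex.continuous_re.continuousAt.comp (F_cont hz)).abs
        filter_upwards [hc.eventually_lt_const (lt_add_one _)] with k hk _ _
        rw [one_div, inv_mul_le_one₀ hp]
        exact hk.le)
  refine ⟨1 / a, fun k h1 h2 => ?_⟩
  rw [le_div_iff₀ ha, mul_comm]
  exact h k h1 h2

lemma slice_continuous {K : ℝ → ℂ} (hK : D.Orb K) {H : ℝ → ℝ → ℂ} (hH0 : ∀ v, H v 0 = K v)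
    (hH : ∀ v b, D.Lift (D.F (K v)) 1 b (H v)) {S : ℝ} (hS : 0 ≤ S) : Continuous fun v => H v S := by
  have hEm : ∀ v s, 0 ≤ s → H v s ∈ D.E ∧ D.F (H v s) = v * I + s := by
    intro v s hs
    obtain ⟨h1, h2⟩ := (hH v (s + 1)).2 s ⟨hs, by linarith⟩
    refine ⟨h1, ?_⟩
    rw [h2, (hK.2 v).2, mul_one]
  have hnn : ∀ x : unitInterval, 0 ≤ (x : ℝ) * S := fun x => mul_nonneg x.2.1 hS
  let f : C(unitInterval × ℝ, ℂ) := ⟨fun p => (p.2 : ℂ) * I + ((p.1 : ℝ) * S : ℝ), by fun_prop⟩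
  let g : unitInterval × ℝ → D.E := fun p => ⟨H p.2 ((p.1 : ℝ) * S), (hEm _ _ (hnn _)).1⟩
  have hg := (p_locHomeo (D := D)).continuous_lift (T2Space.isSeparatedMap _) f (g := g) (by
    funext p
    exact (hEm _ _ (hnn _)).2) (by
    refine Continuous.subtype_mk ?_ _
    have e0 : (fun v => H v (((0 : unitInterval) : ℝ) * S)) = K := by
      funext v; rw [Set.Icc.coe_zero, zero_mul, hH0]
    change Continuous (fun v => H v (((0 : unitInterval) : ℝ) * S))
    rw [e0]
    exact hK.1) (by
    intro v
    refine Continuous.subtype_mk ?_ _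
    have := (hH v (S + 1)).1
    refine this.comp_continuous (by fun_prop) (fun x => ⟨hnn x, ?_⟩)
    have := mul_le_mul_of_nonneg_right x.2.2 hS
    linarith)
  have h1 : Continuous fun v : ℝ => ((g (1, v) : D.E) : ℂ) :=
    continuous_subtype_val.comp (hg.comp (by fun_prop))
  simpa [g] using h1

lemma Lift.add {a θ l : ℂ} {b : ℝ} {H : ℝ → ℂ} (h : D.Lift a θ b H) (hl : l ∈ D.L) :
    D.Lift (a + D.t l * I) θ b (fun s => H s + l) := by
  refine ⟨h.1.add continuousOn_const, fun s hs => ?_⟩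
  obtain ⟨h1, h2⟩ := h.2 s hs
  refine ⟨E_add hl h1, ?_⟩
  rw [F_add hl h1.1, h2]; ring

lemma per_crit {K : ℝ → ℂ} (hK : D.Orb K) {T : ℝ} {l : ℂ} (hT : D.Per K T l) :
    ∃ v b H, 0 < b ∧ H 0 = K v ∧ D.Lift (v * I) 1 b H ∧
      Tendsto (fun s => D.DF (H s)) (𝓝[<] b) (𝓝 0) := by
  by_contra hcon
  have h1 : ∀ v, ∃ H, H 0 = K v ∧ ∀ b, D.Lift (D.F (K v)) 1 b H := by
    intro v
    rcases ray_lift (hK.E v) (θ := 1) (by simp) with h | ⟨b, hb, H, h1, h2, h3⟩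
    · exact h
    · exact absurd ⟨v, b, H, hb, h1, (hK.2 v).2 ▸ h2, h3⟩ hcon
  choose H hH0 hH using h1
  obtain ⟨d, hd, hsep⟩ := exists_sep (W := D.W)
  obtain ⟨M, hM⟩ := far_bound D (δ := d / 4) (by linarith)
  set S := max M 0 + 1 with hS
  have hS0 : 0 ≤ S := by positivity
  have hSM : M < S := by have := le_max_left M 0; linarith
  have hc := slice_continuous hK hH0 hH hS0
  have hnear : ∀ v, ∃ l' ∈ D.L, ‖H v S - l'‖ < d / 4 := by
    intro v
    by_contra hcon
    push Not at hcon
    obtain ⟨h1, h2⟩ := (hH v (S + 1)).2 S ⟨hS0, by linarith⟩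
    have := hM _ h1.1 hcon
    rw [h2, (hK.2 v).2] at this
    simp only [mul_one, Complex.add_re, Complex.mul_re, Complex.I_re, Complex.I_im,
      Complex.ofReal_re, Complex.ofReal_im] at this
    rw [abs_of_nonneg (by simpa using hS0)] at this
    simp at this
    linarith
  choose m hm hmd using hnear
  have hconst : IsLocallyConstant m := by
    rw [IsLocallyConstant.iff_eventually_eq]
    intro v
    have := Metric.tendsto_nhds.1 (hc.tendsto v) (d / 4) (by linarith)
    filter_upwards [this] with x hx
    rw [dist_eq_norm] at hx
    have h2 := hsep (m x - m v) (sub_mem (hm _) (hm _)) (by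
      have e : m x - m v = (H x S - H v S) - (H x S - m x) + (H v S - m v) := by ring
      rw [e]
      refine (norm_add_le _ _).trans_lt ?_
      have := norm_sub_le (H x S - H v S) (H x S - m x)
      linarith [hmd x, hmd v])
    exact sub_eq_zero.1 h2
  have hm0 : m (0 + T) = m 0 := hconst.apply_eq_of_preconnectedSpace _ _
  have hadd : H (0 + T) S = H 0 S + l := by
    have hl1 := hH (0 + T) (S + 1)
    have hl2 := (hH 0 (S + 1)).add hT.2.1
    rw [(hK.2 _).2] at hl1 hl2
    have e : ((0 : ℝ) : ℂ) * I + D.t l * I = ((0 + T : ℝ) : ℂ) * I := by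
      rw [hT.2.2.1]; push_cast; ring
    rw [e] at hl2
    exact hl1.unique hl2 (s := 0) ⟨le_rfl, by linarith⟩ (by
      rw [hH0, hT.2.2.2]; simp only [hH0]) S ⟨hS0, by linarith⟩
  have hl0 : l = 0 := hsep l hT.2.1 (by
    have e : l = (H (0 + T) S - m (0 + T)) - (H 0 S - m 0) := by rw [hadd, hm0]; ring
    rw [e]
    have := norm_sub_le (H (0 + T) S - m (0 + T)) (H 0 S - m 0)
    linarith [hmd 0, hmd (0 + T)])
  have := hT.2.2.1
  rw [hl0, t_zero] at this
  linarith [hT.1]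

lemma crit_exists (D : Ctx) : ∃ ks, ks ∉ D.L ∧ D.DF ks = 0 ∧ 0 < (D.F ks).re ∧
    deriv D.W.P ks ≠ 0 := by
  obtain ⟨k, hk, hP⟩ := P_surj (W := D.W) (-D.W.Z D.ω / D.ω)
  have hω := D.ω_ne
  have hDF : D.DF k = 0 := by rw [DF, hP]; field_simp; ring
  have hu : (D.F k).re ≠ 0 := D.hns k hk hDF
  have h2 : 2 * k ∉ D.L := fun h => hu (FF_half_re D.hω D.hω' hk h)
  rcases lt_or_gt_of_ne hu with h | h
  · refine ⟨-k, by rwa [neg_mem_iff], ?_, ?_, ?_⟩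
    · rw [DF, P_even hk]; exact hDF
    · rw [F_neg]; simpa using h
    · exact P_deriv_ne (by rwa [neg_mem_iff]) (by rwa [mul_neg, neg_mem_iff])
  · exact ⟨k, hk, hDF, h, P_deriv_ne hk h2⟩

lemma crit_approach {ks : ℂ} (hks : ks ∉ D.L) (hd : D.DF ks = 0) (hu : 0 < (D.F ks).re)
    (hP : deriv D.W.P ks ≠ 0) {v b : ℝ} {H : ℝ → ℂ} (hb : 0 < b) (hH : D.Lift (v * I) 1 b H)
    (hlim : Tendsto (fun s => D.DF (H s)) (𝓝[<] b) (𝓝 0)) {U : Set ℂ} (hU : U ∈ 𝓝 ks) :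
    ∀ᶠ s in 𝓝[<] b, ∃ l ∈ D.L, H s - l ∈ U := by
  have hω := D.ω_ne
  have hVe : ∀ᶠ k in 𝓝 ks, k ∈ U ∧ k ∉ D.L ∧ 0 < (D.F k).re := by
    have hc : ContinuousAt (fun k => (D.F k).re) ks :=
      Complex.continuous_re.continuousAt.comp (F_cont hks)
    filter_upwards [hU, ev_notMem' hks, hc.eventually_const_lt hu] with k h1 h2 h3
    exact ⟨h1, h2, h3⟩
  obtain ⟨e, he, hs, hsub, r, hr, hball⟩ :=
    loc_inv ((P_an hks).hasStrictDerivAt) hP hVe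
  have hPlim : Tendsto (fun s => D.W.P (H s)) (𝓝[<] b) (𝓝 (D.W.P ks)) := by
    have h1 : Tendsto (fun s => (D.DF (H s) - D.W.Z D.ω) / D.ω) (𝓝[<] b)
        (𝓝 ((0 - D.W.Z D.ω) / D.ω)) := (hlim.sub_const _).div_const _
    have h2 : (0 - D.W.Z D.ω) / D.ω = D.W.P ks := by
      rw [div_eq_iff hω]; rw [DF] at hd; linear_combination -hd
    rw [h2] at h1
    refine h1.congr fun s => ?_
    rw [DF]; field_simp; ring
  have hI : ∀ᶠ s in 𝓝[<] b, s ∈ Ioo 0 b := Ioo_mem_nhdsLT hb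
  filter_upwards [hPlim.eventually (Metric.ball_mem_nhds _ hr), hI] with s hs1 hs2
  have ht := hball hs1
  set k := e.symm (D.W.P (H s)) with hk
  have hks' := e.map_target ht
  have hPk : D.W.P k = D.W.P (H s) := by rw [hk, ← he]; rw [e.right_inv]; rwa [he]
  obtain ⟨k1, k2, k3⟩ := hsub hks'
  obtain ⟨h1, h2⟩ := hH.2 s ⟨hs2.1.le, hs2.2⟩
  rcases (P_eq_iff h1.1 k2).1 hPk.symm with h | h
  · exact ⟨_, h, by rw [sub_sub_cancel]; exact k1⟩
  · exfalso
    have e1 := F_add h (k := -k) (by rwa [neg_mem_iff])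
    rw [show -k + (H s + k) = H s by ring, F_neg, h2] at e1
    have := congrArg Complex.re e1
    simp at this
    have := hs2.1
    change 0 < (D.F k).re at k3
    linarith

end Ctx
end Lame

namespace Lame
open scoped Topology

lemma sqrt_local {f : ℂ → ℂ} {a : ℂ} (hf : AnalyticAt ℂ f a) (h0 : f a = 0) (h1 : deriv f a = 0)
    (h2 : deriv (deriv f) a ≠ 0) : ∃ φ : ℂ → ℂ, AnalyticAt ℂ φ a ∧ φ a = 0 ∧ deriv φ a ≠ 0 ∧
      ∀ᶠ z in 𝓝 a, f z = φ z ^ 2 := by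
  obtain ⟨p, hp⟩ := hf
  have k1 : AnalyticAt ℂ (dslope f a) a := ⟨_, hp.has_fpower_series_dslope_fslope⟩
  obtain ⟨p', hp'⟩ := k1
  have hh : AnalyticAt ℂ (dslope (dslope f a) a) a := ⟨_, hp'.has_fpower_series_dslope_fslope⟩
  set h := dslope (dslope f a) a with hdef
  have hfac : ∀ z, f z = (z - a) ^ 2 * h z := by
    intro z
    have e1 := sub_smul_dslope f a z
    have e2 := sub_smul_dslope (dslope f a) a z
    rw [dslope_same, h1] at e2
    rw [h0] at e1
    simp only [sub_zero, smul_eq_mul] at e1 e2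
    rw [← e1, ← e2]; ring
  have hmul : ∀ q : ℂ → ℂ, AnalyticAt ℂ q a → HasDerivAt (fun z => (z - a) * q z) (q a) a := by
    intro q hq
    have := ((hasDerivAt_id a).sub_const a).mul hq.differentiableAt.hasDerivAt
    exact this.congr_deriv (by simp)
  have hha : h a ≠ 0 := by
    intro hha
    apply h2
    have e1 : deriv f =ᶠ[𝓝 a] fun z => (z - a) * (2 * h z + (z - a) * deriv h z) := by
      filter_upwards [hh.eventually_analyticAt] with z hz
      have e2 : f = fun z => (z - a) ^ 2 * h z := funext hfac
      rw [e2]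
      have := (((hasDerivAt_id z).sub_const a).pow 2).mul hz.differentiableAt.hasDerivAt
      have e3 := this.deriv
      simp only [id] at e3
      refine Eq.trans ?_ (e3.trans ?_)
      · rfl
      · simp; ring
    rw [e1.deriv_eq]
    rw [(hmul (fun z => 2 * h z + (z - a) * deriv h z) (by
      have := hh.deriv
      fun_prop)).deriv]
    simp [hha]
  obtain ⟨c, hc⟩ := IsAlgClosed.exists_pow_nat_eq (h a) (n := 2) (by norm_num)
  have hc0 : c ≠ 0 := by rintro rfl; apply hha; rw [← hc]; simp
  set q : ℂ → ℂ := fun z => c * (h z / h a) ^ (((2:ℕ) : ℂ)⁻¹) with hq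
  have hqa : q a = c := by simp [hq, div_self hha]
  have hqan : AnalyticAt ℂ q a := by
    refine analyticAt_const.mul (AnalyticAt.cpow ?_ analyticAt_const ?_)
    · exact hh.div analyticAt_const hha
    · rw [div_self hha]; exact one_mem_slitPlane
  refine ⟨fun z => (z - a) * q z, by fun_prop, by simp, ?_, ?_⟩
  · rw [(hmul q hqan).deriv, hqa]; exact hc0
  · refine Eventually.of_forall fun z => ?_
    rw [hfac z, mul_pow]
    congr 1
    rw [hq]; simp only
    rw [mul_pow, Complex.cpow_nat_inv_pow _ two_ne_zero, hc]
    field_simp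

namespace Ctx
variable {D : Ctx}

/-- The local picture near the critical point. -/
lemma crit_local {ks : ℂ} (hks : ks ∉ D.L) (hd : D.DF ks = 0) (hu : 0 < (D.F ks).re)
    (hP : deriv D.W.P ks ≠ 0) : ∃ (g : ℂ → ℂ) (U : Set ℂ) (ρ : ℝ), U ∈ 𝓝 ks ∧ 0 < ρ ∧
      ContinuousOn g (Metric.ball 0 ρ) ∧
      (∀ w ∈ Metric.ball (0:ℂ) ρ, D.F (g w) = D.F ks + w ^ 2 ∧ (w ≠ 0 → g w ∈ D.E)) ∧
      ∀ k ∈ U, ∃ w ∈ Metric.ball (0:ℂ) ρ, k = g w := by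
  have hFd : deriv D.F =ᶠ[𝓝 ks] D.DF := by
    filter_upwards [ev_notMem' hks] with k hk
    exact (F_hd hk).deriv
  obtain ⟨φ, hφ, hφ0, hφd, hφe⟩ := sqrt_local (f := fun k => D.F k - D.F ks) (a := ks)
    ((F_an hks).sub analyticAt_const) (by simp) (by
      rw [deriv_sub_const, hFd.eq_of_nhds, hd]) (by
      have e : deriv (fun k => D.F k - D.F ks) = deriv D.F := by
        funext k; rw [deriv_sub_const]
      rw [e, hFd.deriv_eq]
      have e2 : HasDerivAt D.DF (D.ω * deriv D.W.P ks) ks := by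
        have := ((P_an hks).differentiableAt.hasDerivAt.const_mul D.ω).const_add (D.W.Z D.ω)
        exact this
      rw [e2.deriv]
      exact mul_ne_zero D.ω_ne hP)
  have hVe : ∀ᶠ k in 𝓝 ks, k ∉ D.L ∧ D.F k - D.F ks = φ k ^ 2 ∧ (k ≠ ks → D.DF k ≠ 0) := by
    have hc : ContinuousAt (fun k => (D.F k).re) ks :=
      Complex.continuous_re.continuousAt.comp (F_cont hks)
    obtain ⟨d, hdd, hsep⟩ := exists_sep (W := D.W)
    filter_upwards [hφe, ev_notMem' hks, hc.eventually_const_lt hu, Metric.ball_mem_nhds ks hdd]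
      with k h1 h2 h3 h4
    refine ⟨h2, h1, fun hne h0 => ?_⟩
    have hPe : D.W.P k = D.W.P ks := by
      rw [DF] at h0 hd
      have : D.ω * (D.W.P k - D.W.P ks) = 0 := by linear_combination h0 - hd
      rcases mul_eq_zero.1 this with h | h
      · exact absurd h D.ω_ne
      · exact sub_eq_zero.1 h
    rcases (P_eq_iff h2 hks).1 hPe with h | h
    · rw [mem_ball_iff_norm] at h4
      exact hne (sub_eq_zero.1 (hsep _ h h4))
    · have e1 := F_add h (k := -ks) (by rwa [neg_mem_iff])
      rw [show -ks + (k + ks) = k by ring, F_neg] at e1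
      have := congrArg Complex.re e1
      simp at this
      linarith
  obtain ⟨e, he, hs, hsub, r, hr, hball⟩ := loc_inv (hφ.hasStrictDerivAt) hφd hVe
  rw [hφ0] at hball
  refine ⟨e.symm, e.source ∩ e ⁻¹' Metric.ball 0 r, r, ?_, hr, e.continuousOn_symm.mono hball,
    ?_, ?_⟩
  · refine inter_mem (e.open_source.mem_nhds hs) ?_
    refine (e.continuousAt hs).preimage_mem_nhds ?_
    rw [he, hφ0]
    exact Metric.ball_mem_nhds _ hr
  · intro w hw
    have hk := e.map_target (hball hw)
    obtain ⟨k1, k2, k3⟩ := hsub hk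
    have hφw : φ (e.symm w) = w := by rw [← he]; exact e.right_inv (hball hw)
    rw [hφw] at k2
    refine ⟨by linear_combination k2, fun hw0 => ⟨k1, k3 ?_⟩⟩
    rintro h
    rw [h, hφ0] at hφw
    exact hw0 hφw.symm
  · rintro k ⟨hk1, hk2⟩
    exact ⟨e k, hk2, (e.left_inv hk1).symm⟩

/-- An orbit reaches the point `p` at height `s`. -/
def Reach (D : Ctx) (b vs s : ℝ) (p : ℂ) (K : ℝ → ℂ) : Prop :=
  ∃ v H l, H 0 = K v ∧ D.Lift (v * I) 1 b H ∧ l ∈ D.L ∧ D.t l = v - vs ∧ H s = p + l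

lemma Reach.common {b vs s : ℝ} {p : ℂ} {K K' : ℝ → ℂ} (hs : s ∈ Ico 0 b)
    (h : D.Reach b vs s p K) (h' : D.Reach b vs s p K') : ∃ x y, K x - K' y ∈ D.L := by
  obtain ⟨v, H, l, h0, hH, hl, ht, hp⟩ := h
  obtain ⟨v', H', l', h0', hH', hl', ht', hp'⟩ := h'
  have h2 := hH'.add (sub_mem hl hl')
  have e : (v' : ℂ) * I + D.t (l - l') * I = v * I := by
    rw [sub_eq_add_neg, t_add hl (neg_mem hl'), t_neg hl', ht, ht']; push_cast; ring
  rw [e] at h2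
  have := hH.unique h2 hs (by rw [hp, hp']; ring) 0 ⟨le_rfl, hs.1.trans_lt hs.2⟩
  refine ⟨v, v', ?_⟩
  rw [← h0, ← h0', this, add_sub_cancel_left]
  exact sub_mem hl hl'

end Ctx
end Lame

namespace Lame
open scoped Topology
namespace Ctx
variable {D : Ctx}

lemma reach_exists (D : Ctx) : ∃ (b vs s : ℝ) (p q : ℂ), s ∈ Ico 0 b ∧ ∀ K, D.Orb K →
    (∃ T l, D.Per K T l) → D.Reach b vs s p K ∨ D.Reach b vs s q K := by
  obtain ⟨ks, hks, hd, hu, hP⟩ := crit_exists D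
  obtain ⟨g, U, ρ, hU, hρ, hgc, hg, hgU⟩ := crit_local hks hd hu hP
  set b := (D.F ks).re with hb
  set vs := (D.F ks).im with hvs
  have hFks : D.F ks = b + vs * I := (Complex.re_add_im _).symm
  set r := min (ρ / 2) (min 1 (b / 2)) with hr
  have hr0 : 0 < r := by positivity
  have hrρ : r < ρ := (min_le_left _ _).trans_lt (by linarith)
  have hr1 : r ≤ 1 := (min_le_right _ _).trans (min_le_left _ _)
  have hrb : r ≤ b / 2 := (min_le_right _ _).trans (min_le_right _ _)
  have hr2 : r ^ 2 < b := by nlinarith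
  have hr2' : 0 < r ^ 2 := by positivity
  refine ⟨b, vs, b - r ^ 2, g (1 * ((r : ℂ) * I)), g (-1 * ((r : ℂ) * I)),
    ⟨by linarith, by linarith⟩, ?_⟩
  rintro K hK ⟨T, lT, hT⟩
  obtain ⟨v, b', H, hb', hH0, hH, hlim⟩ := per_crit hK hT
  have hI : ∀ᶠ s in 𝓝[<] b', s ∈ Ioo 0 b' := Ioo_mem_nhdsLT hb'
  have hA : ∀ ε > 0, ∀ᶠ s in 𝓝[<] b', ∃ l ∈ D.L, H s - l ∈ U ∧ |s - b| < ε ∧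
      |v - D.t l - vs| < ε ∧ D.F (H s - l) = s + ((v - D.t l : ℝ) : ℂ) * I := by
    intro ε hε
    have hV : ∀ᶠ k in 𝓝 ks, k ∈ U ∧ ‖D.F k - D.F ks‖ < ε := by
      refine Filter.Eventually.and hU ?_
      filter_upwards [Metric.tendsto_nhds.1 (F_cont hks).tendsto ε hε] with k hk
      rwa [dist_eq_norm] at hk
    filter_upwards [crit_approach hks hd hu hP hb' hH hlim hV, hI] with s hs hs'
    obtain ⟨l, hl, hl1, hl2⟩ := hs
    obtain ⟨h1, h2⟩ := hH.2 s ⟨hs'.1.le, hs'.2⟩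
    have e1 : D.F (H s - l) = s + ((v - D.t l : ℝ) : ℂ) * I := by
      rw [sub_eq_add_neg, F_add (neg_mem hl) h1.1, h2, t_neg hl]; push_cast; ring
    refine ⟨l, hl, hl1, ?_, ?_, e1⟩
    · refine (le_trans ?_ (Complex.abs_re_le_norm _)).trans_lt hl2
      rw [e1, Complex.sub_re]; simp [hb]
    · refine (le_trans ?_ (Complex.abs_im_le_norm _)).trans_lt hl2
      rw [e1, Complex.sub_im]; simp [hvs]
  have hbb : b' = b := by
    by_contra hne
    have hε : 0 < |b' - b| / 2 := by
      have := abs_pos.2 (sub_ne_zero.2 hne)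
      linarith
    have h1 : ∀ᶠ s in 𝓝[<] b', |s - b'| < |b' - b| / 2 := by
      have : ∀ᶠ s in 𝓝 b', dist s b' < |b' - b| / 2 := Metric.ball_mem_nhds b' hε
      exact this.filter_mono nhdsWithin_le_nhds
    obtain ⟨s, ⟨l, -, -, h2, -⟩, h3⟩ := ((hA _ hε).and h1).exists
    have := abs_sub_le b' s b
    rw [abs_sub_comm b' s] at this
    linarith
  subst hbb
  have huniq : ∀ l l', l ∈ D.L → l' ∈ D.L → |v - D.t l - vs| < 1 → |v - D.t l' - vs| < 1 →
      D.t l = D.t l' := by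
    intro l l' hl hl' h1 h2
    obtain ⟨n, hn⟩ := t_int hl
    obtain ⟨n', hn'⟩ := t_int hl'
    have h3 : |((n - n' : ℤ) : ℝ) * Real.pi| < 2 := by
      have e : ((n - n' : ℤ) : ℝ) * Real.pi = (v - D.t l' - vs) - (v - D.t l - vs) := by
        rw [hn, hn']; push_cast; ring
      rw [e]
      have := abs_sub (v - D.t l' - vs) (v - D.t l - vs)
      linarith
    rw [abs_mul, abs_of_pos Real.pi_pos] at h3
    have h4 : |((n - n' : ℤ) : ℝ)| < 1 := by
      have := Real.pi_gt_three
      nlinarith [abs_nonneg ((n - n' : ℤ) : ℝ)]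
    have h5 : |n - n'| < 1 := by exact_mod_cast h4
    have h6 : n = n' := by
      have := Int.abs_lt_one_iff.1 h5
      omega
    rw [hn, hn', h6]
  have hexact : ∀ l, l ∈ D.L → |v - D.t l - vs| < 1 → D.t l = v - vs := by
    intro l hl h1
    by_contra hne
    have hpos : 0 < |v - D.t l - vs| := abs_pos.2 (fun h => hne (by linarith))
    obtain ⟨s, l', hl', -, -, h2, -⟩ := (hA _ hpos).exists
    have := huniq l l' hl hl' h1 (h2.trans h1)
    rw [this] at h2
    exact lt_irrefl _ h2
  have hI2 : ∀ᶠ s in 𝓝[<] b, s ∈ Ioo (b - r ^ 2) b := Ioo_mem_nhdsLT (by linarith)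
  obtain ⟨s, ⟨l, hl, hlU, -, hlt, hF⟩, hs⟩ := ((hA 1 one_pos).and hI2).exists
  have ht := hexact l hl hlt
  obtain ⟨w, hw, hgw⟩ := hgU _ hlU
  have hw2 : w ^ 2 = -((b - s : ℝ) : ℂ) := by
    have := (hg w hw).1
    rw [← hgw, hF, ht, hFks] at this
    push_cast at this ⊢
    linear_combination -this
  have hsq : ∀ x : ℝ, x ≤ b → ((Real.sqrt (b - x) : ℂ) * I) ^ 2 = -((b - x : ℝ) : ℂ) := by
    intro x hx
    rw [mul_pow, Complex.I_sq, ← Complex.ofReal_pow, Real.sq_sqrt (by linarith)]; ring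
  have main : ∀ σ : ℂ, σ ^ 2 = 1 → ‖σ‖ = 1 → w = σ * ((Real.sqrt (b - s) : ℂ) * I) →
      H (b - r ^ 2) = g (σ * ((r : ℂ) * I)) + l := by
    intro σ hσ hσn hwσ
    have hball : ∀ x ∈ Ico (b - r ^ 2) b, σ * ((Real.sqrt (b - x) : ℂ) * I) ∈
        Metric.ball (0:ℂ) ρ ∧ σ * ((Real.sqrt (b - x) : ℂ) * I) ≠ 0 := by
      intro x hx
      have hx1 := hx.1
      have hx2 := hx.2
      have hsp : 0 < Real.sqrt (b - x) := Real.sqrt_pos.2 (by linarith)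
      have hle : Real.sqrt (b - x) ≤ r := Real.sqrt_le_iff.2 ⟨hr0.le, by linarith⟩
      have hnn : ‖σ * ((Real.sqrt (b - x) : ℂ) * I)‖ = Real.sqrt (b - x) := by
        rw [norm_mul, hσn, norm_mul, Complex.norm_I, Complex.norm_real, Real.norm_of_nonneg hsp.le]
        ring
      constructor
      · rw [mem_ball_zero_iff, hnn]; linarith
      · rw [← norm_pos_iff, hnn]; exact hsp
    have hsub : Ico (b - r ^ 2) b ⊆ Ico 0 b := Ico_subset_Ico_left (by linarith)
    have := lift_unique (D := D) (f := H)
      (g := fun x : ℝ => g (σ * ((Real.sqrt (b - x) : ℂ) * I)) + l) (s := Ico (b - r ^ 2) b)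
      isPreconnected_Ico (hH.1.mono hsub) (by
        refine ContinuousOn.add ?_ continuousOn_const
        refine hgc.comp (Continuous.continuousOn ?_) (fun x hx => (hball x hx).1)
        fun_prop) (fun x hx => (hH.2 x (hsub hx)).1)
      (fun x hx => E_add hl ((hg _ (hball x hx).1).2 (hball x hx).2)) (by
        intro x hx
        have hx2 := hx.2
        rw [(hH.2 x (hsub hx)).2, F_add hl ((hg _ (hball x hx).1).2 (hball x hx).2).1,
          (hg _ (hball x hx).1).1, mul_pow, hσ, hsq x hx2.le, hFks, ht]
        push_cast; ring) (a := s) ⟨hs.1.le, hs.2⟩ (by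
        rw [← hwσ, ← hgw]; ring) (b - r ^ 2) ⟨le_rfl, by linarith⟩
    rw [this]
    rw [sub_sub_cancel, Real.sqrt_sq hr0.le]
  have hcases : w = 1 * ((Real.sqrt (b - s) : ℂ) * I) ∨ w = -1 * ((Real.sqrt (b - s) : ℂ) * I) := by
    have : w ^ 2 = ((Real.sqrt (b - s) : ℂ) * I) ^ 2 := by rw [hw2, hsq s hs.2.le]
    rcases sq_eq_sq_iff_eq_or_eq_neg.1 this with h | h
    · left; rw [h]; ring
    · right; rw [h]; ring
  rcases hcases with h | h
  · left
    exact ⟨v, H, l, hH0, hH, hl, ht, main 1 (by ring) (by simp) h⟩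
  · right
    exact ⟨v, H, l, hH0, hH, hl, ht, main (-1) (by ring) (by simp) h⟩

/-- Among three periodic orbits, two coincide modulo the lattice. -/
lemma per_three {K1 K2 K3 : ℝ → ℂ} (h1 : D.Orb K1) (h2 : D.Orb K2) (h3 : D.Orb K3)
    (p1 : ∃ T l, D.Per K1 T l) (p2 : ∃ T l, D.Per K2 T l) (p3 : ∃ T l, D.Per K3 T l) :
    (∃ x y, K1 x - K2 y ∈ D.L) ∨ (∃ x y, K1 x - K3 y ∈ D.L) ∨ (∃ x y, K2 x - K3 y ∈ D.L) := by
  obtain ⟨b, vs, s, p, q, hs, h⟩ := reach_exists D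
  rcases h K1 h1 p1 with r1 | r1 <;> rcases h K2 h2 p2 with r2 | r2 <;>
    rcases h K3 h3 p3 with r3 | r3 <;>
    first
      | exact Or.inl (r1.common hs r2)
      | exact Or.inr (Or.inl (r1.common hs r3))
      | exact Or.inr (Or.inr (r2.common hs r3))

lemma Per.neg {K : ℝ → ℂ} {T : ℝ} {l : ℂ} (h : D.Per K T l) : D.Per (fun v => -K (-v)) T l := by
  refine ⟨h.1, h.2.1, h.2.2.1, fun v => ?_⟩
  have := h.2.2.2 (-(v + T))
  rw [show -(v + T) + T = -v by ring] at this
  simp only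
  rw [this]; ring

/-- Complete description of the zero set of `u`. -/
lemma classify (D : Ctx) : ∃ (K K1 : ℝ → ℂ) (c b T : ℝ), 0 < T ∧
    D.Orb K ∧ D.Orb K1 ∧ Tendsto K atTop (𝓝 0) ∧
    (∀ x, K x + K (c - x) ∈ D.L) ∧ (∀ x y, K x - K y ∈ D.L → x = y) ∧
    (∀ x, K1 x + K1 (2 * b - x) ∈ D.L) ∧ (∀ x (n : ℤ), K1 (x + n * T) - K1 x ∈ D.L) ∧
    (∀ x y, K1 x - K1 y ∈ D.L → ∃ n : ℤ, x = y + n * T) ∧ (∀ x y, K1 x - K y ∉ D.L) ∧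
    (({D.W.P (K1 b), D.W.P (K1 (b + T / 2)), D.W.P (K (c / 2))} : Set ℂ) =
      {D.W.e1, D.W.e2, D.W.e3}) ∧
    (∀ k, k ∉ D.L → (D.F k).re = 0 → (∃ x, k - K x ∈ D.L) ∨ ∃ x, k - K1 x ∈ D.L) := by
  obtain ⟨K, K1, l, l1, b, T, hK, hl, hlim, hsym, hnp, hor, hK1, hT, h2b, hsym1, hmin, hc2, htrip,
    hhalf, hdis⟩ := two_orbits D
  refine ⟨K, K1, D.t l, b, T, hT.1, hK, hK1, hlim, ?_, ?_, ?_, ?_, hmin, hdis, htrip, ?_⟩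
  · intro x
    rw [hsym x, sub_add_cancel]; exact hl
  · intro x y hxy
    by_contra hne
    rcases lt_or_gt_of_ne hne with h | h
    · exact hnp _ _ (hK.per_of (sub_mem_symm hxy) (a := y) (b := x) (by ring) h)
    · exact hnp _ _ (hK.per_of hxy (a := x) (b := y) (by ring) h)
  · intro x
    rw [hsym1 x, sub_add_cancel]; exact h2b
  · intro x n
    rw [hT.int, add_sub_cancel_left]
    exact int_mul_mem hT.2.1 n
  · intro k hk hu
    obtain ⟨K', hK', hk'⟩ := orb_exists hk hu
    rcases hor K' hK' with ⟨T', l', hp⟩ | ⟨l', hl', hv⟩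
    · right
      have hconv : ∀ x y, K' x - K1 y ∈ D.L → ∃ z, k - K1 z ∈ D.L := by
        intro x y h
        obtain ⟨-, h1⟩ := hK'.sub hK1 h (a := x) (b := y) (by ring)
        refine ⟨(D.F k).im - D.t (K' x - K1 y), ?_⟩
        have := h1 (D.F k).im
        rw [hk'] at this
        rw [sub_eq_of_eq_add' this]
        exact h
      rcases per_three hK1 hK' hK'.neg ⟨T, l1, hT⟩ ⟨T', l', hp⟩ ⟨T', l', hp.neg⟩ with
        ⟨x, y, h⟩ | ⟨x, y, h⟩ | ⟨x, y, h⟩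
      · exact hconv y x (sub_mem_symm h)
      · refine hconv (-y) (2 * b - x) ?_
        have := hsym1 x
        have e : K' (-y) - K1 (2 * b - x) = (K1 x - -K' (-y)) - 2 * K1 b := by
          linear_combination -this
        rw [e]
        exact sub_mem h h2b
      · obtain ⟨h1, h2⟩ := hK'.refl hK' (l := K' x - -K' (-y)) h (a := x) (b := -y) (by ring)
        set m := K' x - -K' (-y) with hm
        have h3 : 2 * K' (D.t m / 2) = m := by
          have := h2 (D.t m / 2)
          rw [show D.t m - D.t m / 2 = D.t m / 2 by ring] at this
          linear_combination this
        rcases hhalf (K' (D.t m / 2)) (hK'.2 _).1 (by rw [h3]; exact h) with g | g | g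
        · exfalso
          obtain ⟨-, e2⟩ := hK.sub hK' (sub_mem_symm g) (a := D.t l / 2) (b := D.t m / 2) (by ring)
          set m' := K (D.t l / 2) - K' (D.t m / 2)
          apply hnp T' l'
          refine ⟨hp.1, hp.2.1, hp.2.2.1, fun v => ?_⟩
          rw [e2, e2 v, show v + T' - D.t m' = v - D.t m' + T' by ring, hp.2.2.2]
          ring
        · exact hconv _ _ g
        · exact hconv _ _ g
    · left
      refine ⟨(D.F k).im - D.t l', ?_⟩
      have := hv (D.F k).im
      rw [hk'] at this
      rw [sub_eq_of_eq_add' this]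
      exact hl'

end Ctx
end Lame

namespace Lame
open scoped Topology

/-- An even real-analytic function is an analytic function of the square. -/
lemma even_an {E : Type*} [NormedAddCommGroup E] [NormedSpace ℝ E] [CompleteSpace E] {f : ℝ → E}
    (hf : AnalyticAt ℝ f 0) (he : ∀ᶠ s in 𝓝 0, f (-s) = f s) :
    ∃ g : ℝ → E, AnalyticAt ℝ g 0 ∧ ∀ᶠ s in 𝓝 0, g (s ^ 2) = f s := by
  obtain ⟨p, hp⟩ := hf
  set q : FormalMultilinearSeries ℝ ℝ E := fun n =>
    ContinuousMultilinearMap.mkPiRing ℝ (Fin n) (p.coeff (2 * n)) with hq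
  have hqn : ∀ n, ‖q n‖ = ‖p.coeff (2 * n)‖ := fun n => by
    rw [hq]; simp
  have hrad : 0 < p.radius := hp.radius_pos
  obtain ⟨r, hr0, hr⟩ := ENNReal.lt_iff_exists_nnreal_btwn.1 hrad
  obtain ⟨C, hC, hb⟩ := p.norm_mul_pow_le_of_lt_radius hr
  have hr0' : 0 < r := by exact_mod_cast hr0
  have hqr : ((r ^ 2 : NNReal) : ENNReal) ≤ q.radius := by
    refine q.le_radius_of_bound C fun n => ?_
    rw [hqn]
    have h1 := hb (2 * n)
    have h2 : ‖p.coeff (2 * n)‖ = ‖p (2 * n)‖ := p.norm_apply_eq_norm_coef.symm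
    rw [h2]
    push_cast
    rwa [← pow_mul]
  have hqpos : 0 < q.radius := lt_of_lt_of_le (by exact_mod_cast pow_pos hr0' 2) hqr
  have hg := q.hasFPowerSeriesOnBall hqpos
  refine ⟨q.sum, hg.analyticAt, ?_⟩
  have hs := hp.eventually_hasSum
  have hneg : Tendsto (fun s : ℝ => -s) (𝓝 0) (𝓝 0) := by
    simpa using (continuous_neg (G := ℝ)).tendsto 0
  filter_upwards [hs, hneg.eventually hs, he] with s h1 h2 h3
  rw [zero_add] at h1 h2
  have h4 := (h1.add h2).const_smul (2⁻¹ : ℝ)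
  rw [h3, ← two_smul ℝ (f s), smul_smul, inv_mul_cancel₀ two_ne_zero, one_smul] at h4
  have hinj : Function.Injective (fun n : ℕ => 2 * n) := fun a b h => by simpa using h
  rw [← hinj.hasSum_iff] at h4
  · rw [FormalMultilinearSeries.sum]
    refine Eq.trans (tsum_congr fun n => ?_) h4.tsum_eq
    simp only [Function.comp, FormalMultilinearSeries.apply_eq_pow_smul_coeff]
    rw [(even_two_mul n).neg_pow, ← two_smul ℝ, smul_smul, inv_mul_cancel₀ two_ne_zero, one_smul,
      pow_mul]
    congr 1
    rw [FormalMultilinearSeries.coeff, hq]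
    simp
  · intro n hn
    have hodd : Odd n := by
      rw [← Nat.not_even_iff_odd]
      rintro ⟨m, hm⟩
      exact hn ⟨m, by simp only; omega⟩
    simp only [FormalMultilinearSeries.apply_eq_pow_smul_coeff]
    rw [hodd.neg_pow, neg_smul, add_neg_cancel, smul_zero]

lemma deriv_ne_of_comp {γ f : ℝ → ℂ} {τ : ℝ → ℝ} {x : ℝ} (hγ : DifferentiableAt ℝ γ (τ x))
    (hτ : DifferentiableAt ℝ τ x) (h : ∀ᶠ y in 𝓝 x, γ (τ y) = f y) (hf : deriv f x ≠ 0) :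
    deriv γ (τ x) ≠ 0 := by
  intro h0
  apply hf
  have h1 : HasDerivAt (fun y => γ (τ y)) (deriv τ x • deriv γ (τ x)) x :=
    hγ.hasDerivAt.scomp x hτ.hasDerivAt
  have h2 : f =ᶠ[𝓝 x] fun y => γ (τ y) := h.mono fun y hy => hy.symm
  rw [(h1.congr_of_eventuallyEq h2).deriv, h0, smul_zero]

lemma sq_lim {E : Type*} [NormedAddCommGroup E] [NormedSpace ℝ E] {f g : ℝ → E} {A : E}
    (hg : AnalyticAt ℝ g 0) (h : ∀ᶠ s in 𝓝 0, g (s ^ 2) = f s)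
    (hA : Tendsto (fun s : ℝ => (s ^ 2)⁻¹ • (f s - f 0)) (𝓝[≠] 0) (𝓝 A)) : deriv g 0 = A := by
  have h1 := hg.differentiableAt.hasDerivAt.tendsto_slope
  have h2 : Tendsto (fun s : ℝ => s ^ 2) (𝓝[≠] 0) (𝓝[≠] 0) := by
    refine tendsto_nhdsWithin_iff.2 ⟨?_, ?_⟩
    · have : Continuous fun s : ℝ => s ^ 2 := by fun_prop
      have := this.tendsto 0
      simp only [ne_eq, OfNat.ofNat_ne_zero, not_false_eq_true, zero_pow] at this
      exact this.mono_left nhdsWithin_le_nhds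
    · filter_upwards [self_mem_nhdsWithin] with s hs
      exact pow_ne_zero 2 hs
  have h3 := h1.comp h2
  refine tendsto_nhds_unique (h3.congr' ?_) hA
  have h0 := h.self_of_nhds
  simp only [ne_eq, OfNat.ofNat_ne_zero, not_false_eq_true, zero_pow] at h0
  filter_upwards [h.filter_mono nhdsWithin_le_nhds] with s hs
  simp only [Function.comp, slope_def_module]
  rw [hs, h0, sub_zero]

lemma arc_end {f : ℝ → ℂ} {τ : ℝ → ℝ} (hf : AnalyticAt ℝ f 0) (hτ : AnalyticAt ℝ τ 0)
    (hfe : ∀ᶠ s in 𝓝 0, f (-s) = f s) (hτe : ∀ᶠ s in 𝓝 0, τ (-s) = τ s) (hτ0 : τ 0 = 0)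
    {A : ℂ} {B : ℝ} (hA0 : A ≠ 0) (hB0 : B ≠ 0)
    (hA : Tendsto (fun s : ℝ => (s ^ 2)⁻¹ • (f s - f 0)) (𝓝[≠] 0) (𝓝 A))
    (hB : Tendsto (fun s : ℝ => (s ^ 2)⁻¹ • (τ s - τ 0)) (𝓝[≠] 0) (𝓝 B)) :
    ∃ γ : ℝ → ℂ, AnalyticAt ℝ γ 0 ∧ deriv γ 0 ≠ 0 ∧ ∀ᶠ s in 𝓝 0, γ (τ s) = f s := by
  obtain ⟨g1, a1, e1⟩ := even_an hf hfe
  obtain ⟨g2, a2, e2⟩ := even_an hτ hτe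
  have d1 := sq_lim a1 e1 hA
  have d2 := sq_lim a2 e2 hB
  have hg20 : g2 0 = 0 := by
    have := e2.self_of_nhds
    simpa [hτ0] using this
  have d2' : deriv g2 0 ≠ 0 := by rw [d2]; exact hB0
  obtain ⟨e, he, hs, -, -⟩ := loc_inv (a2.hasStrictDerivAt) d2' univ_mem
  have an := loc_inv_an a2 d2' he hs
  rw [hg20] at an
  have hes : e.symm 0 = 0 := by
    have := e.left_inv hs
    rwa [he, hg20] at this
  have hγ : AnalyticAt ℝ (fun t => g1 (e.symm t)) 0 := by
    refine AnalyticAt.comp' (g := g1) ?_ an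
    rw [hes]; exact a1
  have hsrc : ∀ᶠ y in 𝓝 0, y ∈ e.source := e.open_source.mem_nhds hs
  have hinv : ∀ᶠ y in 𝓝 0, e.symm (g2 y) = y := by
    filter_upwards [hsrc] with y hy
    have := e.left_inv hy
    rwa [he] at this
  refine ⟨_, hγ, ?_, ?_⟩
  · have := deriv_ne_of_comp (γ := fun t => g1 (e.symm t)) (τ := g2) (x := 0) (f := g1)
      (by rw [hg20]; exact hγ.differentiableAt) a2.differentiableAt
      (hinv.mono fun y hy => by simp only [hy]) (by rw [d1]; exact hA0)
    rwa [hg20] at this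
  · have hsq : Tendsto (fun s : ℝ => s ^ 2) (𝓝 0) (𝓝 0) := by
      have : Continuous fun s : ℝ => s ^ 2 := by fun_prop
      simpa using this.tendsto 0
    filter_upwards [e1, e2, hsq.eventually hinv] with s h1 h2 h3
    rw [← h2, h3, h1]

lemma arc_interior {f : ℝ → ℂ} {τ ρ : ℝ → ℝ} {x t : ℝ} (hf : AnalyticAt ℝ f x)
    (hτ : AnalyticAt ℝ τ x) (hf' : deriv f x ≠ 0) (hτ' : deriv τ x ≠ 0) (hρ : ContinuousAt ρ t)
    (hx : ρ t = x) (hinv : ∀ᶠ y in 𝓝 t, τ (ρ y) = y) :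
    AnalyticAt ℝ (fun y => f (ρ y)) t ∧ deriv (fun y => f (ρ y)) t ≠ 0 := by
  obtain ⟨e, he, hs, -, -⟩ := loc_inv (hτ.hasStrictDerivAt) hτ' univ_mem
  have an := loc_inv_an hτ hτ' he hs
  have hτx : τ x = t := by rw [← hx]; exact hinv.self_of_nhds
  rw [hτx] at an
  have h1 : e.symm =ᶠ[𝓝 t] ρ := by
    have : ∀ᶠ y in 𝓝 t, ρ y ∈ e.source := hρ.eventually (by
      rw [hx]; exact e.open_source.mem_nhds hs)
    filter_upwards [this, hinv] with y h1 h2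
    have := e.left_inv h1
    rwa [he, h2] at this
  have hρa : AnalyticAt ℝ ρ t := an.congr h1
  have ha : AnalyticAt ℝ (fun y => f (ρ y)) t := by
    refine AnalyticAt.comp' (g := f) ?_ hρa
    rw [hx]; exact hf
  refine ⟨ha, ?_⟩
  have h2 : ∀ᶠ y in 𝓝 x, ρ (τ y) = y := by
    have h3 : ∀ᶠ y in 𝓝 x, e.symm (τ y) = ρ (τ y) := by
      have := hτ.continuousAt.tendsto
      rw [hτx] at this
      exact this.eventually h1
    filter_upwards [h3, e.open_source.mem_nhds hs] with y h4 h5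
    have := e.left_inv h5
    rw [he, h4] at this
    exact this
  have := deriv_ne_of_comp (γ := fun y => f (ρ y)) (τ := τ) (x := x) (f := f)
    (by rw [hτx]; exact ha.differentiableAt) hτ.differentiableAt
    (h2.mono fun y hy => by simp only [hy]) hf'
  rwa [hτx] at this

end Lame

namespace Lame
open scoped Topology

namespace Ctx

variable {D : Ctx}

/-- The spectral parameter along an orbit. -/
def lam (D : Ctx) (K : ℝ → ℂ) (x : ℝ) : ℂ := -D.ω ^ 2 * D.W.P (K x)

lemma lam_an {K : ℝ → ℂ} (h : D.Orb K) (x : ℝ) : AnalyticAt ℝ (D.lam K) x := by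
  have h1 : AnalyticAt ℝ D.W.P (K x) := (P_an (h.2 x).1).restrictScalars
  have h2 : AnalyticAt ℝ (fun x => D.W.P (K x)) x :=
    AnalyticAt.fun_comp h1 (h.hasDerivAt_analytic x).1
  exact analyticAt_const.mul h2

lemma lam_deriv {K : ℝ → ℂ} (h : D.Orb K) {x : ℝ} (h2 : 2 * K x ∉ D.L) :
    deriv (D.lam K) x ≠ 0 := by
  have hP := (P_an (h.2 x).1).differentiableAt.hasDerivAt
  have hK := (h.hasDerivAt_analytic x).1.differentiableAt.hasDerivAt
  have h3 : HasDerivAt (fun x => D.W.P (K x)) (deriv D.W.P (K x) * deriv K x) x := by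
    have := HasDerivAt.scomp (𝕜' := ℂ) x hP hK
    simpa [Function.comp_def, mul_comm] using this
  have h4 : HasDerivAt (D.lam K) (-D.ω ^ 2 * (deriv D.W.P (K x) * deriv K x)) x :=
    h3.const_mul _
  rw [h4.deriv]
  exact mul_ne_zero (neg_ne_zero.2 (pow_ne_zero _ D.ω_ne))
    (mul_ne_zero (P_deriv_ne (h.2 x).1 h2) (h.hasDerivAt_analytic x).2)

lemma lam_eq_iff {K K' : ℝ → ℂ} (h : D.Orb K) (h' : D.Orb K') {x y : ℝ} :
    D.lam K x = D.lam K' y ↔ K x - K' y ∈ D.L ∨ K x + K' y ∈ D.L := by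
  rw [← P_eq_iff (h.2 x).1 (h'.2 y).1, lam, lam]
  exact mul_right_inj' (neg_ne_zero.2 (pow_ne_zero _ D.ω_ne))

lemma orb_end {K : ℝ → ℂ} (h : D.Orb K) {x0 : ℝ} (hsym : ∀ s, K (x0 + s) + K (x0 - s) ∈ D.L)
    {τ : ℝ → ℝ} {B : ℝ} (hτ : AnalyticAt ℝ τ 0) (hτe : ∀ s, τ (-s) = τ s) (hτ0 : τ 0 = 0)
    (hB0 : B ≠ 0) (hB : Tendsto (fun s : ℝ => (s ^ 2)⁻¹ • (τ s - τ 0)) (𝓝[≠] 0) (𝓝 B)) :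
    ∃ γ : ℝ → ℂ, AnalyticAt ℝ γ 0 ∧ deriv γ 0 ≠ 0 ∧
      ∀ᶠ s in 𝓝 0, γ (τ s) = D.lam K (x0 + s) := by
  have hk := (h.2 x0).1
  have h2k : 2 * K x0 ∈ D.L := by
    have := hsym 0
    simp only [add_zero, sub_zero] at this
    rwa [two_mul]
  obtain ⟨c, hc, hlim⟩ := P_half_sq hk h2k
  obtain ⟨hKa, hKd⟩ := h.hasDerivAt_analytic x0
  have hK := hKa.differentiableAt.hasDerivAt
  have hKs : HasDerivAt (fun s => K (x0 + s)) (deriv K x0) 0 := by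
    have := HasDerivAt.comp_const_add (f := K) (f' := deriv K x0) x0 0 (by simpa using hK)
    exact this
  have hslope : Tendsto (fun s : ℝ => s⁻¹ • (K (x0 + s) - K x0)) (𝓝[≠] 0) (𝓝 (deriv K x0)) := by
    have := hKs.tendsto_slope_zero
    simpa using this
  have hne : ∀ᶠ s : ℝ in 𝓝[≠] 0, K (x0 + s) ≠ K x0 := by
    have := hKs.eventually_ne (c := K x0) hKd
    simpa using this
  have htend : Tendsto (fun s : ℝ => K (x0 + s)) (𝓝[≠] 0) (𝓝[≠] (K x0)) := by
    refine tendsto_nhdsWithin_of_tendsto_nhds_of_eventually_within _ ?_ hne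
    have := hKs.continuousAt.tendsto
    simp only [add_zero] at this
    exact this.mono_left nhdsWithin_le_nhds
  have hA : Tendsto (fun s : ℝ => (s ^ 2)⁻¹ • (D.lam K (x0 + s) - D.lam K (x0 + 0))) (𝓝[≠] 0)
      (𝓝 (-D.ω ^ 2 * (c * deriv K x0 ^ 2))) := by
    have := ((hlim.comp htend).mul (hslope.pow 2)).const_mul (-D.ω ^ 2)
    refine this.congr' ?_
    filter_upwards [hne, self_mem_nhdsWithin] with s hs hs0
    have hs1 : K (x0 + s) - K x0 ≠ 0 := sub_ne_zero.2 hs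
    have hs0' : (s : ℂ) ≠ 0 := by exact_mod_cast hs0
    simp only [Function.comp_apply, lam, add_zero, Complex.real_smul]
    push_cast
    field_simp
    ring
  refine arc_end (f := fun s => D.lam K (x0 + s)) ?_ hτ ?_ (Eventually.of_forall hτe) hτ0
    ?_ hB0 hA hB
  · refine AnalyticAt.fun_comp (g := D.lam K) (f := fun s : ℝ => x0 + s) (lam_an h _) ?_
    exact analyticAt_const.add analyticAt_id
  · refine Eventually.of_forall fun s => ?_
    refine (lam_eq_iff h h).2 (Or.inr ?_)
    have := hsym s
    rw [add_comm, ← sub_eq_add_neg]; exact this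
  · exact mul_ne_zero (neg_ne_zero.2 (pow_ne_zero _ D.ω_ne)) (mul_ne_zero hc (pow_ne_zero _ hKd))

lemma inf_arc {K : ℝ → ℂ} {c : ℝ} (h : D.Orb K) (h0 : Tendsto K atTop (𝓝 0))
    (hsym : ∀ x, K x + K (c - x) ∈ D.L) (hinj : ∀ x y, K x - K y ∈ D.L → x = y) :
    ∃ γ : ℝ → ℂ, AnalyticOnNhd ℝ γ (Ici 0) ∧ (∀ t ∈ Ici (0:ℝ), deriv γ t ≠ 0) ∧
      InjOn γ (Ici 0) ∧ γ '' Ici 0 = range (D.lam K) ∧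
      Tendsto (fun t => ‖γ t‖) atTop atTop ∧ γ 0 = D.lam K (c / 2) := by
  obtain ⟨γe, ha, hd, he⟩ := orb_end (D := D) h (x0 := c / 2) (τ := fun s => s ^ 2) (B := 1)
    (fun s => by
      have := hsym (c / 2 + s)
      rwa [show c - (c / 2 + s) = c / 2 - s by ring] at this)
    (by fun_prop) (fun s => by ring) (by simp) one_ne_zero (by
      refine tendsto_const_nhds.congr' ?_
      filter_upwards [self_mem_nhdsWithin] with s hs
      have hs' : s ≠ 0 := hs
      simp only [smul_eq_mul]
      field_simp
      ring)
  set γ : ℝ → ℂ := fun t => if t < 0 then γe t else D.lam K (c / 2 + √t) with hγ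
  have hpos : ∀ t, 0 ≤ t → γ t = D.lam K (c / 2 + √t) := fun t ht => by
    simp only [hγ, if_neg (not_lt.2 ht)]
  have hsqrt0 : Tendsto (fun t : ℝ => √t) (𝓝 0) (𝓝 0) := by
    simpa using Real.continuous_sqrt.tendsto 0
  have hev0 : γe =ᶠ[𝓝 0] γ := by
    filter_upwards [hsqrt0.eventually he] with t ht
    by_cases h1 : t < 0
    · simp only [hγ, if_pos h1]
    · rw [hpos t (not_lt.1 h1), ← ht, Real.sq_sqrt (not_lt.1 h1)]
  have h2ne : ∀ x : ℝ, 2 * K (c / 2 + x) ∈ D.L → x = 0 := fun x hx => by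
    have h1 := hsym (c / 2 + x)
    have h2 := sub_mem hx h1
    rw [show 2 * K (c / 2 + x) - (K (c / 2 + x) + K (c - (c / 2 + x)))
      = K (c / 2 + x) - K (c - (c / 2 + x)) by ring] at h2
    have := hinj _ _ h2
    linarith
  have hall : ∀ t ∈ Ici (0:ℝ), AnalyticAt ℝ γ t ∧ deriv γ t ≠ 0 := by
    intro t ht
    rcases eq_or_lt_of_le (mem_Ici.1 ht) with rfl | ht
    · exact ⟨ha.congr hev0, by rw [← hev0.deriv_eq]; exact hd⟩
    · have hst : 0 < √t := Real.sqrt_pos.2 ht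
      have hev : (fun y => D.lam K (c / 2 + √y)) =ᶠ[𝓝 t] γ := by
        filter_upwards [lt_mem_nhds ht] with y hy
        exact (hpos y hy.le).symm
      have := arc_interior (f := fun x => D.lam K (c / 2 + x)) (τ := fun x => x ^ 2)
        (ρ := fun t => √t) (x := √t) (t := t)
        (AnalyticAt.fun_comp (g := D.lam K) (f := fun s : ℝ => c / 2 + s) (lam_an h _)
          (analyticAt_const.add analyticAt_id)) (by fun_prop)
        (by
          rw [deriv_comp_const_add]
          exact lam_deriv h fun hh => hst.ne' (h2ne _ hh))
        (by simp [hst.ne']) Real.continuous_sqrt.continuousAt rfl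
        (by filter_upwards [lt_mem_nhds ht] with y hy; exact Real.sq_sqrt hy.le)
      exact ⟨this.1.congr hev, by rw [← hev.deriv_eq]; exact this.2⟩
  refine ⟨γ, fun t ht => (hall t ht).1, fun t ht => (hall t ht).2, ?_, ?_, ?_, ?_⟩
  · intro t ht s hs hts
    rw [mem_Ici] at ht hs
    rw [hpos t ht, hpos s hs, lam_eq_iff h h] at hts
    rw [← Real.sqrt_inj ht hs]
    rcases hts with hts | hts
    · have := hinj _ _ hts; linarith
    · have h1 := sub_mem hts (hsym (c / 2 + √s))
      rw [show K (c / 2 + √t) + K (c / 2 + √s) - (K (c / 2 + √s) + K (c - (c / 2 + √s)))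
        = K (c / 2 + √t) - K (c - (c / 2 + √s)) by ring] at h1
      have := hinj _ _ h1
      have := Real.sqrt_nonneg t
      have := Real.sqrt_nonneg s
      linarith
  · ext z
    constructor
    · rintro ⟨t, ht, rfl⟩
      exact ⟨_, (hpos t ht).symm⟩
    · rintro ⟨x, rfl⟩
      refine ⟨(x - c / 2) ^ 2, mem_Ici.2 (sq_nonneg _), ?_⟩
      rw [hpos _ (sq_nonneg _), Real.sqrt_sq_eq_abs, lam_eq_iff h h]
      rcases abs_cases (x - c / 2) with ⟨h1, -⟩ | ⟨h1, -⟩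
      · left
        rw [h1, show c / 2 + (x - c / 2) = x by ring, sub_self]; exact zero_mem
      · right
        rw [h1, show c / 2 + -(x - c / 2) = c - x by ring, add_comm]; exact hsym x
  · have h1 : Tendsto (fun t : ℝ => c / 2 + √t) atTop atTop :=
      tendsto_atTop_add_const_left _ _ Real.tendsto_sqrt_atTop
    have h2 : Tendsto K atTop (𝓝[≠] 0) :=
      tendsto_nhdsWithin_of_tendsto_nhds_of_eventually_within _ h0
        (Eventually.of_forall fun x hx => (h.2 x).1 (by
          rw [mem_singleton_iff.1 hx]; exact zero_mem))
    have h3 := ((P_tendsto_zero (W := D.W)).comp (h2.comp h1)).const_mul_atTop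
      (norm_pos_iff.2 (neg_ne_zero.2 (pow_ne_zero 2 D.ω_ne)))
    refine h3.congr' ?_
    filter_upwards [eventually_ge_atTop 0] with t ht
    rw [hpos t ht, lam, norm_mul]; rfl
  · rw [hpos 0 le_rfl]; simp

end Ctx

end Lame

namespace Lame
open scoped Topology

namespace Ctx

variable {D : Ctx}

lemma fin_arc {K : ℝ → ℂ} {b T : ℝ} (hT : 0 < T) (h : D.Orb K)
    (hsym : ∀ x, K x + K (2 * b - x) ∈ D.L)
    (hper : ∀ x (n : ℤ), K (x + n * T) - K x ∈ D.L)
    (hinj : ∀ x y, K x - K y ∈ D.L → ∃ n : ℤ, x = y + n * T) :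
    ∃ γ : ℝ → ℂ, AnalyticOnNhd ℝ γ (Icc 0 1) ∧ (∀ t ∈ Icc (0:ℝ) 1, deriv γ t ≠ 0) ∧
      InjOn γ (Icc 0 1) ∧ γ '' Icc 0 1 = range (D.lam K) ∧
      γ 0 = D.lam K b ∧ γ 1 = D.lam K (b + T / 2) := by
  have hpi := Real.pi_pos
  set a : ℝ := Real.pi / T with ha_def
  have ha0 : 0 < a := div_pos hpi hT
  have haT : a * (T / 2) = Real.pi / 2 := by rw [ha_def]; field_simp
  set τ : ℝ → ℝ := fun x => Real.sin (a * x) ^ 2 with hτ_def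
  have hτa : ∀ x, AnalyticAt ℝ τ x := fun x => by
    have h1 : AnalyticAt ℝ (fun x : ℝ => a * x) x := by fun_prop
    exact (AnalyticAt.fun_comp (g := Real.sin) Real.analyticAt_sin h1).pow 2
  have hτd : ∀ x, HasDerivAt τ (2 * Real.sin (a * x) * (Real.cos (a * x) * a)) x := fun x => by
    have h1 : HasDerivAt (fun x => a * x) a x := by
      simpa using (hasDerivAt_id x).const_mul a
    have := (h1.sin).fun_pow 2
    simpa using this
  have hτe : ∀ s, τ (-s) = τ s := fun s => by simp [hτ_def]
  have hτ0 : τ 0 = 0 := by simp [hτ_def]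
  have hB0 : a ^ 2 ≠ 0 := (pow_pos ha0 2).ne'
  have hB : Tendsto (fun s : ℝ => (s ^ 2)⁻¹ • (τ s - τ 0)) (𝓝[≠] 0) (𝓝 (a ^ 2)) := by
    have h1 : HasDerivAt (fun x : ℝ => Real.sin (a * x)) a 0 := by
      have h1 : HasDerivAt (fun x => a * x) a 0 := by
        simpa using (hasDerivAt_id (0:ℝ)).const_mul a
      simpa using h1.sin
    have h2 := (h1.tendsto_slope_zero).pow 2
    refine h2.congr fun s => ?_
    simp only [hτ_def, smul_eq_mul, zero_add, mul_zero, Real.sin_zero, sub_zero]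
    ring
  have hsymb : ∀ s, K (b + s) + K (b - s) ∈ D.L := fun s => by
    have := hsym (b + s)
    rwa [show 2 * b - (b + s) = b - s by ring] at this
  have hsymT : ∀ s, K (b + T / 2 + s) + K (b + T / 2 - s) ∈ D.L := fun s => by
    have h1 := hsym (b + T / 2 + s)
    have h2 := hper (2 * b - (b + T / 2 + s)) 1
    rw [show 2 * b - (b + T / 2 + s) + ((1:ℤ):ℝ) * T = b + T / 2 - s by push_cast; ring] at h2
    have := add_mem h1 h2
    rwa [show K (b + T / 2 + s) + K (2 * b - (b + T / 2 + s)) + (K (b + T / 2 - s)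
      - K (2 * b - (b + T / 2 + s))) = K (b + T / 2 + s) + K (b + T / 2 - s) by ring] at this
  obtain ⟨γ0, ha_0, hd0, he0⟩ := orb_end (D := D) h hsymb (hτa 0) hτe hτ0 hB0 hB
  obtain ⟨γ1, ha_1, hd1, he1⟩ := orb_end (D := D) h hsymT (hτa 0) hτe hτ0 hB0 hB
  set ρ : ℝ → ℝ := fun t => Real.arcsin (√t) / a with hρ_def
  have hρc : Continuous ρ := by
    have := Real.continuous_arcsin.comp Real.continuous_sqrt
    exact this.div_const a
  have haρ : ∀ t, a * ρ t = Real.arcsin (√t) := fun t => by simp only [hρ_def]; field_simp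
  have hρ0 : ρ 0 = 0 := by simp [hρ_def]
  have hρ1 : ρ 1 = T / 2 := by
    have := haρ 1
    rw [Real.sqrt_one, Real.arcsin_one, ← haT] at this
    exact mul_left_cancel₀ ha0.ne' this
  have hτρ : ∀ t, 0 ≤ t → t ≤ 1 → τ (ρ t) = t := fun t h0 h1 => by
    simp only [hτ_def]
    rw [haρ, Real.sin_arcsin (by linarith [Real.sqrt_nonneg t]) (Real.sqrt_le_one.2 h1), Real.sq_sqrt h0]
  have hρn : ∀ t, 0 ≤ ρ t := fun t => div_nonneg (Real.arcsin_nonneg.2 (Real.sqrt_nonneg t)) ha0.le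
  have hρT : ∀ t, ρ t ≤ T / 2 := fun t => by
    rw [← mul_le_mul_iff_right₀ ha0, haρ, haT]; exact Real.arcsin_le_pi_div_two _
  set γ : ℝ → ℂ := fun t => if t < 0 then γ0 t else if 1 < t then γ1 (1 - t)
    else D.lam K (b + ρ t) with hγ
  have hpos : ∀ t, 0 ≤ t → t ≤ 1 → γ t = D.lam K (b + ρ t) := fun t ht ht1 => by
    simp only [hγ, if_neg (not_lt.2 ht), if_neg (not_lt.2 ht1)]
  have hev0 : γ0 =ᶠ[𝓝 0] γ := by
    have h1 : Tendsto ρ (𝓝 0) (𝓝 0) := by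
      have := hρc.tendsto 0
      rwa [hρ0] at this
    filter_upwards [h1.eventually he0, gt_mem_nhds (zero_lt_one (α := ℝ))] with t ht ht1
    by_cases h1 : t < 0
    · simp only [hγ, if_pos h1]
    · rw [hpos t (not_lt.1 h1) ht1.le, ← ht, hτρ t (not_lt.1 h1) ht1.le]
  have hτ1 : ∀ x, τ (x - T / 2) = 1 - τ x := fun x => by
    simp only [hτ_def]
    rw [mul_sub, haT, Real.sin_sub_pi_div_two, neg_sq, ← Real.sin_sq_add_cos_sq (a * x)]
    ring
  have hev1 : (fun t => γ1 (1 - t)) =ᶠ[𝓝 1] γ := by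
    have h1 : Tendsto (fun t => ρ t - T / 2) (𝓝 1) (𝓝 0) := by
      have := (hρc.sub continuous_const).tendsto (f := fun t => ρ t - T / 2) 1
      rwa [hρ1, sub_self] at this
    filter_upwards [h1.eventually he1, lt_mem_nhds (zero_lt_one (α := ℝ))] with t ht ht1
    by_cases h1 : 1 < t
    · simp only [hγ, if_neg (not_lt.2 ht1.le), if_pos h1]
    · rw [hpos t ht1.le (not_lt.1 h1)]
      rw [hτ1, hτρ t ht1.le (not_lt.1 h1)] at ht
      rw [ht]; congr 1; ring
  have hnT : ∀ (x : ℝ) (n : ℤ), 0 < x → x < T → x ≠ n * T := by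
    intro x n h0 h1 hx
    rw [hx] at h0 h1
    have h2 : (0:ℝ) < n := by
      by_contra hc
      have := mul_nonpos_of_nonpos_of_nonneg (not_lt.1 hc) hT.le
      linarith
    have h3 : (n:ℝ) < 1 := by
      by_contra hc
      have := mul_le_mul_of_nonneg_right (not_lt.1 hc) hT.le
      linarith
    have h4 : (0:ℤ) < n := by exact_mod_cast h2
    have h5 : n < (1:ℤ) := by exact_mod_cast h3
    omega
  have h2ne : ∀ x : ℝ, 0 < x → x < T / 2 → 2 * K (b + x) ∉ D.L := fun x hx0 hxT hx => by
    have h2 := sub_mem hx (hsymb x)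
    rw [show 2 * K (b + x) - (K (b + x) + K (b - x)) = K (b + x) - K (b - x) by ring] at h2
    obtain ⟨n, hn⟩ := hinj _ _ h2
    exact hnT (2 * x) n (by linarith) (by linarith) (by linarith)
  have hall : ∀ t ∈ Icc (0:ℝ) 1, AnalyticAt ℝ γ t ∧ deriv γ t ≠ 0 := by
    intro t ht
    obtain ⟨ht0, ht1⟩ := mem_Icc.1 ht
    rcases eq_or_lt_of_le ht0 with rfl | ht0
    · exact ⟨ha_0.congr hev0, by rw [← hev0.deriv_eq]; exact hd0⟩
    rcases eq_or_lt_of_le ht1 with rfl | ht1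
    · have h1 : AnalyticAt ℝ (fun t => γ1 (1 - t)) 1 := by
        refine AnalyticAt.fun_comp (g := γ1) (f := fun t : ℝ => 1 - t) ?_ (by fun_prop)
        simpa using ha_1
      refine ⟨h1.congr hev1, ?_⟩
      rw [← hev1.deriv_eq, deriv_comp_const_sub]
      simpa using hd1
    · have hr0 : ρ t ≠ 0 := fun hc => by
        have := hτρ t ht0.le ht1.le
        rw [hc, hτ0] at this; exact ht0.ne this
      have hr1 : ρ t ≠ T / 2 := fun hc => by
        have := hτρ t ht0.le ht1.le
        rw [hc] at this
        simp only [hτ_def, haT, Real.sin_pi_div_two, one_pow] at this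
        exact ht1.ne' this
      have hr0' : 0 < ρ t := lt_of_le_of_ne (hρn t) hr0.symm
      have hr1' : ρ t < T / 2 := lt_of_le_of_ne (hρT t) hr1
      have hx0 : 0 < a * ρ t := mul_pos ha0 hr0'
      have hx1 : a * ρ t < Real.pi / 2 := by rw [← haT]; exact mul_lt_mul_of_pos_left hr1' ha0
      have hev : (fun y => D.lam K (b + ρ y)) =ᶠ[𝓝 t] γ := by
        filter_upwards [lt_mem_nhds ht0, gt_mem_nhds ht1] with y hy hy1
        exact (hpos y hy.le hy1.le).symm
      have := arc_interior (f := fun x => D.lam K (b + x)) (τ := τ)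
        (ρ := ρ) (x := ρ t) (t := t)
        (AnalyticAt.fun_comp (g := D.lam K) (f := fun s : ℝ => b + s) (lam_an h _)
          (analyticAt_const.add analyticAt_id)) (hτa _)
        (by
          rw [deriv_comp_const_add]
          exact lam_deriv h (h2ne _ hr0' hr1'))
        (by
          rw [(hτd _).deriv]
          have h1 := Real.sin_pos_of_pos_of_lt_pi hx0 (by linarith)
          have h2 := Real.cos_pos_of_mem_Ioo (x := a * ρ t) ⟨by linarith, hx1⟩
          positivity) hρc.continuousAt rfl
        (by filter_upwards [lt_mem_nhds ht0, gt_mem_nhds ht1] with y hy hy1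
            exact hτρ y hy.le hy1.le)
      exact ⟨this.1.congr hev, by rw [← hev.deriv_eq]; exact this.2⟩
  refine ⟨γ, fun t ht => (hall t ht).1, fun t ht => (hall t ht).2, ?_, ?_, ?_, ?_⟩
  · intro t ht s hs hts
    obtain ⟨ht0, ht1⟩ := mem_Icc.1 ht
    obtain ⟨hs0, hs1⟩ := mem_Icc.1 hs
    rw [hpos t ht0 ht1, hpos s hs0 hs1, lam_eq_iff h h] at hts
    suffices hr : ρ t = ρ s by rw [← hτρ t ht0 ht1, hr, hτρ s hs0 hs1]
    have i1 := hρn t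
    have i2 := hρn s
    have i3 := hρT t
    have i4 := hρT s
    by_contra hne
    rcases hts with hts | hts
    · obtain ⟨n, hn⟩ := hinj _ _ hts
      rcases lt_or_gt_of_ne hne with hl | hl
      · exact hnT (ρ s - ρ t) (-n) (by linarith) (by linarith) (by push_cast; linarith)
      · exact hnT (ρ t - ρ s) n (by linarith) (by linarith) (by linarith)
    · have h1 := sub_mem hts (hsymb (ρ s))
      rw [show K (b + ρ t) + K (b + ρ s) - (K (b + ρ s) + K (b - ρ s))
        = K (b + ρ t) - K (b - ρ s) by ring] at h1
      obtain ⟨n, hn⟩ := hinj _ _ h1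
      refine hnT (ρ t + ρ s) n ?_ ?_ (by linarith)
      · rcases lt_or_gt_of_ne hne with hl | hl <;> linarith
      · rcases lt_or_gt_of_ne hne with hl | hl <;> linarith
  · ext z
    constructor
    · rintro ⟨t, ht, rfl⟩
      exact ⟨_, (hpos t ht.1 ht.2).symm⟩
    · rintro ⟨x, rfl⟩
      have key : ∃ y, 0 ≤ y ∧ y ≤ T / 2 ∧ D.lam K (b + y) = D.lam K x := by
        set n : ℤ := round ((x - b) / T) with hn
        have h1 := abs_sub_round ((x - b) / T)
        rw [← hn] at h1
        have h2 : |x - b - n * T| ≤ T / 2 := by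
          have e1 : x - b - n * T = ((x - b) / T - n) * T := by field_simp
          rw [e1, abs_mul, abs_of_pos hT]
          have := mul_le_mul_of_nonneg_right h1 hT.le
          linarith
        refine ⟨|x - b - n * T|, abs_nonneg _, h2, ?_⟩
        rw [lam_eq_iff h h]
        have h3 := hper (x - n * T) n
        rw [show x - n * T + n * T = x by ring] at h3
        rcases abs_cases (x - b - n * T) with ⟨h4, -⟩ | ⟨h4, -⟩
        · left
          rw [h4, show b + (x - b - n * T) = x - n * T by ring]
          exact sub_mem_symm h3
        · right
          rw [h4, show b + -(x - b - n * T) = 2 * b - (x - n * T) by ring]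
          have := add_mem (hsym (x - n * T)) h3
          rwa [show K (x - n * T) + K (2 * b - (x - n * T)) + (K x - K (x - n * T))
            = K (2 * b - (x - n * T)) + K x by ring] at this
      obtain ⟨y, hy0, hyT, hy⟩ := key
      have i1 : 0 ≤ a * y := mul_nonneg ha0.le hy0
      have i2 : a * y ≤ Real.pi / 2 := by rw [← haT]; exact mul_le_mul_of_nonneg_left hyT ha0.le
      have i3 : 0 ≤ Real.sin (a * y) := Real.sin_nonneg_of_nonneg_of_le_pi i1 (by linarith)
      have i4 : τ y ∈ Icc (0:ℝ) 1 := mem_Icc.2 ⟨sq_nonneg _, Real.sin_sq_le_one _⟩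
      refine ⟨τ y, i4, ?_⟩
      rw [hpos _ i4.1 i4.2, ← hy]
      congr 2
      apply mul_left_cancel₀ ha0.ne'
      rw [haρ]
      simp only [hτ_def]
      rw [Real.sqrt_sq i3, Real.arcsin_sin (by linarith) i2]
  · rw [hpos 0 le_rfl zero_le_one, hρ0, add_zero]
  · rw [hpos 1 zero_le_one le_rfl, hρ1]

theorem arcs (D : Ctx) : ∃ γf γi : ℝ → ℂ,
      AnalyticOnNhd ℝ γf (Icc 0 1) ∧ (∀ t ∈ Icc (0:ℝ) 1, deriv γf t ≠ 0) ∧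
        InjOn γf (Icc 0 1) ∧
      AnalyticOnNhd ℝ γi (Ici 0) ∧ (∀ t ∈ Ici (0:ℝ), deriv γi t ≠ 0) ∧
        InjOn γi (Ici 0) ∧
      {lam | ∃ k, k ∉ D.W.lattice ∧ (FF D.W D.ω k).re = 0 ∧ lam = -D.ω ^ 2 * D.W.P k}
        = γf '' Icc 0 1 ∪ γi '' Ici 0 ∧
      (γf '' Icc 0 1) ∩ (γi '' Ici 0) = ∅ ∧
      Tendsto (fun t => ‖γi t‖) atTop atTop ∧
      Bornology.IsBounded (γf '' Icc 0 1) ∧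
      ({γf 0, γf 1, γi 0} : Set ℂ)
        = {-D.ω ^ 2 * D.W.e1, -D.ω ^ 2 * D.W.e2, -D.ω ^ 2 * D.W.e3} := by
  obtain ⟨K, K1, c, b, T, hT, hK, hK1, h0, hsym, hinj, hsym1, hper1, hinj1, hdis, hends, hcov⟩ :=
    D.classify
  obtain ⟨γi, i1, i2, i3, i4, i5, i6⟩ := inf_arc hK h0 hsym hinj
  obtain ⟨γf, f1, f2, f3, f4, f5, f6⟩ := fin_arc hT hK1 hsym1 hper1 hinj1
  refine ⟨γf, γi, f1, f2, f3, i1, i2, i3, ?_, ?_, i5, ?_, ?_⟩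
  · rw [f4, i4]
    ext z
    constructor
    · rintro ⟨k, hk, hu, rfl⟩
      rcases hcov k hk hu with ⟨x, hx⟩ | ⟨x, hx⟩
      · right
        refine ⟨x, ?_⟩
        rw [lam, (P_eq_iff hk (hK.2 x).1).2 (Or.inl hx)]
      · left
        refine ⟨x, ?_⟩
        rw [lam, (P_eq_iff hk (hK1.2 x).1).2 (Or.inl hx)]
    · rintro (⟨x, rfl⟩ | ⟨x, rfl⟩)
      · exact ⟨_, (hK1.2 x).1, hK1.u x, rfl⟩
      · exact ⟨_, (hK.2 x).1, hK.u x, rfl⟩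
  · rw [f4, i4, eq_empty_iff_forall_notMem]
    rintro z ⟨⟨x, rfl⟩, ⟨y, hy⟩⟩
    rcases (lam_eq_iff hK1 hK).1 hy.symm with h | h
    · exact hdis _ _ h
    · have := sub_mem h (hsym y)
      rw [show K1 x + K y - (K y + K (c - y)) = K1 x - K (c - y) by ring] at this
      exact hdis _ _ this
  · exact (isCompact_Icc.image_of_continuousOn f1.continuousOn).isBounded
  · rw [f5, f6, i6]
    have := congrArg (fun s => (fun z => -D.ω ^ 2 * z) '' s) hends
    simpa only [image_insert_eq, image_singleton, lam] using this

end Ctx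

end Lame

/-- Under the non-degeneracy conditions `η + ωeⱼ ≠ 0` and the
non-singularity condition `u(k*) ≠ 0`, the spectrum of the `m = 1` complex Lamé
operator `L = -d²/dx² + 2ω²℘(ωx+z₀)` consists of exactly two non-intersecting
regular analytic arcs; precisely one arc extends to infinity, and the three
remaining endpoints are `-ω²e₁, -ω²e₂, -ω²e₃`. -/
theorem lameSpectrum_two_arcs
    (W : WeierstrassData) (ω : ℂ) (hω : 2 * ω ∈ W.lattice) (hω' : ω ∉ W.lattice)
    (z0 : ℂ) (hz0 : ∀ x : ℝ, ω * x + z0 ∉ W.lattice)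
    (hnd : W.Z ω + ω * W.e1 ≠ 0 ∧ W.Z ω + ω * W.e2 ≠ 0 ∧ W.Z ω + ω * W.e3 ≠ 0)
    (hns : ∀ k ∉ W.lattice, W.Z ω + ω * W.P k = 0 → W.uFun ω k ≠ 0) :
    ∃ γf γi : ℝ → ℂ,
      -- the finite arc: regular, analytic, simple
      AnalyticOnNhd ℝ γf (Set.Icc 0 1) ∧ (∀ t ∈ Set.Icc (0:ℝ) 1, deriv γf t ≠ 0) ∧
        Set.InjOn γf (Set.Icc 0 1) ∧
      -- the infinite arc: regular, analytic, simple
      AnalyticOnNhd ℝ γi (Set.Ici 0) ∧ (∀ t ∈ Set.Ici (0:ℝ), deriv γi t ≠ 0) ∧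
        Set.InjOn γi (Set.Ici 0) ∧
      -- the spectrum is the union of the two arcs, and they do not intersect
      W.lameSpectrum 1 ω z0 = γf '' Set.Icc 0 1 ∪ γi '' Set.Ici 0 ∧
      (γf '' Set.Icc 0 1) ∩ (γi '' Set.Ici 0) = ∅ ∧
      -- precisely one arc extends to infinity
      Filter.Tendsto (fun t => ‖γi t‖) Filter.atTop Filter.atTop ∧
      Bornology.IsBounded (γf '' Set.Icc 0 1) ∧
      -- the three remaining endpoints
      ({γf 0, γf 1, γi 0} : Set ℂ)
        = {-ω ^ 2 * W.e1, -ω ^ 2 * W.e2, -ω ^ 2 * W.e3} := by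
  rw [Lame.spec_iff hz0 hω hω']
  exact Lame.Ctx.arcs ⟨W, ω, hω, hω', hns⟩
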